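/- arXiv:1208.1361 — 18 statements merged into one kernel-verified Lean document; each statement's English description precedes it below -/
import Mathlib

section
/- Let M be a finite set and let 𝒰 and ℬ be two partitions of M such that every part of 𝒰 and every part of ℬ has exactly n elements (n ≥ 1), and let μ be the common number of parts of 𝒰 and of ℬ. Then there exists a subset X ⊆ M with μ elements such that for every x ∈ X there is exactly one part U ∈ 𝒰 and exactly one part B ∈ ℬ with X ∩ U = X ∩ B = {x}; in other words, X is a common system of distinct representatives of 𝒰 and ℬ: every part of 𝒰 and every part of ℬ contains exactly one element of X. -/
/-- Hall's condition for two families of `n`-element sets: if the sets of `𝒰` are pairwise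
disjoint and covered by `ℬ`, there is an injection from `𝒰` to `ℬ` sending each set to one
that it meets. -/
theorem exists_injective_inter_nonempty {α : Type*} [DecidableEq α] {n : ℕ} (hn : 1 ≤ n)
    (𝒰 ℬ : Finset (Finset α))
    (hUcard : ∀ U ∈ 𝒰, U.card = n) (hBcard : ∀ B ∈ ℬ, B.card = n)
    (hdisj : ∀ U ∈ 𝒰, ∀ V ∈ 𝒰, ∀ x, x ∈ U → x ∈ V → U = V)
    (hcover : ∀ U ∈ 𝒰, ∀ x ∈ U, ∃ B ∈ ℬ, x ∈ B) :
    ∃ f : {U // U ∈ 𝒰} → Finset α, Function.Injective f ∧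
      ∀ U, f U ∈ ℬ ∧ (U.1 ∩ f U).Nonempty := by
  obtain ⟨f, hf, hmem⟩ := (Finset.all_card_le_biUnion_card_iff_exists_injective
    (fun U : {U // U ∈ 𝒰} => ℬ.filter fun B => (U.1 ∩ B).Nonempty)).1 (by
      intro s
      set N := s.biUnion fun U : {U // U ∈ 𝒰} => ℬ.filter fun B => (U.1 ∩ B).Nonempty
      have hunion : (s.biUnion fun U => U.1).card = s.card * n := by
        rw [Finset.card_biUnion]
        · exact Finset.sum_const_nat fun U _ => hUcard _ U.2
        · intro U _ V _ hne
          exact Finset.disjoint_left.2 fun x hx hy =>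
            hne (Subtype.ext (hdisj _ U.2 _ V.2 x hx hy))
      have hsub : (s.biUnion fun U => U.1) ⊆ N.biUnion id := by
        intro x hx
        obtain ⟨U, hU, hxU⟩ := Finset.mem_biUnion.1 hx
        obtain ⟨B, hB, hxB⟩ := hcover _ U.2 x hxU
        exact Finset.mem_biUnion.2 ⟨B, Finset.mem_biUnion.2 ⟨U, hU, Finset.mem_filter.2
          ⟨hB, x, Finset.mem_inter.2 ⟨hxU, hxB⟩⟩⟩, hxB⟩
      have hle : (N.biUnion id).card ≤ N.card * n := by
        refine Finset.card_biUnion_le_card_mul _ _ _ fun B hB => ?_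
        obtain ⟨U, _, hBU⟩ := Finset.mem_biUnion.1 hB
        exact (hBcard B (Finset.mem_filter.1 hBU).1).le
      have := Finset.card_le_card hsub
      exact Nat.le_of_mul_le_mul_right (hunion ▸ this.trans hle) hn)
  exact ⟨f, hf, fun U => Finset.mem_filter.1 (hmem U)⟩

/-- Van der Waerden's theorem on common systems of distinct representatives:
if `𝒰` and `ℬ` are partitions of a finite set `M` into parts of size exactly `n`
(`n ≥ 1`), both with `μ` parts, then there is a set `X ⊆ M` of `μ` elements
meeting every part of `𝒰` and every part of `ℬ` in exactly one element. -/
theorem stmt0 {α : Type*} [DecidableEq α] (M : Finset α) (n μ : ℕ) (hn : 1 ≤ n)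
    (𝒰 ℬ : Finset (Finset α))
    (hUsub : ∀ U ∈ 𝒰, U ⊆ M) (hBsub : ∀ B ∈ ℬ, B ⊆ M)
    (hUcard : ∀ U ∈ 𝒰, U.card = n) (hBcard : ∀ B ∈ ℬ, B.card = n)
    (hUpart : ∀ x ∈ M, ∃! U, U ∈ 𝒰 ∧ x ∈ U)
    (hBpart : ∀ x ∈ M, ∃! B, B ∈ ℬ ∧ x ∈ B)
    (hμU : 𝒰.card = μ) (hμB : ℬ.card = μ) :
    ∃ X : Finset α, X ⊆ M ∧ X.card = μ ∧
      (∀ U ∈ 𝒰, ∃ x ∈ X, X ∩ U = {x}) ∧ (∀ B ∈ ℬ, ∃ x ∈ X, X ∩ B = {x}) := by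
  have hUdisj : ∀ U ∈ 𝒰, ∀ V ∈ 𝒰, ∀ x, x ∈ U → x ∈ V → U = V := fun U hU V hV x hx hy =>
    (hUpart x (hUsub U hU hx)).unique ⟨hU, hx⟩ ⟨hV, hy⟩
  have hBdisj : ∀ U ∈ ℬ, ∀ V ∈ ℬ, ∀ x, x ∈ U → x ∈ V → U = V := fun U hU V hV x hx hy =>
    (hBpart x (hBsub U hU hx)).unique ⟨hU, hx⟩ ⟨hV, hy⟩
  obtain ⟨f, hf, hfB⟩ := exists_injective_inter_nonempty hn 𝒰 ℬ hUcard hBcard hUdisj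
    fun U hU x hx => (hBpart x (hUsub U hU hx)).exists
  choose g hg using fun U => (hfB U).2
  have hgU : ∀ U, g U ∈ U.1 := fun U => (Finset.mem_inter.1 (hg U)).1
  have hgB : ∀ U, g U ∈ f U := fun U => (Finset.mem_inter.1 (hg U)).2
  have hginj : Function.Injective g := fun U V h =>
    Subtype.ext (hUdisj _ U.2 _ V.2 (g U) (hgU U) (h ▸ hgU V))
  have hsurj : Finset.univ.image f = ℬ := by
    refine Finset.eq_of_subset_of_card_le ?_ ?_
    · exact Finset.image_subset_iff.2 fun U _ => (hfB U).1
    · rw [Finset.card_image_of_injective _ hf, Finset.card_univ, Fintype.card_coe, hμU, hμB]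
  refine ⟨Finset.univ.image g, Finset.image_subset_iff.2 fun U _ => hUsub _ U.2 (hgU U), ?_,
    fun U hU => ⟨g ⟨U, hU⟩, Finset.mem_image_of_mem _ (Finset.mem_univ _), ?_⟩, fun B hB => ?_⟩
  · rw [Finset.card_image_of_injective _ hginj, Finset.card_univ, Fintype.card_coe, hμU]
  · refine Finset.eq_singleton_iff_unique_mem.2 ⟨Finset.mem_inter.2
      ⟨Finset.mem_image_of_mem _ (Finset.mem_univ _), hgU ⟨U, hU⟩⟩, fun x hx => ?_⟩
    obtain ⟨hx, hxU⟩ := Finset.mem_inter.1 hx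
    obtain ⟨V, -, rfl⟩ := Finset.mem_image.1 hx
    exact congrArg g (Subtype.ext (hUdisj _ V.2 _ hU _ (hgU V) hxU))
  · obtain ⟨U, -, rfl⟩ := Finset.mem_image.1 (hsurj ▸ hB)
    refine ⟨g U, Finset.mem_image_of_mem _ (Finset.mem_univ _),
      Finset.eq_singleton_iff_unique_mem.2 ⟨Finset.mem_inter.2
        ⟨Finset.mem_image_of_mem _ (Finset.mem_univ _), hgB U⟩, fun x hx => ?_⟩⟩
    obtain ⟨hx, hxB⟩ := Finset.mem_inter.1 hx
    obtain ⟨V, -, rfl⟩ := Finset.mem_image.1 hx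
    exact congrArg g (hf (hBdisj _ (hfB V).1 _ hB _ (hgB V) hxB))
end

section
/- Let M be an arbitrary (possibly infinite) set and let 𝒰 and ℬ be partitions of M satisfying: (1) for no natural number k ≥ 1 do there exist k−1 parts of 𝒰 whose union contains k distinct parts of ℬ, and likewise no k−1 parts of ℬ whose union contains k distinct parts of 𝒰; and (2) every part of 𝒰 has nonempty intersection with only finitely many parts of ℬ, and every part of ℬ has nonempty intersection with only finitely many parts of 𝒰. Then there exists a common system of distinct representatives for 𝒰 and ℬ, i.e., a set X ⊆ M such that every part of 𝒰 contains exactly one element of X and every part of ℬ contains exactly one element of X. -/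
/-- If every part of `𝒯` meets only finitely many members of the cover `𝒮`, and no `n` members of
`𝒮` cover more than `n` members of `𝒯`, then the members of `𝒯` can be assigned distinct members
of `𝒮` that they meet. -/
theorem exists_injective_inter_nonempty_s2 {α : Type*} (𝒮 𝒯 : Set (Set α))
    (hcov : ∀ x : α, ∃ S ∈ 𝒮, x ∈ S)
    (hcard : ∀ k : ℕ, 1 ≤ k → ∀ S : Finset (Set α), ↑S ⊆ 𝒮 → S.card = k - 1 →
      ∀ T : Finset (Set α), ↑T ⊆ 𝒯 → (∀ B ∈ T, B ⊆ ⋃₀ ↑S) → T.card < k)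
    (hfin : ∀ T ∈ 𝒯, {S ∈ 𝒮 | (S ∩ T).Nonempty}.Finite) :
    ∃ f : 𝒯 → 𝒮, Function.Injective f ∧ ∀ T, ((f T : Set α) ∩ T).Nonempty := by
  classical
  let t : 𝒯 → Finset (Set α) := fun T => (hfin T T.2).toFinset
  have mem_t : ∀ T S, S ∈ t T ↔ S ∈ 𝒮 ∧ (S ∩ (T : Set α)).Nonempty := fun T S => by simp [t]
  obtain ⟨f, hf, hft⟩ := (Finset.all_card_le_biUnion_card_iff_exists_injective t).1 fun s => by
    have h := hcard ((s.biUnion t).card + 1) (by omega) (s.biUnion t)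
      (fun S hS => by
        obtain ⟨T, -, hT⟩ := Finset.mem_biUnion.1 (Finset.mem_coe.1 hS)
        exact ((mem_t T S).1 hT).1)
      (by omega) (s.map (Function.Embedding.subtype _))
      (fun T hT => by
        obtain ⟨T, -, rfl⟩ := Finset.mem_map.1 (Finset.mem_coe.1 hT)
        exact T.2)
      (fun T hT x hx => by
        obtain ⟨T, hTs, rfl⟩ := Finset.mem_map.1 hT
        obtain ⟨S, hS, hxS⟩ := hcov x
        exact ⟨S, Finset.mem_coe.2 (Finset.mem_biUnion.2 ⟨T, hTs, (mem_t T S).2 ⟨hS, x, hxS, hx⟩⟩),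
          hxS⟩)
    rw [Finset.card_map] at h
    omega
  exact ⟨fun T => ⟨f T, ((mem_t T _).1 (hft T)).1⟩,
    fun _ _ h => hf (congrArg Subtype.val h), fun T => ((mem_t T _).1 (hft T)).2⟩


/-- De Bruijn's infinite extension of Van der Waerden's theorem:
if `𝒰` and `ℬ` are partitions of an arbitrary set (the type `α`) such that
(1) for no `k ≥ 1` do `k - 1` parts of one partition contain in their union
`k` distinct parts of the other, and (2) every part of either partition meets
only finitely many parts of the other, then the two partitions have a common
system of distinct representatives. -/
theorem stmt2 {α : Type*} (𝒰 ℬ : Set (Set α))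
    (hUne : ∀ U ∈ 𝒰, U.Nonempty) (hBne : ∀ B ∈ ℬ, B.Nonempty)
    (hUdisj : ∀ U₁ ∈ 𝒰, ∀ U₂ ∈ 𝒰, U₁ ≠ U₂ → U₁ ∩ U₂ = ∅)
    (hBdisj : ∀ B₁ ∈ ℬ, ∀ B₂ ∈ ℬ, B₁ ≠ B₂ → B₁ ∩ B₂ = ∅)
    (hUcov : ∀ x : α, ∃ U ∈ 𝒰, x ∈ U)
    (hBcov : ∀ x : α, ∃ B ∈ ℬ, x ∈ B)
    (h1a : ∀ k : ℕ, 1 ≤ k → ∀ S : Finset (Set α), ↑S ⊆ 𝒰 → S.card = k - 1 →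
      ∀ T : Finset (Set α), ↑T ⊆ ℬ → (∀ B ∈ T, B ⊆ ⋃₀ ↑S) → T.card < k)
    (h1b : ∀ k : ℕ, 1 ≤ k → ∀ S : Finset (Set α), ↑S ⊆ ℬ → S.card = k - 1 →
      ∀ T : Finset (Set α), ↑T ⊆ 𝒰 → (∀ U ∈ T, U ⊆ ⋃₀ ↑S) → T.card < k)
    (h2a : ∀ U ∈ 𝒰, {B ∈ ℬ | (U ∩ B).Nonempty}.Finite)
    (h2b : ∀ B ∈ ℬ, {U ∈ 𝒰 | (U ∩ B).Nonempty}.Finite) :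
    ∃ X : Set α, (∀ U ∈ 𝒰, ∃! x, x ∈ X ∩ U) ∧ (∀ B ∈ ℬ, ∃! x, x ∈ X ∩ B) := by
  obtain ⟨f, hf, hfR⟩ := exists_injective_inter_nonempty_s2 𝒰 ℬ hUcov h1a h2b
  obtain ⟨g, hg, hgR⟩ := exists_injective_inter_nonempty_s2 ℬ 𝒰 hBcov h1b
    fun U hU => by simpa only [Set.inter_comm] using h2a U hU
  obtain ⟨h, hh, hR⟩ := Function.Embedding.schroeder_bernstein_of_rel hf hg
    (fun B U => ((U : Set α) ∩ B).Nonempty) hfR fun U => by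
      simpa only [Set.inter_comm] using hgR U
  choose p hp using hR
  have eq_U : ∀ U₁ U₂ : 𝒰, ∀ x, x ∈ (U₁ : Set α) → x ∈ (U₂ : Set α) → U₁ = U₂ := by
    intro U₁ U₂ x h₁ h₂
    by_contra hne
    exact Set.eq_empty_iff_forall_notMem.1
      (hUdisj U₁ U₁.2 U₂ U₂.2 fun e => hne (Subtype.ext e)) x ⟨h₁, h₂⟩
  have eq_B : ∀ B₁ B₂ : ℬ, ∀ x, x ∈ (B₁ : Set α) → x ∈ (B₂ : Set α) → B₁ = B₂ := by
    intro B₁ B₂ x h₁ h₂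
    by_contra hne
    exact Set.eq_empty_iff_forall_notMem.1
      (hBdisj B₁ B₁.2 B₂ B₂.2 fun e => hne (Subtype.ext e)) x ⟨h₁, h₂⟩
  refine ⟨Set.range p, fun U hU => ?_, fun B hB => ?_⟩
  · obtain ⟨B, hB⟩ := hh.2 ⟨U, hU⟩
    refine ⟨p B, ⟨⟨B, rfl⟩, ?_⟩, ?_⟩
    · simpa [hB] using (hp B).1
    · rintro _ ⟨⟨B', rfl⟩, hx⟩
      exact congrArg p (hh.1 ((eq_U _ ⟨U, hU⟩ _ (hp B').1 hx).trans hB.symm))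
  · refine ⟨p ⟨B, hB⟩, ⟨⟨_, rfl⟩, (hp ⟨B, hB⟩).2⟩, ?_⟩
    rintro _ ⟨⟨B', rfl⟩, hx⟩
    exact congrArg p (eq_B _ ⟨B, hB⟩ _ (hp B').2 hx)
end

section
/- For every n ≥ 1, the number of P_n-cycles is 2^(2^(n−1) − n). Here a P_n-cycle is an equivalence class, under cyclic rotation, of functions c : ZMod(2^n) → {0,1} with the property that the 2^n windows (c(i), c(i+1), …, c(i+n−1)), for i ∈ ZMod(2^n), are pairwise distinct (equivalently, every binary word of length n occurs exactly once as a consecutive subword of the cycle). -/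
open Matrix in
theorem Matrix.det_one_sub_eq_one_of_isNilpotent {α : Type*} [Fintype α] [DecidableEq α]
    {A : Matrix α α ℚ} (hA : IsNilpotent A) : (1 - A).det = 1 := by
  have h := (isNilpotent_charpoly_sub_pow_of_isNilpotent hA).eq_zero
  have h' := A.eval_charpoly 1
  rw [sub_eq_zero.mp h] at h'
  simpa using h'.symm

section RootedLaplacian

variable {α : Type*} [Fintype α] [DecidableEq α]

/-- The matrix of `f ↦ (w ↦ f w + f a - f (π w))`. -/
def rootedLaplacian (π : Equiv.Perm α) (a : α) : Matrix α α ℚ :=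
  Matrix.of fun w => Pi.single w 1 + Pi.single a 1 - Pi.single (π w) 1

open Matrix

theorem rootedLaplacian_mulVec (π : Equiv.Perm α) (a : α) (f : α → ℚ) (w : α) :
    (rootedLaplacian π a *ᵥ f) w = f w + f a - f (π w) := by
  change (Pi.single w 1 + Pi.single a 1 - Pi.single (π w) 1 : α → ℚ) ⬝ᵥ f = _
  simp [sub_dotProduct, add_dotProduct]

theorem det_rootedLaplacian_of_not_sameCycle {π : Equiv.Perm α} {a b : α}
    (h : ¬ π.SameCycle a b) : (rootedLaplacian π a).det = 0 := by
  classical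
  rw [← exists_mulVec_eq_zero_iff]
  refine ⟨fun w => if π.SameCycle a w then 0 else 1, fun h0 => ?_, ?_⟩
  · have := congrFun h0 b
    simp [h] at this
  · ext w
    rw [rootedLaplacian_mulVec]
    simp [Equiv.Perm.sameCycle_apply_right, Equiv.Perm.SameCycle.refl]

/-- The matrix of `f ↦ f ∘ π` with the column of `a` erased. -/
def erasedPermMatrix (π : Equiv.Perm α) (a : α) : Matrix α α ℚ :=
  Matrix.of fun w => if π w = a then 0 else Pi.single (π w) 1

theorem erasedPermMatrix_mulVec (π : Equiv.Perm α) (a : α) (f : α → ℚ) (w : α) :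
    (erasedPermMatrix π a *ᵥ f) w = if π w = a then 0 else f (π w) := by
  change (if π w = a then 0 else Pi.single (π w) 1 : α → ℚ) ⬝ᵥ f = _
  split_ifs <;> simp

theorem erasedPermMatrix_pow_mulVec_eq_zero (π : Equiv.Perm α) (a : α) (f : α → ℚ) (k : ℕ) :
    ∀ w, ∀ j < k, (π ^ (j + 1)) w = a → (erasedPermMatrix π a ^ k *ᵥ f) w = 0 := by
  induction k with
  | zero => simp
  | succ k ih =>
    intro w j hj hw
    rw [pow_succ', ← mulVec_mulVec, erasedPermMatrix_mulVec]
    split_ifs with h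
    · rfl
    · obtain _ | j := j
      · simp [h] at hw
      · refine ih _ j (by omega) ?_
        rw [← hw, pow_succ π (j + 1)]
        rfl

omit [DecidableEq α] in
theorem Equiv.Perm.isCycleOn_univ_of_forall_sameCycle {π : Equiv.Perm α} {a : α}
    (h : ∀ w, π.SameCycle a w) : π.IsCycleOn (Finset.univ : Finset α) :=
  ⟨by simp [Set.bijOn_univ], fun x _ y _ => (h x).symm.trans (h y)⟩

theorem isNilpotent_erasedPermMatrix {π : Equiv.Perm α} {a : α} (h : ∀ w, π.SameCycle a w) :
    IsNilpotent (erasedPermMatrix π a) := by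
  refine ⟨Fintype.card α, ext_iff_mulVec.mpr fun f => funext fun w => ?_⟩
  obtain ⟨j, hj, hw⟩ := (Equiv.Perm.isCycleOn_univ_of_forall_sameCycle h).exists_pow_eq
    (Finset.mem_univ (π w)) (Finset.mem_univ a)
  rw [zero_mulVec, Pi.zero_apply]
  exact erasedPermMatrix_pow_mulVec_eq_zero π a f _ w j hj (by rw [pow_succ]; exact hw)

theorem sum_one_sub_erasedPermMatrix_mulVec (π : Equiv.Perm α) (a : α) (f : α → ℚ) :
    ∑ w, ((1 - erasedPermMatrix π a) *ᵥ f) w = f a := by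
  simp only [sub_mulVec, one_mulVec, Pi.sub_apply, erasedPermMatrix_mulVec, Finset.sum_sub_distrib]
  rw [Equiv.sum_comp π fun w => if w = a then 0 else f w, ← Finset.sum_sub_distrib,
    Finset.sum_eq_single a] <;> simp +contextual

theorem det_rootedLaplacian_of_sameCycle {π : Equiv.Perm α} {a : α}
    (h : ∀ w, π.SameCycle a w) : (rootedLaplacian π a).det = Fintype.card α := by
  set B := erasedPermMatrix π a
  have hdet : (1 - B).det = 1 := det_one_sub_eq_one_of_isNilpotent (isNilpotent_erasedPermMatrix h)
  set u : α → ℚ := fun w => 1 - if π w = a then 1 else 0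
  set y : α → ℚ := (1 - B)⁻¹ *ᵥ u
  have hy : (1 - B) *ᵥ y = u := by
    rw [mulVec_mulVec, mul_nonsing_inv _ (by rw [hdet]; exact isUnit_one), one_mulVec]
  have hya : y a = Fintype.card α - 1 := by
    rw [← sum_one_sub_erasedPermMatrix_mulVec π a y, hy]
    simp only [u, Finset.sum_sub_distrib]
    rw [Equiv.sum_comp π fun w => if w = a then (1 : ℚ) else 0]
    simp
  have hM : rootedLaplacian π a =
      (1 - B) * (1 + replicateCol Unit y * replicateRow Unit (Pi.single a (1 : ℚ))) := by
    refine ext_iff_mulVec.mpr fun f => funext fun w => ?_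
    have hf : replicateCol Unit y *ᵥ replicateRow Unit (Pi.single a (1 : ℚ)) *ᵥ f = f a • y := by
      ext v
      simp [mulVec, dotProduct, Pi.single_apply, mul_comm]
    rw [← mulVec_mulVec, add_mulVec, one_mulVec, ← mulVec_mulVec, hf, mulVec_add, mulVec_smul, hy,
      sub_mulVec, one_mulVec, rootedLaplacian_mulVec]
    simp only [Pi.add_apply, Pi.sub_apply, Pi.smul_apply, smul_eq_mul, B, erasedPermMatrix_mulVec, u]
    split_ifs with h
    · rw [h]; ring
    · ring
  rw [hM, det_mul, hdet, det_one_add_replicateCol_mul_replicateRow]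
  simp [hya]

end RootedLaplacian

section Averaging

variable {m : ℕ}

/-- Rows `X w - Y v b`, where `v` is the tail of `w` and the bit `b` is chosen by `w 0` and `g`,
except that for `v ∈ s` both bits are averaged. -/
def partialAverage (X : (Fin (m + 1) → Bool) → (Fin (m + 1) → Bool) → ℚ)
    (Y : (Fin m → Bool) → Bool → (Fin (m + 1) → Bool) → ℚ)
    (s : Finset (Fin m → Bool)) (g : (Fin m → Bool) → Bool) :
    Matrix (Fin (m + 1) → Bool) (Fin (m + 1) → Bool) ℚ :=
  Matrix.of fun w => X w - if Fin.tail w ∈ s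
    then (1 / 2 : ℚ) • (Y (Fin.tail w) false + Y (Fin.tail w) true)
    else Y (Fin.tail w) (xor (w 0) (g (Fin.tail w)))

theorem partialAverage_apply (X : (Fin (m + 1) → Bool) → (Fin (m + 1) → Bool) → ℚ)
    (Y : (Fin m → Bool) → Bool → (Fin (m + 1) → Bool) → ℚ)
    (s : Finset (Fin m → Bool)) (g : (Fin m → Bool) → Bool) (w : Fin (m + 1) → Bool) :
    partialAverage X Y s g w = X w - if Fin.tail w ∈ s
      then (1 / 2 : ℚ) • (Y (Fin.tail w) false + Y (Fin.tail w) true)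
      else Y (Fin.tail w) (xor (w 0) (g (Fin.tail w))) := rfl

open Matrix

theorem Matrix.det_updateRow_updateRow_add_swap {ι : Type*} [Fintype ι] [DecidableEq ι]
    (B : Matrix ι ι ℚ) {p q : ι} (hpq : p ≠ q) (x y s t : ι → ℚ) :
    ((B.updateRow p (x - s)).updateRow q (y - t)).det +
      ((B.updateRow p (x - t)).updateRow q (y - s)).det =
    2 * ((B.updateRow p (x - (1 / 2 : ℚ) • (s + t))).updateRow q
      (y - (1 / 2 : ℚ) • (s + t))).det := by
  have add_q : ∀ a b c : ι → ℚ, ((B.updateRow p a).updateRow q (b + c)).det =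
      ((B.updateRow p a).updateRow q b).det + ((B.updateRow p a).updateRow q c).det :=
    fun a b c => det_updateRow_add _ _ _ _
  have smul_q : ∀ (r : ℚ) (a b : ι → ℚ), ((B.updateRow p a).updateRow q (r • b)).det =
      r * ((B.updateRow p a).updateRow q b).det := fun r a b => det_updateRow_smul _ _ _ _
  have add_p : ∀ a b c : ι → ℚ, ((B.updateRow p (b + c)).updateRow q a).det =
      ((B.updateRow p b).updateRow q a).det + ((B.updateRow p c).updateRow q a).det := by
    intro a b c
    simp only [updateRow_comm B hpq]
    exact det_updateRow_add _ _ _ _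
  have smul_p : ∀ (r : ℚ) (a b : ι → ℚ), ((B.updateRow p (r • b)).updateRow q a).det =
      r * ((B.updateRow p b).updateRow q a).det := by
    intro r a b
    simp only [updateRow_comm B hpq]
    exact det_updateRow_smul _ _ _ _
  have diag : ∀ a : ι → ℚ, ((B.updateRow p a).updateRow q a).det = 0 := by
    intro a
    refine det_zero_of_row_eq hpq ?_
    rw [updateRow_ne hpq, updateRow_self, updateRow_self]
  have alt : ((B.updateRow p s).updateRow q t).det = -((B.updateRow p t).updateRow q s).det := by
    have := diag (s + t)
    rw [add_q, add_p, add_p, diag, diag] at this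
    linarith
  have neg_eq : ∀ a : ι → ℚ, -a = (-1 : ℚ) • a := by simp
  simp only [sub_eq_add_neg, neg_eq, smul_add, add_q, add_p, smul_q, smul_p, diag, alt]
  ring

theorem det_partialAverage_add_update (X : (Fin (m + 1) → Bool) → (Fin (m + 1) → Bool) → ℚ)
    (Y : (Fin m → Bool) → Bool → (Fin (m + 1) → Bool) → ℚ)
    {s : Finset (Fin m → Bool)} {v : Fin m → Bool} (hv : v ∉ s) (g : (Fin m → Bool) → Bool) :
    (partialAverage X Y s g).det + (partialAverage X Y s (Function.update g v (!g v))).det =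
      2 * (partialAverage X Y (insert v s) g).det := by
  set p : Fin (m + 1) → Bool := Fin.cons false v with hp
  set q : Fin (m + 1) → Bool := Fin.cons true v with hq
  have hpq : p ≠ q := fun h => by simpa [hp, hq] using congrFun h 0
  have hne : ∀ w, w ≠ p → w ≠ q → Fin.tail w ≠ v := by
    rintro w hwp hwq rfl
    cases h : w 0
    · exact hwp (by rw [hp, ← h, Fin.cons_self_tail])
    · exact hwq (by rw [hq, ← h, Fin.cons_self_tail])
  have key : ∀ (s' : Finset (Fin m → Bool)) (g' : (Fin m → Bool) → Bool) (a b : _ → ℚ),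
      (∀ u ≠ v, u ∈ s' ↔ u ∈ insert v s) → (∀ u ≠ v, g' u = g u) →
      partialAverage X Y s' g' p = a → partialAverage X Y s' g' q = b →
      partialAverage X Y s' g' =
        ((partialAverage X Y (insert v s) g).updateRow p a).updateRow q b := by
    rintro s' g' a b hs hg rfl rfl
    refine funext fun w => ?_
    rcases eq_or_ne w q with rfl | hwq
    · rw [updateRow_self]
    rcases eq_or_ne w p with rfl | hwp
    · rw [updateRow_ne hpq, updateRow_self]
    rw [updateRow_ne hwq, updateRow_ne hwp]
    have := hne w hwp hwq
    simp only [partialAverage_apply, hs _ this, hg _ this]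
  have hpt : Fin.tail p = v := Fin.tail_cons _ _
  have hqt : Fin.tail q = v := Fin.tail_cons _ _
  have hp0 : p 0 = false := rfl
  have hq0 : q 0 = true := rfl
  have hins : ∀ u ≠ v, u ∈ s ↔ u ∈ insert v s := fun u hu => by simp [hu]
  rw [key s g (X p - Y v (g v)) (X q - Y v (!g v)) hins (fun _ _ => rfl)
      (by simp [partialAverage_apply, hpt, hv, hp0]) (by simp [partialAverage_apply, hqt, hv, hq0]),
    key s (Function.update g v (!g v)) (X p - Y v (!g v)) (X q - Y v (g v)) hins
      (fun u hu => by simp [hu])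
      (by simp [partialAverage_apply, hpt, hv, hp0]) (by simp [partialAverage_apply, hqt, hv, hq0]),
    det_updateRow_updateRow_add_swap _ hpq]
  congr 2
  refine (key _ g _ _ (fun _ _ => Iff.rfl) (fun _ _ => rfl) ?_ ?_).symm
  · cases h : g v <;> simp [partialAverage_apply, hpt, add_comm]
  · cases h : g v <;> simp [partialAverage_apply, hqt, add_comm]

theorem sum_det_partialAverage (X : (Fin (m + 1) → Bool) → (Fin (m + 1) → Bool) → ℚ)
    (Y : (Fin m → Bool) → Bool → (Fin (m + 1) → Bool) → ℚ) (s : Finset (Fin m → Bool)) :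
    ∑ g, (partialAverage X Y s g).det = ∑ g, (partialAverage X Y ∅ g).det := by
  induction s using Finset.induction_on with
  | empty => rfl
  | insert v s hv ih =>
    have hflip : Function.Involutive
        fun g : (Fin m → Bool) → Bool => Function.update g v (!g v) := fun g => by simp
    have h := Finset.sum_congr rfl fun g (_ : g ∈ Finset.univ) =>
      det_partialAverage_add_update X Y hv g
    rw [Finset.sum_add_distrib, ← Finset.mul_sum,
      hflip.bijective.sum_comp fun g => (partialAverage X Y s g).det, ih] at h
    linarith

end Averaging

section FeedbackShift

variable {m : ℕ}

/-- The nonsingular feedback shift register on words of length `m + 1`. -/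
def feedbackShift (g : (Fin m → Bool) → Bool) : Equiv.Perm (Fin (m + 1) → Bool) where
  toFun w := Fin.snoc (Fin.tail w) (xor (w 0) (g (Fin.tail w)))
  invFun u := Fin.cons (xor (u (Fin.last m)) (g (Fin.init u))) (Fin.init u)
  left_inv w := by simp
  right_inv u := by simp

theorem feedbackShift_apply (g : (Fin m → Bool) → Bool) (w : Fin (m + 1) → Bool) :
    feedbackShift g w =
      Fin.snoc (α := fun _ => Bool) (Fin.tail w) (xor (w 0) (g (Fin.tail w))) := rfl

open Matrix

/-- The averaged shift on functions of words, minus the projection `f ↦ f 0` to constants. -/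
def averagedShift (m : ℕ) : Matrix (Fin (m + 1) → Bool) (Fin (m + 1) → Bool) ℚ :=
  Matrix.of fun w => (1 / 2 : ℚ) • (Pi.single (Fin.snoc (Fin.tail w) false) 1 +
    Pi.single (Fin.snoc (Fin.tail w) true) 1) - Pi.single (fun _ => false) 1

theorem averagedShift_mulVec (f : (Fin (m + 1) → Bool) → ℚ) (w : Fin (m + 1) → Bool) :
    (averagedShift m *ᵥ f) w =
      (1 / 2) * (f (Fin.snoc (Fin.tail w) false) + f (Fin.snoc (Fin.tail w) true)) -
        f fun _ => false := by
  change ((1 / 2 : ℚ) • (Pi.single (Fin.snoc (Fin.tail w) false) 1 +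
    Pi.single (Fin.snoc (Fin.tail w) true) 1) - Pi.single (fun _ => false) 1 :
      (Fin (m + 1) → Bool) → ℚ) ⬝ᵥ f = _
  simp only [sub_dotProduct, smul_dotProduct, add_dotProduct, single_dotProduct, smul_eq_mul,
    one_mul]

theorem averagedShift_pow_mulVec_congr (f : (Fin (m + 1) → Bool) → ℚ) (k : ℕ) :
    ∀ w w' : Fin (m + 1) → Bool, (∀ i, k ≤ i.val → w i = w' i) →
      (averagedShift m ^ k *ᵥ f) w = (averagedShift m ^ k *ᵥ f) w' := by
  induction k with
  | zero =>
    intro w w' h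
    rw [funext fun i => h i (Nat.zero_le _)]
  | succ k ih =>
    intro w w' h
    rw [pow_succ', ← mulVec_mulVec, averagedShift_mulVec, averagedShift_mulVec]
    have key : ∀ b : Bool, (averagedShift m ^ k *ᵥ f) (Fin.snoc (Fin.tail w) b) =
        (averagedShift m ^ k *ᵥ f) (Fin.snoc (Fin.tail w') b) := by
      intro b
      refine ih _ _ fun i hi => ?_
      induction i using Fin.lastCases with
      | last => simp
      | cast i =>
        simp only [Fin.snoc_castSucc, Fin.tail]
        exact h _ (by simpa using hi)
    rw [key, key]

theorem isNilpotent_averagedShift (m : ℕ) : IsNilpotent (averagedShift m) := by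
  refine ⟨m + 2, ext_iff_mulVec.mpr fun f => funext fun w => ?_⟩
  have hconst : ∀ w', (averagedShift m ^ (m + 1) *ᵥ f) w' =
      (averagedShift m ^ (m + 1) *ᵥ f) fun _ => false := fun w' =>
    averagedShift_pow_mulVec_congr f (m + 1) _ _ fun i hi => absurd i.isLt (by omega)
  rw [pow_succ', ← mulVec_mulVec, averagedShift_mulVec, hconst, hconst (Fin.snoc _ true),
    zero_mulVec, Pi.zero_apply]
  ring

theorem sum_det_rootedLaplacian_feedbackShift (m : ℕ) :
    ∑ g : (Fin m → Bool) → Bool, (rootedLaplacian (feedbackShift g) fun _ => false).det =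
      2 ^ 2 ^ m := by
  set X : (Fin (m + 1) → Bool) → (Fin (m + 1) → Bool) → ℚ :=
    fun w => Pi.single w 1 + Pi.single (fun _ => false) 1
  set Y : (Fin m → Bool) → Bool → (Fin (m + 1) → Bool) → ℚ :=
    fun v b => Pi.single (Fin.snoc (α := fun _ => Bool) v b) 1
  have hempty : ∀ g, rootedLaplacian (feedbackShift g) (fun _ => false) =
      partialAverage X Y ∅ g := by
    intro g
    refine funext fun w => ?_
    rw [partialAverage_apply, if_neg (Finset.notMem_empty _)]
    rfl
  have huniv : ∀ g, partialAverage X Y Finset.univ g = 1 - averagedShift m := by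
    intro g
    refine funext fun w => ?_
    rw [partialAverage_apply, if_pos (Finset.mem_univ _)]
    ext u
    simp [X, Y, averagedShift, Pi.single_apply, Matrix.one_apply, eq_comm]
    ring
  simp only [hempty]
  rw [← sum_det_partialAverage X Y Finset.univ]
  simp [huniv, det_one_sub_eq_one_of_isNilpotent (isNilpotent_averagedShift m)]

/-- The feedback functions whose shift register runs through all words in a single cycle. -/
abbrev FullCycleFeedback (m : ℕ) : Type :=
  {g : (Fin m → Bool) → Bool // ∀ w, (feedbackShift g).SameCycle (fun _ => false) w}

theorem card_fullCycleFeedback (m : ℕ) :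
    Nat.card (FullCycleFeedback m) = 2 ^ (2 ^ m - (m + 1)) := by
  classical
  have hdet : ∀ g : (Fin m → Bool) → Bool,
      (rootedLaplacian (feedbackShift g) fun _ => false).det =
        if ∀ w, (feedbackShift g).SameCycle (fun _ => false) w then (2 : ℚ) ^ (m + 1) else 0 := by
    intro g
    split_ifs with h
    · rw [det_rootedLaplacian_of_sameCycle h]
      simp
    · obtain ⟨w, hw⟩ := not_forall.mp h
      exact det_rootedLaplacian_of_not_sameCycle hw
  have hsum := sum_det_rootedLaplacian_feedbackShift m
  simp only [hdet] at hsum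
  rw [← Finset.sum_filter, Finset.sum_const, nsmul_eq_mul] at hsum
  rw [Nat.card_eq_fintype_card, Fintype.card_subtype]
  have hle : m + 1 ≤ 2 ^ m := Nat.lt_two_pow_self
  refine Nat.eq_of_mul_eq_mul_right (Nat.two_pow_pos (m + 1)) ?_
  rw [← pow_add, Nat.sub_add_cancel hle]
  exact_mod_cast hsum

end FeedbackShift

section Windows

variable {m : ℕ}

/-- The window of length `m + 1` of a cyclic sequence at position `i`. -/
def cyclicWindow {N : ℕ} (c : ZMod N → Bool) (i : ZMod N) : Fin (m + 1) → Bool :=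
  fun t => c (i + (t : ℕ))

theorem tail_cyclicWindow {N : ℕ} (c : ZMod N → Bool) (i : ZMod N) :
    Fin.tail (cyclicWindow (m := m) c i) = Fin.init (cyclicWindow (m := m) c (i + 1)) := by
  ext t
  simp [Fin.tail, Fin.init, cyclicWindow, add_assoc, add_comm (1 : ZMod N)]

theorem cyclicWindow_rotate {N : ℕ} (c : ZMod N → Bool) (s i : ZMod N) :
    cyclicWindow (m := m) (fun j => c (j + s)) i = cyclicWindow c (i + s) := by
  ext t
  simp [cyclicWindow, add_right_comm]

theorem bijective_of_injective_cyclicWindow {c : ZMod (2 ^ (m + 1)) → Bool}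
    (hc : Function.Injective (cyclicWindow (m := m) c)) :
    Function.Bijective (cyclicWindow (m := m) c) :=
  (Fintype.bijective_iff_injective_and_card _).mpr ⟨hc, by simp [ZMod.card]⟩

theorem exists_feedbackShift_cyclicWindow {c : ZMod (2 ^ (m + 1)) → Bool}
    (hc : Function.Injective (cyclicWindow (m := m) c)) :
    ∃ g : (Fin m → Bool) → Bool,
      ∀ i, feedbackShift g (cyclicWindow c i) = cyclicWindow c (i + 1) := by
  set e := Equiv.ofBijective _ (bijective_of_injective_cyclicWindow hc)
  have he : ∀ i, e i = cyclicWindow c i := fun _ => rfl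
  set π : (Fin (m + 1) → Bool) → Fin (m + 1) → Bool := fun w => e (e.symm w + 1) with hπ
  have hπinj : Function.Injective π := fun w w' h => by simpa [hπ] using h
  have hinit : ∀ w, Fin.init (π w) = Fin.tail w := fun w => by
    simp only [hπ]
    rw [he, ← tail_cyclicWindow, ← he, e.apply_symm_apply]
  refine ⟨fun v => π (Fin.cons false v) (Fin.last m), fun i => ?_⟩
  suffices h : ∀ w, feedbackShift (fun v => π (Fin.cons false v) (Fin.last m)) w = π w by
    rw [h, ← he, ← he]
    simp [hπ]
  intro w
  rw [feedbackShift_apply, ← hinit w]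
  conv_rhs => rw [← Fin.snoc_init_self (π w)]
  congr 1
  rw [hinit w]
  cases h0 : w 0
  · rw [← h0, Fin.cons_self_tail]
    simp [h0]
  · have hne : π (Fin.cons false (Fin.tail w)) ≠ π w := fun h => by
      have := congrFun (hπinj h) 0
      simp [h0] at this
    have hlast : π (Fin.cons false (Fin.tail w)) (Fin.last m) ≠ π w (Fin.last m) := by
      intro h
      apply hne
      rw [← Fin.snoc_init_self (π w), ← Fin.snoc_init_self (π (Fin.cons false (Fin.tail w))), h,
        hinit, hinit, Fin.tail_cons]
    revert hlast
    cases π (Fin.cons false (Fin.tail w)) (Fin.last m) <;> cases π w (Fin.last m) <;> simp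

theorem feedbackShift_injective : Function.Injective (feedbackShift (m := m)) := by
  intro g g' h
  ext v
  have := congrFun (congrArg (⇑) h) (Fin.cons false v)
  rw [feedbackShift_apply, feedbackShift_apply] at this
  simpa using congrFun this (Fin.last m)

theorem feedbackShift_pow_apply_zero (g : (Fin m → Bool) → Bool) (w : Fin (m + 1) → Bool)
    (t : Fin (m + 1)) : ((feedbackShift g ^ (t : ℕ)) w) 0 = w t := by
  suffices h : ∀ (k : ℕ) (w : Fin (m + 1) → Bool) (hk : k < m + 1),
      ((feedbackShift g ^ k) w) 0 = w ⟨k, hk⟩ from h t w t.isLt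
  intro k
  induction k with
  | zero => exact fun _ _ => rfl
  | succ k ih =>
    intro w hk
    rw [pow_succ, Equiv.Perm.mul_apply, ih _ (by omega), feedbackShift_apply]
    have : (⟨k, by omega⟩ : Fin (m + 1)) = Fin.castSucc ⟨k, by omega⟩ := rfl
    rw [this, Fin.snoc_castSucc]
    rfl

/-- The sequence of first letters along the orbit of the zero word. -/
def orbitSequence (g : (Fin m → Bool) → Bool) (i : ZMod (2 ^ (m + 1))) : Bool :=
  ((feedbackShift g ^ i.val) fun _ => false) 0

theorem feedbackShift_pow_two_pow (g : FullCycleFeedback m) :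
    (feedbackShift g.1 ^ 2 ^ (m + 1)) (fun _ => false) = fun _ => false := by
  simpa using (Equiv.Perm.isCycleOn_univ_of_forall_sameCycle g.2).pow_card_apply
    (Finset.mem_univ fun _ => false)

theorem feedbackShift_pow_val (g : FullCycleFeedback m) (k : ℕ) :
    (feedbackShift g.1 ^ (k : ZMod (2 ^ (m + 1))).val) (fun _ => false) =
      (feedbackShift g.1 ^ k) fun _ => false := by
  rw [ZMod.val_natCast]
  conv_rhs => rw [← Nat.mod_add_div k (2 ^ (m + 1)), pow_add, pow_mul, Equiv.Perm.mul_apply,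
    Equiv.Perm.pow_apply_eq_self_of_apply_eq_self (feedbackShift_pow_two_pow g)]

theorem cyclicWindow_orbitSequence (g : FullCycleFeedback m) (i : ZMod (2 ^ (m + 1))) :
    cyclicWindow (orbitSequence g.1) i = (feedbackShift g.1 ^ i.val) fun _ => false := by
  ext t
  have hi : i + (t : ℕ) = ((t + i.val : ℕ) : ZMod (2 ^ (m + 1))) := by
    simp [add_comm]
  rw [cyclicWindow, orbitSequence, hi, feedbackShift_pow_val, pow_add, Equiv.Perm.mul_apply,
    feedbackShift_pow_apply_zero]

theorem injective_cyclicWindow_orbitSequence (g : FullCycleFeedback m) :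
    Function.Injective (cyclicWindow (m := m) (orbitSequence g.1)) := by
  refine ((Fintype.bijective_iff_surjective_and_card _).mpr ⟨fun w => ?_, by simp [ZMod.card]⟩).1
  obtain ⟨k, -, hk⟩ := (Equiv.Perm.isCycleOn_univ_of_forall_sameCycle g.2).exists_pow_eq
    (Finset.mem_univ fun _ => false) (Finset.mem_univ w)
  exact ⟨k, by rw [cyclicWindow_orbitSequence, feedbackShift_pow_val, hk]⟩

theorem feedbackShift_cyclicWindow_orbitSequence (g : FullCycleFeedback m)
    (i : ZMod (2 ^ (m + 1))) :
    feedbackShift g.1 (cyclicWindow (orbitSequence g.1) i) =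
      cyclicWindow (orbitSequence g.1) (i + 1) := by
  have hi : i + 1 = ((i.val + 1 : ℕ) : ZMod (2 ^ (m + 1))) := by simp
  rw [cyclicWindow_orbitSequence, cyclicWindow_orbitSequence, hi, feedbackShift_pow_val,
    pow_succ' (feedbackShift g.1)]
  rfl

theorem cyclicWindow_eq_feedbackShift_pow {c : ZMod (2 ^ (m + 1)) → Bool}
    {g : (Fin m → Bool) → Bool}
    (h : ∀ i, feedbackShift g (cyclicWindow c i) = cyclicWindow c (i + 1))
    (i : ZMod (2 ^ (m + 1))) (k : ℕ) :
    cyclicWindow c (i + k) = (feedbackShift g ^ k) (cyclicWindow c i) := by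
  induction k with
  | zero => simp
  | succ k ih =>
    rw [pow_succ' (feedbackShift g), Equiv.Perm.mul_apply, ← ih, h]
    push_cast
    rw [add_assoc]

end Windows

/-- De Bruijn's theorem (conjecture of Posthumus): for `n ≥ 1` the number of
`P_n`-cycles, i.e. cyclic binary sequences of length `2 ^ n` in which all
`2 ^ n` windows of length `n` are pairwise distinct, counted up to cyclic
rotation, is `2 ^ (2 ^ (n - 1) - n)`. -/
theorem stmt3 (n : ℕ) (hn : 1 ≤ n) :
    Nat.card (Quot (fun c d : {c : ZMod (2 ^ n) → Bool //
        Function.Injective fun i : ZMod (2 ^ n) => fun t : Fin n => c (i + (t : ℕ))} =>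
      ∃ s : ZMod (2 ^ n), ∀ i, d.1 i = c.1 (i + s))) = 2 ^ (2 ^ (n - 1) - n) := by
  obtain ⟨m, rfl⟩ := Nat.exists_eq_add_of_le' hn
  rw [Nat.add_sub_cancel, ← card_fullCycleFeedback m]
  symm
  refine Nat.card_eq_of_bijective (fun g : FullCycleFeedback m =>
    Quot.mk _ ⟨orbitSequence g.1, injective_cyclicWindow_orbitSequence g⟩) ⟨?_, ?_⟩
  · intro g g' h
    rw [Equivalence.quot_mk_eq_iff] at h
    · obtain ⟨s, hs⟩ := h
      have hs' : orbitSequence g'.1 = fun i => orbitSequence g.1 (i + s) := funext hs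
      refine Subtype.ext (feedbackShift_injective (Equiv.ext fun w => ?_))
      obtain ⟨i, rfl⟩ := (bijective_of_injective_cyclicWindow
        (injective_cyclicWindow_orbitSequence g')).2 w
      rw [feedbackShift_cyclicWindow_orbitSequence, hs', cyclicWindow_rotate, cyclicWindow_rotate,
        feedbackShift_cyclicWindow_orbitSequence, add_right_comm]
    · refine ⟨fun c => ⟨0, by simp⟩, fun ⟨s, hs⟩ => ⟨-s, by simp [hs]⟩, ?_⟩
      rintro c d e ⟨s, hs⟩ ⟨t, ht⟩
      exact ⟨t + s, fun i => by rw [ht, hs, add_assoc]⟩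
  · refine Quot.ind ?_
    rintro ⟨c, hc⟩
    obtain ⟨g, hg⟩ := exists_feedbackShift_cyclicWindow hc
    have hsurj := (bijective_of_injective_cyclicWindow hc).2
    obtain ⟨s, hs⟩ := hsurj fun _ => false
    have hpow : ∀ i : ZMod (2 ^ (m + 1)),
        cyclicWindow c (i + s) = (feedbackShift g ^ i.val) fun _ => false := by
      intro i
      rw [← hs, ← cyclicWindow_eq_feedbackShift_pow hg, ZMod.natCast_zmod_val, add_comm i]
    have hcyc : ∀ w, (feedbackShift g).SameCycle (fun _ => false) w := by
      intro w
      obtain ⟨i, rfl⟩ := hsurj w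
      exact ⟨(i - s).val, by rw [zpow_natCast, ← hpow, sub_add_cancel]⟩
    refine ⟨⟨g, hcyc⟩, (Quot.sound ⟨s, fun i => ?_⟩).symm⟩
    change orbitSequence g i = c (i + s)
    rw [orbitSequence, ← hpow]
    simp [cyclicWindow]
end

section
/- Let n ≥ 1, let U = {1, …, n}, and let A_1, …, A_m (m > 1) be proper subsets of U such that every pair of distinct elements of U is contained in exactly one of the sets A_i. Then m ≥ n. -/
open Finset in
/-- If every pair of distinct points lies in exactly one of the sets `A i`, then the squares of the
block sums of `c` add up to `(∑ c)² + ∑ (r x - 1) c x²`, where `r x` is the number of blocks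
containing `x`. -/
theorem sum_sq_block_sum_of_existsUnique {α ι : Type*} [Fintype α] [DecidableEq α] [Fintype ι]
    (A : ι → Finset α) (hpair : ∀ x y : α, x ≠ y → ∃! i, x ∈ A i ∧ y ∈ A i) (c : α → ℝ) :
    ∑ i, (∑ x ∈ A i, c x) ^ 2 =
      (∑ x, c x) ^ 2 + ∑ x, ((#{i | x ∈ A i} : ℝ) - 1) * c x ^ 2 := by
  have hcount (x y : α) : (#{i | x ∈ A i ∧ y ∈ A i} : ℝ) =
      1 + if x = y then (#{i | x ∈ A i} : ℝ) - 1 else 0 := by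
    split_ifs with h
    · subst h
      simp
    · obtain ⟨i, hi, huniq⟩ := hpair x y h
      have : ({j | x ∈ A j ∧ y ∈ A j} : Finset ι) = {i} := by
        ext j
        simp only [mem_filter, mem_univ, true_and, mem_singleton]
        exact ⟨huniq j, fun hj => hj ▸ hi⟩
      simp [this]
  calc ∑ i, (∑ x ∈ A i, c x) ^ 2
      = ∑ i, ∑ x, ∑ y, if x ∈ A i ∧ y ∈ A i then c x * c y else 0 := by
        refine sum_congr rfl fun i _ => ?_
        have h : ∑ x ∈ A i, c x = ∑ x, if x ∈ A i then c x else 0 := by simp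
        rw [h, sq, sum_mul_sum]
        refine sum_congr rfl fun x _ => sum_congr rfl fun y _ => ?_
        by_cases hx : x ∈ A i <;> by_cases hy : y ∈ A i <;> simp [hx, hy]
    _ = ∑ x, ∑ y, (#{i | x ∈ A i ∧ y ∈ A i} : ℝ) * (c x * c y) := by
        rw [sum_comm]
        refine sum_congr rfl fun x _ => ?_
        rw [sum_comm]
        refine sum_congr rfl fun y _ => ?_
        rw [← sum_filter, sum_const, nsmul_eq_mul]
    _ = _ := by
        simp only [hcount, add_mul, one_mul, sum_add_distrib, ite_mul, zero_mul, sum_ite_eq,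
          mem_univ, if_true, sq, sum_mul_sum]

open Finset in
/-- A point lies in at least two blocks if the blocks are proper and there is another point. -/
theorem two_le_card_filter_mem_of_existsUnique {α ι : Type*} [Fintype α] [DecidableEq α]
    [Nontrivial α] [Fintype ι] (A : ι → Finset α) (hproper : ∀ i, A i ≠ univ)
    (hpair : ∀ x y : α, x ≠ y → ∃! i, x ∈ A i ∧ y ∈ A i) (x : α) :
    2 ≤ #{i | x ∈ A i} := by
  obtain ⟨y, hy⟩ := exists_ne x
  obtain ⟨i, ⟨hxi, -⟩, -⟩ := hpair x y hy.symm
  obtain ⟨z, hz⟩ : ∃ z, z ∉ A i := by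
    by_contra! h
    exact hproper i (eq_univ_iff_forall.2 h)
  obtain ⟨j, ⟨hxj, hzj⟩, -⟩ := hpair x z fun h => hz (h ▸ hxi)
  exact one_lt_card.2 ⟨i, by simpa using hxi, j, by simpa using hxj, fun h => hz (h ▸ hzj)⟩


/-- The De Bruijn–Erdős theorem from incidence geometry (inequality part):
if `A 1, …, A m` (`m > 1`) are proper subsets of an `n`-element set (`n ≥ 1`)
such that every pair of distinct elements lies in exactly one of the sets,
then `m ≥ n`. -/
theorem stmt4 (n m : ℕ) (hn : 1 ≤ n) (hm : 1 < m)
    (A : Fin m → Finset (Fin n))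
    (hproper : ∀ i, A i ≠ Finset.univ)
    (hpair : ∀ x y : Fin n, x ≠ y → ∃! i, x ∈ A i ∧ y ∈ A i) :
    n ≤ m := by
  obtain rfl | hn2 : n = 1 ∨ 1 < n := by omega
  · exact hm.le
  have : Nontrivial (Fin n) := Fin.nontrivial_iff_two_le.2 hn2
  let f : (Fin n → ℝ) →ₗ[ℝ] (Fin m → ℝ) :=
    LinearMap.pi fun i => ∑ x ∈ A i, LinearMap.proj x
  have hf (c : Fin n → ℝ) (i : Fin m) : f c i = ∑ x ∈ A i, c x := by
    simp [f]
  have hinj : Function.Injective f := by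
    refine (injective_iff_map_eq_zero f).2 fun c hc => funext fun x => ?_
    have h := sum_sq_block_sum_of_existsUnique A hpair c
    simp only [← hf, hc, Pi.zero_apply, ne_eq, OfNat.ofNat_ne_zero, not_false_eq_true, zero_pow,
      Finset.sum_const_zero] at h
    have hr (y : Fin n) : (2 : ℝ) ≤ (Finset.card {i | y ∈ A i} : ℝ) := by
      exact_mod_cast two_le_card_filter_mem_of_existsUnique A hproper hpair y
    have hle := Finset.single_le_sum
      (f := fun y => ((Finset.card {i | y ∈ A i} : ℝ) - 1) * c y ^ 2)
      (fun y _ => mul_nonneg (by linarith [hr y]) (sq_nonneg _)) (Finset.mem_univ x)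
    have hsq : c x ^ 2 ≤ 0 := by
      nlinarith [hr x, sq_nonneg (c x), sq_nonneg (∑ y, c y)]
    simpa using le_antisymm hsq (sq_nonneg _)
  simpa using LinearMap.finrank_le_finrank_of_injective hinj
end

section
/- Sylvester–Gallai theorem: Let S be a finite set of points in the real plane ℝ² that are not all collinear. Then there exists a line that passes through exactly two points of S. -/
/-- The signed area of the parallelogram spanned by `q - p` and `r - p`. -/
def planarCross (p q r : ℝ × ℝ) : ℝ :=
  (q.1 - p.1) * (r.2 - p.2) - (q.2 - p.2) * (r.1 - p.1)

/-- The square of the Euclidean distance between two points of the plane. -/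
def sqDist (p q : ℝ × ℝ) : ℝ :=
  (q.1 - p.1) ^ 2 + (q.2 - p.2) ^ 2

lemma sqDist_pos {p q : ℝ × ℝ} (h : p ≠ q) : 0 < sqDist p q := by
  by_contra! hle
  unfold sqDist at hle
  apply h
  ext <;> nlinarith [sq_nonneg (q.1 - p.1), sq_nonneg (q.2 - p.2)]

lemma ne_of_planarCross_ne_zero {p q r : ℝ × ℝ} (h : planarCross p q r ≠ 0) : p ≠ q := by
  rintro rfl
  simp [planarCross] at h

lemma planarCross_lineMap (p q x : ℝ × ℝ) (a b : ℝ) :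
    planarCross x (a • (q - p) + p) (b • (q - p) + p) = (b - a) * planarCross p q x := by
  simp [planarCross]
  ring

lemma exists_lineMap_of_planarCross_eq_zero {p q r : ℝ × ℝ} (hpq : p ≠ q)
    (h : planarCross p q r = 0) : ∃ t : ℝ, r = t • (q - p) + p := by
  have hD := (sqDist_pos hpq).ne'
  refine ⟨((r.1 - p.1) * (q.1 - p.1) + (r.2 - p.2) * (q.2 - p.2)) / sqDist p q, ?_⟩
  unfold planarCross at h
  unfold sqDist at hD ⊢
  ext
  · simp only [Prod.fst_add, Prod.smul_fst, Prod.fst_sub, smul_eq_mul]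
    field_simp
    linear_combination (-(q.2 - p.2)) * h
  · simp only [Prod.snd_add, Prod.smul_snd, Prod.snd_sub, smul_eq_mul]
    field_simp
    linear_combination (q.1 - p.1) * h

lemma exists_lineMap_of_collinear {p q r : ℝ × ℝ} (hpq : p ≠ q)
    (h : Collinear ℝ {p, q, r}) : ∃ t : ℝ, r = t • (q - p) + p := by
  apply exists_lineMap_of_planarCross_eq_zero hpq
  obtain ⟨v, hv⟩ := (collinear_iff_of_mem (p₀ := p) (by simp)).1 h
  obtain ⟨a, rfl⟩ := hv q (by simp)
  obtain ⟨b, rfl⟩ := hv r (by simp)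
  simp [planarCross]
  ring

lemma exists_planarCross_ne_zero {S : Set (ℝ × ℝ)} (h : ¬ Collinear ℝ S) :
    ∃ p ∈ S, ∃ q ∈ S, ∃ r ∈ S, planarCross p q r ≠ 0 := by
  by_contra! hS
  apply h
  rcases S.subsingleton_or_nontrivial with hs | ⟨p, hp, q, hq, hpq⟩
  · rcases hs.eq_empty_or_singleton with rfl | ⟨x, rfl⟩
    · exact collinear_empty ℝ _
    · exact collinear_singleton ℝ _
  · exact (collinear_iff_of_mem hp).2 ⟨q - p, fun r hr =>
      exists_lineMap_of_planarCross_eq_zero hpq (hS p hp q hq r hr)⟩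

lemma mul_neg_of_sq_lt_sq_sub {u v : ℝ} (hu : u ^ 2 < (u - v) ^ 2) (hv : v ^ 2 < (u - v) ^ 2) :
    u * v < 0 := by
  by_contra! h
  rcases le_total (u ^ 2) (v ^ 2) with h' | h' <;>
    nlinarith [abs_mul_abs_self u, abs_mul_abs_self v, abs_mul u v, abs_of_nonneg h,
      abs_nonneg u, abs_nonneg v, sq_le_sq.1 h']

/-- Points with parameters `a` and `b` on the line `pq`, together with a point `x` off that line:
if `x` is no closer to the line `pq` than the point `b` is to the line joining `x` and `a`, then
the foot of `x` is strictly closer to `a` than `b` is. -/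
lemma sq_sub_foot_lt {p q x : ℝ × ℝ} (hx : planarCross p q x ≠ 0) {a b : ℝ}
    (h : planarCross p q x ^ 2 / sqDist p q ≤
      planarCross x (a • (q - p) + p) (b • (q - p) + p) ^ 2 / sqDist x (a • (q - p) + p))
    (s : ℝ) (hs : s * sqDist p q = (x.1 - p.1) * (q.1 - p.1) + (x.2 - p.2) * (q.2 - p.2)) :
    (a - s) ^ 2 < (a - b) ^ 2 := by
  have hD := sqDist_pos (ne_of_planarCross_ne_zero hx)
  have hdist : sqDist x (a • (q - p) + p) * sqDist p q =
      ((a - s) * sqDist p q) ^ 2 + planarCross p q x ^ 2 := by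
    rw [sub_mul, hs]
    simp [sqDist, planarCross]
    ring
  have hC : 0 < planarCross p q x ^ 2 := by positivity
  have hE : 0 < sqDist x (a • (q - p) + p) := by
    refine pos_of_mul_pos_left (b := sqDist p q) ?_ hD.le
    rw [hdist]
    positivity
  rw [planarCross_lineMap, div_le_div_iff₀ hD hE, mul_pow, mul_right_comm, mul_comm] at h
  have h₁ := le_of_mul_le_mul_right h hC
  have h₂ := mul_le_mul_of_nonneg_right h₁ hD.le
  have h₃ : (a - s) ^ 2 * sqDist p q ^ 2 < (a - b) ^ 2 * sqDist p q ^ 2 := by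
    linarith
  exact lt_of_mul_lt_mul_right h₃ (sq_nonneg _)

/-- The Sylvester–Gallai theorem: a finite set of points in the real plane,
not all collinear, determines a line passing through exactly two of the
points. (The line through `p` and `q` meets `S` only in `p` and `q`.) -/
theorem stmt5 (S : Set (ℝ × ℝ)) (hfin : S.Finite) (hncol : ¬ Collinear ℝ S) :
    ∃ p ∈ S, ∃ q ∈ S, p ≠ q ∧
      ∀ r ∈ S, Collinear ℝ {p, q, r} → r = p ∨ r = q := by
  let T : Set ((ℝ × ℝ) × (ℝ × ℝ) × (ℝ × ℝ)) :=
    {w ∈ S ×ˢ S ×ˢ S | planarCross w.1 w.2.1 w.2.2 ≠ 0}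
  have hT : T.Finite := (hfin.prod (hfin.prod hfin)).subset (Set.sep_subset _ _)
  have hne : T.Nonempty := by
    obtain ⟨p, hp, q, hq, r, hr, h⟩ := exists_planarCross_ne_zero hncol
    exact ⟨(p, q, r), ⟨hp, hq, hr⟩, h⟩
  obtain ⟨⟨p, q, x⟩, ⟨⟨hp, hq, hx⟩, hC⟩, hmin⟩ := Set.exists_min_image T
    (fun w => planarCross w.1 w.2.1 w.2.2 ^ 2 / sqDist w.1 w.2.1) hT hne
  dsimp only at hp hq hx hC hmin
  have hpq := ne_of_planarCross_ne_zero hC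
  refine ⟨p, hp, q, hq, hpq, fun r hr hcol => ?_⟩
  obtain ⟨t, rfl⟩ := exists_lineMap_of_collinear hpq hcol
  by_contra! hrpq
  have ht0 : t ≠ 0 := by
    rintro rfl
    simp at hrpq
  have ht1 : t ≠ 1 := by
    rintro rfl
    simp at hrpq
  obtain ⟨s, hs⟩ : ∃ s : ℝ,
      s * sqDist p q = (x.1 - p.1) * (q.1 - p.1) + (x.2 - p.2) * (q.2 - p.2) :=
    ⟨_, div_mul_cancel₀ _ (sqDist_pos hpq).ne'⟩
  have key : ∀ a b : ℝ, a • (q - p) + p ∈ S → b • (q - p) + p ∈ S → a ≠ b →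
      (a - s) ^ 2 < (a - b) ^ 2 := by
    intro a b ha hb hab
    refine sq_sub_foot_lt hC (hmin (x, _, _) ⟨⟨hx, ha, hb⟩, ?_⟩) s hs
    exact planarCross_lineMap p q x a b ▸ mul_ne_zero (sub_ne_zero.2 hab.symm) hC
  have opposite : ∀ a b : ℝ, a • (q - p) + p ∈ S → b • (q - p) + p ∈ S → a ≠ b →
      (a - s) * (b - s) < 0 := by
    intro a b ha hb hab
    apply mul_neg_of_sq_lt_sq_sub
    · linarith [key a b ha hb hab]
    · linarith [key b a hb ha hab.symm]
  have h0 : (0 : ℝ) • (q - p) + p ∈ S := by simpa using hp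
  have h1 : (1 : ℝ) • (q - p) + p ∈ S := by simpa using hq
  have h01 := opposite 0 1 h0 h1 zero_ne_one
  have h0t := opposite 0 t h0 hr ht0.symm
  have h1t := opposite 1 t h1 hr ht1.symm
  nlinarith [mul_pos_of_neg_of_neg h01 h0t, sq_nonneg (0 - s)]
end

section
/- Let S be a set of n points in the real plane ℝ² that are not all collinear. Then the number of distinct lines that pass through at least two points of S is at least n; moreover, if this number equals n, then some n−1 of the points of S lie on one line. -/
namespace PlaneConfiguration

/-- Twice the signed area of the triangle `p q r`. -/
def cross (p q r : ℝ × ℝ) : ℝ :=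
  (q.1 - p.1) * (r.2 - p.2) - (q.2 - p.2) * (r.1 - p.1)

/-- The squared Euclidean distance between two points of the plane. -/
def sqDist (p q : ℝ × ℝ) : ℝ :=
  (q.1 - p.1) ^ 2 + (q.2 - p.2) ^ 2

lemma sqDist_pos {p q : ℝ × ℝ} (h : p ≠ q) : 0 < sqDist p q := by
  by_contra! hn
  refine h (Prod.ext ?_ ?_) <;> unfold sqDist at hn <;>
    nlinarith [sq_nonneg (q.1 - p.1), sq_nonneg (q.2 - p.2)]

lemma exists_eq_add_mul_of_cross_eq_zero {p q x : ℝ × ℝ} (h : p ≠ q) (hx : cross p q x = 0) :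
    ∃ t : ℝ, x.1 = p.1 + t * (q.1 - p.1) ∧ x.2 = p.2 + t * (q.2 - p.2) := by
  have hd := sqDist_pos h
  refine ⟨((x.1 - p.1) * (q.1 - p.1) + (x.2 - p.2) * (q.2 - p.2)) / sqDist p q, ?_, ?_⟩ <;>
    field_simp <;> unfold sqDist <;> unfold cross at hx
  · linear_combination -(q.2 - p.2) * hx
  · linear_combination (q.1 - p.1) * hx

lemma exists_cross_eq_mul {p q x y : ℝ × ℝ} (h : p ≠ q) (hx : cross p q x = 0)
    (hy : cross p q y = 0) (hxy : x ≠ y) :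
    ∃ c : ℝ, c ≠ 0 ∧ ∀ r, cross x y r = c * cross p q r := by
  obtain ⟨s, hs₁, hs₂⟩ := exists_eq_add_mul_of_cross_eq_zero h hx
  obtain ⟨t, ht₁, ht₂⟩ := exists_eq_add_mul_of_cross_eq_zero h hy
  refine ⟨t - s, fun hst => hxy ?_, fun r => ?_⟩
  · obtain rfl : t = s := by linarith
    exact Prod.ext (hs₁.trans ht₁.symm) (hs₂.trans ht₂.symm)
  · simp only [cross, hs₁, hs₂, ht₁, ht₂]
    ring

lemma cross_eq_zero_iff {p q x y : ℝ × ℝ} (h : p ≠ q) (hx : cross p q x = 0)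
    (hy : cross p q y = 0) (hxy : x ≠ y) (r : ℝ × ℝ) : cross x y r = 0 ↔ cross p q r = 0 := by
  obtain ⟨c, hc, hr⟩ := exists_cross_eq_mul h hx hy hxy
  simp [hr, hc]

lemma cross_self_left (p q : ℝ × ℝ) : cross p p q = 0 := by unfold cross; ring

lemma cross_self_right (p q : ℝ × ℝ) : cross p q q = 0 := by unfold cross; ring

lemma cross_self_outer (p q : ℝ × ℝ) : cross p q p = 0 := by unfold cross; ring

lemma cross_swap_right (p q r : ℝ × ℝ) : cross p r q = -cross p q r := by unfold cross; ring

lemma cross_rotate (p q r : ℝ × ℝ) : cross q r p = cross p q r := by unfold cross; ring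

lemma collinear_of_cross_eq_zero {T : Set (ℝ × ℝ)} {a : ℝ × ℝ} (ha : a ∈ T)
    (h : ∀ c ∈ T, ∀ d ∈ T, cross a c d = 0) : Collinear ℝ T := by
  by_cases hT : ∃ c ∈ T, c ≠ a
  · obtain ⟨c, hc, hca⟩ := hT
    refine (collinear_iff_of_mem ha).2 ⟨c - a, fun d hd => ?_⟩
    obtain ⟨t, ht₁, ht₂⟩ := exists_eq_add_mul_of_cross_eq_zero hca.symm (h c hc d hd)
    refine ⟨t, Prod.ext ?_ ?_⟩ <;> simp [ht₁, ht₂, add_comm]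
  · push Not at hT
    exact (collinear_singleton ℝ a).subset hT

lemma collinear_triple_iff {p q r : ℝ × ℝ} : Collinear ℝ {p, q, r} ↔ cross p q r = 0 := by
  constructor
  · intro h
    obtain ⟨v, hv⟩ := (collinear_iff_of_mem (p₀ := p) (by simp)).1 h
    obtain ⟨s, rfl⟩ := hv q (by simp)
    obtain ⟨t, rfl⟩ := hv r (by simp)
    simp [cross]
    ring
  · intro h
    have h' : cross p r q = 0 := by rw [cross_swap_right, h, neg_zero]
    refine collinear_of_cross_eq_zero (a := p) (by simp) ?_
    rintro c (rfl | rfl | rfl) d (rfl | rfl | rfl) <;>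
      first | assumption | apply cross_self_left | apply cross_self_right | apply cross_self_outer

lemma sq_mul_lt_of_far {D N M a b k : ℝ} (hD : 0 < D) (hN : 0 < N) (hdiff : b - a = k * N)
    (hM : M * N = D + b ^ 2) (hside : 0 ≤ a * b) (hfar : a ^ 2 ≤ b ^ 2) : k ^ 2 * N < M := by
  have hab : a ^ 2 ≤ a * b := by
    rw [← sq_abs, sq, ← abs_of_nonneg hside, abs_mul]
    exact mul_le_mul_of_nonneg_left (sq_le_sq.1 hfar) (abs_nonneg a)
  refine lt_of_mul_lt_mul_right ?_ hN.le
  calc k ^ 2 * N * N = (b - a) ^ 2 := by rw [hdiff]; ring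
    _ < M * N := by rw [hM]; linarith [sub_sq b a, sq_nonneg a]

/-- If `x` and `y` lie on the line `q r` on the same side of the foot of the perpendicular from `p`,
and `y` is the farther one, then `x` is closer to the line `p y` than `p` is to the line `q r`. -/
lemma cross_sq_div_sqDist_lt {p q r x y : ℝ × ℝ} (hp : cross p q r ≠ 0)
    (hx : cross q r x = 0) (hy : cross q r y = 0) (hxy : x ≠ y)
    (hside : 0 ≤ ((x.1 - p.1) * (r.1 - q.1) + (x.2 - p.2) * (r.2 - q.2)) *
      ((y.1 - p.1) * (r.1 - q.1) + (y.2 - p.2) * (r.2 - q.2)))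
    (hfar : ((x.1 - p.1) * (r.1 - q.1) + (x.2 - p.2) * (r.2 - q.2)) ^ 2 ≤
      ((y.1 - p.1) * (r.1 - q.1) + (y.2 - p.2) * (r.2 - q.2)) ^ 2) :
    cross x p y ≠ 0 ∧
      cross x p y ^ 2 / sqDist p y < cross p q r ^ 2 / sqDist q r := by
  have hqr : q ≠ r := by rintro rfl; exact hp (cross_self_right _ _)
  obtain ⟨s, hs₁, hs₂⟩ := exists_eq_add_mul_of_cross_eq_zero hqr hx
  obtain ⟨t, ht₁, ht₂⟩ := exists_eq_add_mul_of_cross_eq_zero hqr hy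
  have hst : t - s ≠ 0 := fun hst => hxy <| by
    obtain rfl : t = s := by linarith
    exact Prod.ext (hs₁.trans ht₁.symm) (hs₂.trans ht₂.symm)
  have hc : cross x p y = -(t - s) * cross p q r := by
    simp only [cross, hs₁, hs₂, ht₁, ht₂]; ring
  have hne : cross x p y ≠ 0 := by rw [hc]; exact mul_ne_zero (neg_ne_zero.2 hst) hp
  have hpy : p ≠ y := by rintro rfl; exact hne (cross_self_right _ _)
  refine ⟨hne, ?_⟩
  have hu := sqDist_pos hqr
  have hlt : (t - s) ^ 2 * sqDist q r < sqDist p y := by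
    refine sq_mul_lt_of_far (by positivity : 0 < cross p q r ^ 2) hu ?_ ?_ hside hfar
    · simp only [sqDist, hs₁, hs₂, ht₁, ht₂]; ring
    · simp only [sqDist, cross, ht₁, ht₂]; ring
  rw [div_lt_div_iff₀ (sqDist_pos hpy) hu, hc]
  calc (-(t - s) * cross p q r) ^ 2 * sqDist q r
      = cross p q r ^ 2 * ((t - s) ^ 2 * sqDist q r) := by ring
    _ < cross p q r ^ 2 * sqDist p y := by gcongr

/-- The **Sylvester–Gallai theorem**: a finite non-collinear set in the plane determines a line
containing exactly two of its points. -/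
theorem exists_ordinary_line {S : Set (ℝ × ℝ)} (hfin : S.Finite) (hncol : ¬ Collinear ℝ S) :
    ∃ a ∈ S, ∃ b ∈ S, a ≠ b ∧ ∀ c ∈ S, cross a b c = 0 → c = a ∨ c = b := by
  let F : Set ((ℝ × ℝ) × (ℝ × ℝ) × (ℝ × ℝ)) :=
    {x | (x.1 ∈ S ∧ x.2.1 ∈ S ∧ x.2.2 ∈ S) ∧ cross x.1 x.2.1 x.2.2 ≠ 0}
  have hF : F.Finite := (hfin.prod (hfin.prod hfin)).subset fun x hx => hx.1
  have hne : F.Nonempty := by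
    obtain ⟨a, ha⟩ : S.Nonempty := by
      by_contra! h
      exact hncol (h ▸ collinear_empty ℝ _)
    by_contra! h
    refine hncol (collinear_of_cross_eq_zero ha fun c hc d hd => ?_)
    by_contra hcd
    have hm : (a, c, d) ∈ F := ⟨⟨ha, hc, hd⟩, hcd⟩
    simp [h] at hm
  obtain ⟨⟨p, q, r⟩, ⟨⟨hpS, hqS, hrS⟩, hD⟩, hmin⟩ :=
    Set.exists_min_image F (fun x => cross x.1 x.2.1 x.2.2 ^ 2 / sqDist x.2.1 x.2.2) hF hne
  dsimp only at hpS hqS hrS hD hmin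
  have hqr : q ≠ r := by rintro rfl; exact hD (cross_self_right _ _)
  refine ⟨q, hqS, r, hrS, hqr, fun c hcS hc => ?_⟩
  by_contra! hcqr
  let t (x : ℝ × ℝ) : ℝ := (x.1 - p.1) * (r.1 - q.1) + (x.2 - p.2) * (r.2 - q.2)
  have far : ∀ x ∈ S, ∀ y ∈ S, cross q r x = 0 → cross q r y = 0 → x ≠ y → 0 ≤ t x * t y →
      t x ^ 2 ≤ t y ^ 2 → False := fun x hxS y hyS hx hy hxy hs hf => by
    obtain ⟨hn, hlt⟩ := cross_sq_div_sqDist_lt hD hx hy hxy hs hf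
    exact absurd (hmin (x, p, y) ⟨⟨hxS, hpS, hyS⟩, hn⟩) (not_le.2 hlt)
  have key : ∀ x ∈ S, ∀ y ∈ S, cross q r x = 0 → cross q r y = 0 → x ≠ y → t x * t y < 0 := by
    intro x hxS y hyS hx hy hxy
    by_contra! hs
    rcases le_total (t x ^ 2) (t y ^ 2) with hf | hf
    · exact far x hxS y hyS hx hy hxy hs hf
    · exact far y hyS x hxS hy hx hxy.symm (by linarith) hf
  clear_value t
  have h₁ := key q hqS r hrS (cross_self_outer _ _) (cross_self_right _ _) hqr
  have h₂ := key q hqS c hcS (cross_self_outer _ _) hc hcqr.1.symm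
  have h₃ := key r hrS c hcS (cross_self_right _ _) hc hcqr.2.symm
  have hprod : t q * t r * (t q * t c) * (t r * t c) < 0 :=
    mul_neg_of_pos_of_neg (mul_pos_of_neg_of_neg h₁ h₂) h₃
  have hsq : t q * t r * (t q * t c) * (t r * t c) = (t q * t r * t c) ^ 2 := by ring
  exact absurd (hsq ▸ hprod) (not_lt.2 (sq_nonneg _))

/-- The lines determined by a set of points of the plane. -/
def determinedLines (S : Set (ℝ × ℝ)) : Set (Set (ℝ × ℝ)) :=
  {l | ∃ p ∈ S, ∃ q ∈ S, p ≠ q ∧ l = {r | Collinear ℝ {p, q, r}}}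

instance (S : Set (ℝ × ℝ)) : Membership S (determinedLines S) :=
  ⟨fun l p => (p : ℝ × ℝ) ∈ (l : Set (ℝ × ℝ))⟩

lemma mem_iff {S : Set (ℝ × ℝ)} {p : S} {l : determinedLines S} :
    p ∈ l ↔ (p : ℝ × ℝ) ∈ (l : Set (ℝ × ℝ)) := Iff.rfl

/-- The line through two distinct points of `S`. -/
def lineThrough {S : Set (ℝ × ℝ)} {p q : S} (h : p ≠ q) : determinedLines S :=
  ⟨{r | Collinear ℝ {(p : ℝ × ℝ), (q : ℝ × ℝ), r}}, p, p.2, q, q.2, Subtype.coe_ne_coe.2 h, rfl⟩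

lemma mem_lineThrough {S : Set (ℝ × ℝ)} {p q r : S} (h : p ≠ q) :
    r ∈ lineThrough h ↔ cross p q r = 0 :=
  collinear_triple_iff

lemma eq_lineThrough {S : Set (ℝ × ℝ)} {p q : S} (h : p ≠ q) {l : determinedLines S}
    (hp : p ∈ l) (hq : q ∈ l) : l = lineThrough h := by
  obtain ⟨_, x, hx, y, hy, hxy, rfl⟩ := l
  refine Subtype.ext (Set.ext fun r => ?_)
  change Collinear ℝ {x, y, r} ↔ Collinear ℝ {(p : ℝ × ℝ), (q : ℝ × ℝ), r}
  rw [collinear_triple_iff, collinear_triple_iff]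
  exact (cross_eq_zero_iff hxy (collinear_triple_iff.1 hp) (collinear_triple_iff.1 hq)
    (Subtype.coe_ne_coe.2 h) r).symm

lemma finite_determinedLines {S : Set (ℝ × ℝ)} (hfin : S.Finite) : (determinedLines S).Finite := by
  refine ((hfin.prod hfin).image fun x => {r | Collinear ℝ {x.1, x.2, r}}).subset ?_
  rintro _ ⟨p, hp, q, hq, -, rfl⟩
  exact ⟨(p, q), ⟨hp, hq⟩, rfl⟩

/-- Points and determined lines of a non-collinear set form a nondegenerate configuration in which
any two points are joined by a line. -/
@[reducible]
def hasLines {S : Set (ℝ × ℝ)} (hncol : ¬ Collinear ℝ S) :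
    Configuration.HasLines S (determinedLines S) where
  exists_point l := by
    obtain ⟨_, p, hp, q, hq, hpq, rfl⟩ := l
    by_contra! h
    refine hncol (collinear_of_cross_eq_zero hp fun c hc d hd => ?_)
    have hc' : cross p q c = 0 := collinear_triple_iff.1 (h ⟨c, hc⟩)
    have hd' : cross p q d = 0 := collinear_triple_iff.1 (h ⟨d, hd⟩)
    by_cases hpc : p = c
    · rw [hpc, cross_self_left]
    · exact (cross_eq_zero_iff hpq (cross_self_outer _ _) hc' hpc d).2 hd'
  exists_line p := by
    by_contra! h
    refine hncol (collinear_of_cross_eq_zero p.2 fun c hc d hd => ?_)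
    by_cases hcd : c = d
    · rw [hcd, cross_self_right]
    · have hne : (⟨c, hc⟩ : S) ≠ ⟨d, hd⟩ := fun h => hcd (congrArg Subtype.val h)
      rw [← cross_rotate]
      exact (mem_lineThrough hne).1 (h (lineThrough hne))
  eq_or_eq {p q l m} hpl hql hpm hqm := by
    by_cases hpq : p = q
    · exact Or.inl hpq
    · exact Or.inr ((eq_lineThrough hpq hpl hql).trans (eq_lineThrough hpq hpm hqm).symm)
  mkLine h := lineThrough h
  mkLine_ax h := ⟨(mem_lineThrough h).2 (cross_self_outer _ _),
    (mem_lineThrough h).2 (cross_self_right _ _)⟩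

lemma forall_or_forall_of_trans {α : Type*} {T : Set α} {R R' : α → α → Prop}
    (symm : ∀ c d, R c d → R d c) (symm' : ∀ c d, R' c d → R' d c)
    (trans : ∀ c, ∀ d ∈ T, ∀ e, R c d → R d e → R c e)
    (trans' : ∀ c, ∀ d ∈ T, ∀ e, R' c d → R' d e → R' c e)
    (h : ∀ c ∈ T, ∀ d ∈ T, R c d ∨ R' c d) :
    (∀ c ∈ T, ∀ d ∈ T, R c d) ∨ (∀ c ∈ T, ∀ d ∈ T, R' c d) := by
  by_contra! hn
  obtain ⟨⟨c, hc, d, hd, hcd⟩, e, he, f, hf, hef⟩ := hn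
  have := h c hc d hd
  have := h e he f hf
  have := h c hc e he
  have := h c hc f hf
  have := h d hd e he
  have := h d hd f hf
  grind

lemma cross_trans {a c d e : ℝ × ℝ} (had : a ≠ d) (hcd : cross a c d = 0)
    (hde : cross a d e = 0) : cross a c e = 0 := by
  by_cases hac : a = c
  · rw [hac, cross_self_left]
  · refine (cross_eq_zero_iff had (cross_self_outer _ _) ?_ hac e).2 hde
    rw [cross_swap_right, hcd, neg_zero]

lemma exists_collinear_diff_singleton {S : Set (ℝ × ℝ)} {a b : ℝ × ℝ} (ha : a ∈ S) (hb : b ∈ S)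
    (hab : a ≠ b)
    (h : ∀ c ∈ S \ {a, b}, ∀ d ∈ S \ {a, b}, cross a c d = 0 ∨ cross b c d = 0) :
    ∃ x ∈ S, Collinear ℝ (S \ {x}) := by
  have extend : ∀ u v, u ∈ S → u ≠ v →
      (∀ c ∈ S \ {u, v}, ∀ d ∈ S \ {u, v}, cross u c d = 0) → Collinear ℝ (S \ {v}) := by
    intro u v hu huv huc
    refine collinear_of_cross_eq_zero (a := u) ⟨hu, huv⟩ fun c hc d hd => ?_
    by_cases hcu : c = u
    · rw [hcu, cross_self_left]
    by_cases hdu : d = u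
    · rw [hdu, cross_self_outer]
    exact huc c ⟨hc.1, by simpa [hcu] using hc.2⟩ d ⟨hd.1, by simpa [hdu] using hd.2⟩
  have symm : ∀ u c d, cross u c d = 0 → cross u d c = 0 := fun u c d hcd => by
    rw [cross_swap_right, hcd, neg_zero]
  rcases forall_or_forall_of_trans (symm a) (symm b)
    (fun c d hd e => cross_trans fun had => hd.2 (by simp [had]))
    (fun c d hd e => cross_trans fun hbd => hd.2 (by simp [hbd])) h with h | h
  · exact ⟨b, hb, extend a b ha hab h⟩
  · exact ⟨a, ha, extend b a hb hab.symm (by rwa [Set.pair_comm])⟩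

end PlaneConfiguration

/-- A set of `n` points in the real plane, not all collinear, determines at
least `n` lines; if it determines exactly `n` lines, then some `n - 1` of the
points are collinear. A line determined by `S` is encoded as the set of
points collinear with two distinct points `p, q ∈ S`. -/
theorem stmt6 (n : ℕ) (S : Set (ℝ × ℝ)) (hfin : S.Finite) (hcard : Nat.card S = n)
    (hncol : ¬ Collinear ℝ S) :
    n ≤ Nat.card {l : Set (ℝ × ℝ) |
        ∃ p ∈ S, ∃ q ∈ S, p ≠ q ∧ l = {r | Collinear ℝ {p, q, r}}} ∧
      (Nat.card {l : Set (ℝ × ℝ) |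
          ∃ p ∈ S, ∃ q ∈ S, p ≠ q ∧ l = {r | Collinear ℝ {p, q, r}}} = n →
        ∃ T ⊆ S, Nat.card T = n - 1 ∧ Collinear ℝ T) := by
  have hS := hfin.to_subtype
  have hL := (PlaneConfiguration.finite_determinedLines hfin).to_subtype
  have := Fintype.ofFinite S
  have := Fintype.ofFinite (PlaneConfiguration.determinedLines S)
  have := PlaneConfiguration.hasLines hncol
  change n ≤ Nat.card (PlaneConfiguration.determinedLines S) ∧
    (Nat.card (PlaneConfiguration.determinedLines S) = n → _)
  subst hcard
  refine ⟨?_, fun heq => ?_⟩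
  · simpa only [Nat.card_eq_fintype_card] using
      Configuration.HasLines.card_le S (PlaneConfiguration.determinedLines S)
  simp only [Nat.card_eq_fintype_card] at heq
  have hpts := Configuration.HasLines.hasPoints heq.symm
  obtain ⟨a, ha, b, hb, hab, hord⟩ := PlaneConfiguration.exists_ordinary_line hfin hncol
  obtain ⟨x, hx, hcol⟩ : ∃ x ∈ S, Collinear ℝ (S \ {x}) := by
    refine PlaneConfiguration.exists_collinear_diff_singleton ha hb hab fun c hc d hd => ?_
    by_cases hcd : c = d
    · exact Or.inl (by rw [hcd, PlaneConfiguration.cross_self_right])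
    have hab' : (⟨a, ha⟩ : S) ≠ ⟨b, hb⟩ := fun h => hab (congrArg Subtype.val h)
    have hcd' : (⟨c, hc.1⟩ : S) ≠ ⟨d, hd.1⟩ := fun h => hcd (congrArg Subtype.val h)
    have hne : PlaneConfiguration.lineThrough hab' ≠ PlaneConfiguration.lineThrough hcd' := by
      intro h
      have hmem : (⟨c, hc.1⟩ : S) ∈ PlaneConfiguration.lineThrough hab' := by
        rw [h, PlaneConfiguration.mem_lineThrough]
        exact PlaneConfiguration.cross_self_outer _ _
      exact hc.2 (hord c hc.1 ((PlaneConfiguration.mem_lineThrough hab').1 hmem))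
    obtain ⟨h₁, h₂⟩ := hpts.mkPoint_ax hne
    rw [PlaneConfiguration.mem_lineThrough] at h₁ h₂
    rw [← PlaneConfiguration.cross_rotate, ← PlaneConfiguration.cross_rotate b]
    rcases hord _ (hpts.mkPoint hne).2 h₁ with h | h <;> rw [h] at h₂
    · exact Or.inl h₂
    · exact Or.inr h₂
  exact ⟨S \ {x}, Set.sdiff_subset, Set.ncard_sdiff_singleton_of_mem hx, hcol⟩
end

section
/- De Bruijn–Erdős coloring theorem: Let k be a natural number and let G be a simple graph (on a possibly infinite vertex set). Then G admits a proper k-coloring if and only if every finite induced subgraph of G admits a proper k-coloring. -/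
/-- The De Bruijn–Erdős colouring theorem: a (possibly infinite) simple graph
is `k`-colourable if and only if every finite induced subgraph is
`k`-colourable. -/
theorem stmt7 {V : Type*} (G : SimpleGraph V) (k : ℕ) :
    G.Colorable k ↔ ∀ s : Finset V, (G.induce (↑s : Set V)).Colorable k := by
  refine ⟨fun h s => h.of_hom (SimpleGraph.Embedding.induce (G := G) (↑s : Set V)).toHom,
    fun h => SimpleGraph.nonempty_hom_of_forall_finite_subgraph_hom fun G' hG' => ?_⟩
  have c := (h hG'.toFinset).some
  exact ⟨fun v => c ⟨v, by simp⟩, fun {v w} hvw => c.map_rel (G'.adj_sub hvw)⟩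
end

section
/- Rado's selection theorem: Let M and M_I be arbitrary sets, and suppose that for every i ∈ M_I a finite subset A_i ⊆ M is given. Suppose that for every finite subset N ⊆ M_I there is a choice function f_N : N → M with f_N(i) ∈ A_i for all i ∈ N. Then there exists a choice function f : M_I → M with f(i) ∈ A_i for all i ∈ M_I, having the property that for every finite subset K ⊆ M_I there is a finite subset N with K ⊆ N ⊆ M_I such that f(i) = f_N(i) for every i ∈ K. -/
/-- Rado's selection theorem: given finite sets `A i ⊆ M` for `i ∈ M_I` and a
choice function `fN N` on every finite subset `N` of the index set, there is a
global choice function `f` such that every finite `K` is contained in some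
finite `N` with `f` agreeing with `fN N` on `K`. -/
theorem stmt8 {I M : Type*} (A : I → Finset M) (fN : Finset I → I → M)
    (hfN : ∀ N : Finset I, ∀ i ∈ N, fN N i ∈ A i) :
    ∃ f : I → M, (∀ i, f i ∈ A i) ∧
      ∀ K : Finset I, ∃ N : Finset I, K ⊆ N ∧ ∀ i ∈ K, f i = fN N i := by
  classical
  let U : Ultrafilter (Finset I) := Ultrafilter.of Filter.atTop
  have hU : ∀ K : Finset I, ∀ᶠ N in (U : Filter (Finset I)), K ⊆ N := fun K =>
    Ultrafilter.of_le Filter.atTop (Filter.eventually_ge_atTop K)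
  have h_limit : ∀ i, ∃ a ∈ A i, ∀ᶠ N in (U : Filter (Finset I)), a = fN N i := by
    intro i
    have h_mem : (⋃ a ∈ (A i : Set M), {N | a = fN N i}) ∈ U := by
      filter_upwards [hU {i}] with N hN
      simpa using hfN N i (Finset.singleton_subset_iff.mp hN)
    exact (Ultrafilter.finite_biUnion_mem_iff (A i).finite_toSet).mp h_mem
  choose f hfA hf using h_limit
  refine ⟨f, hfA, fun K => ?_⟩
  have h_agree : ∀ᶠ N in (U : Filter (Finset I)), ∀ i ∈ K, f i = fN N i :=
    (Filter.eventually_all_finset K).mpr fun i _ => hf i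
  exact ((hU K).and h_agree).exists
end

section
/- Let k be a natural number, let S be a set, and suppose that for every s ∈ S a subset f(s) ⊆ S \ {s} with at most k elements is given. Call two elements b, c ∈ S independent if b ∉ f(c) and c ∉ f(b), and call a subset A ⊆ S independent if every two distinct elements of A are independent. Then S is the union of 2k+1 independent subsets. -/
/-- In a finite digraph with out-degrees at most `k`, some vertex has in-degree at most `k`. -/
theorem exists_card_filter_mem_le {S : Type*} [DecidableEq S] {k : ℕ} {f : S → Finset S}
    (hcard : ∀ s, (f s).card ≤ k) {T : Finset S} (hT : T.Nonempty) :
    ∃ v ∈ T, (T.filter fun c => v ∈ f c).card ≤ k := by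
  apply Finset.exists_le_of_sum_le hT
  calc ∑ v ∈ T, (T.filter fun c => v ∈ f c).card
      = ∑ c ∈ T, (T.filter fun v => v ∈ f c).card :=
        Finset.sum_card_bipartiteAbove_eq_sum_card_bipartiteBelow fun v c => v ∈ f c
    _ ≤ ∑ _c ∈ T, k := Finset.sum_le_sum fun c _ =>
        (Finset.card_le_card fun v hv => (Finset.mem_filter.mp hv).2).trans (hcard c)

/-- A finite digraph with out-degrees at most `k` is properly `2 * k + 1`-colorable. -/
theorem exists_finset_coloring {S : Type*} {k : ℕ} {f : S → Finset S}
    (hcard : ∀ s, (f s).card ≤ k) (T : Finset S) :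
    ∃ g : S → Fin (2 * k + 1), ∀ b ∈ T, ∀ c ∈ T, b ≠ c → b ∈ f c → g b ≠ g c := by
  classical
  induction T using Finset.strongInduction with
  | H T ih =>
    obtain rfl | hT := T.eq_empty_or_nonempty
    · exact ⟨fun _ => 0, by simp⟩
    obtain ⟨v, hv, hvk⟩ := exists_card_filter_mem_le hcard hT
    obtain ⟨g, hg⟩ := ih (T.erase v) (Finset.erase_ssubset hv)
    obtain ⟨a, ha⟩ : ∃ a, a ∉ (f v ∪ T.filter fun c => v ∈ f c).image g := by
      by_contra! h
      have h₁ := Finset.card_image_le (s := f v ∪ T.filter fun c => v ∈ f c) (f := g)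
      rw [Finset.eq_univ_of_forall h, Finset.card_univ, Fintype.card_fin] at h₁
      have h₂ := Finset.card_union_le (f v) (T.filter fun c => v ∈ f c)
      have h₃ := hcard v
      omega
    have ha' : ∀ c, (c ∈ f v ∨ c ∈ T ∧ v ∈ f c) → g c ≠ a := by
      intro c hc hca
      exact ha (Finset.mem_image.mpr ⟨c, by simpa using hc, hca⟩)
    refine ⟨Function.update g v a, fun b hb c hc hbc hbf => ?_⟩
    by_cases hbv : b = v
    · subst hbv
      rw [Function.update_self, Function.update_of_ne hbc.symm]
      exact (ha' c (.inr ⟨hc, hbf⟩)).symm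
    by_cases hcv : c = v
    · subst hcv
      rw [Function.update_self, Function.update_of_ne hbc]
      exact ha' b (.inl hbf)
    rw [Function.update_of_ne hbv, Function.update_of_ne hcv]
    exact hg b (Finset.mem_erase.mpr ⟨hbv, hb⟩) c (Finset.mem_erase.mpr ⟨hcv, hc⟩) hbc hbf

/-- De Bruijn–Erdős application: if every `s ∈ S` is assigned a finite set
`f s ⊆ S \ {s}` of at most `k` elements, then `S` is the union of `2k + 1`
sets each of which is independent (pairwise, `b ∉ f c` and `c ∉ f b`). -/
theorem stmt9 {S : Type*} (k : ℕ) (f : S → Finset S)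
    (hf : ∀ s, s ∉ f s) (hcard : ∀ s, (f s).card ≤ k) :
    ∃ P : Fin (2 * k + 1) → Set S, (⋃ i, P i) = Set.univ ∧
      ∀ i, ∀ b ∈ P i, ∀ c ∈ P i, b ≠ c → b ∉ f c ∧ c ∉ f b := by
  classical
  choose g hg using exists_finset_coloring hcard
  obtain ⟨χ, hχ⟩ := Finset.rado_selection (β := fun _ => Fin (2 * k + 1)) g
  have key : ∀ b c, b ≠ c → b ∈ f c → χ b ≠ χ c := by
    intro b c hbc hbf
    obtain ⟨t, hst, ht⟩ := hχ {b, c}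
    rw [ht b (by simp), ht c (by simp)]
    exact hg t b (hst (by simp)) c (hst (by simp)) hbc hbf
  refine ⟨fun i => χ ⁻¹' {i}, by ext; simp, ?_⟩
  rintro i b rfl c hc hbc
  exact ⟨fun h => key b c hbc h hc.symm, fun h => key c b hbc.symm h hc⟩
end

section
/- Kirchhoff's matrix-tree theorem for directed graphs: Let a finite directed multigraph on vertices p_1, …, p_n be given by a matrix C where C(i,j) ∈ ℕ is the number of arcs from p_i to p_j (with C(i,i) = 0). Define the n×n matrix M by M(i,i) = Σ_j C(i,j) (the out-degree of p_i) and M(i,j) = −C(i,j) for i ≠ j. Then for every k, the number of spanning trees with all arcs directed toward the root p_k equals the (k,k)-minor of M, i.e., the determinant of the matrix obtained from M by deleting the k-th row and the k-th column. Here the number of spanning trees directed toward p_k equals the sum, over all functions t assigning to each vertex p_i with i ≠ k a vertex t(i) such that the arcs (p_i, p_{t(i)}) contain no cycle (so that iterating t from any vertex eventually reaches p_k), of the product ∏_{i ≠ k} C(i, t(i)). -/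
/-- The reduced adjacency matrix of the functional graph of `t`, with the vertex `k` deleted. -/
def reducedFunMatrix {m : ℕ} (k : Fin (m + 1)) (t : Fin (m + 1) → Fin (m + 1)) :
    Matrix (Fin m) (Fin m) ℤ :=
  Matrix.of fun i l => if t (k.succAbove i) = k.succAbove l then 1 else 0

theorem reducedFunMatrix_mul_apply {m : ℕ} {k : Fin (m + 1)} {t : Fin (m + 1) → Fin (m + 1)}
    (f : Fin (m + 1) → ℤ) (hf : f k = 0) (i : Fin m) :
    ∑ l, reducedFunMatrix k t i l * f (k.succAbove l) = f (t (k.succAbove i)) := by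
  have h := Fin.sum_univ_succAbove (fun v => (if t (k.succAbove i) = v then 1 else 0) * f v) k
  simp only [hf, mul_zero, zero_add] at h
  simp only [reducedFunMatrix, Matrix.of_apply]
  rw [← h]
  simp

theorem reducedFunMatrix_pow {m : ℕ} {k : Fin (m + 1)} {t : Fin (m + 1) → Fin (m + 1)}
    (hk : t k = k) (p : ℕ) :
    reducedFunMatrix k t ^ p = reducedFunMatrix k t^[p] := by
  induction p with
  | zero =>
    ext i l
    simp [reducedFunMatrix, Matrix.one_apply]
  | succ p ih =>
    ext i l
    rw [pow_succ', ih, Matrix.mul_apply]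
    have hp : t^[p] k = k := Function.iterate_fixed hk p
    have h := reducedFunMatrix_mul_apply (k := k) (t := t)
      (fun v => if t^[p] v = k.succAbove l then (1 : ℤ) else 0)
      (by simp [hp, (Fin.succAbove_ne k l).symm]) i
    exact h

theorem isNilpotent_reducedFunMatrix {m : ℕ} {k : Fin (m + 1)} {t : Fin (m + 1) → Fin (m + 1)}
    (hk : t k = k) (h : ∀ i, ∃ j : ℕ, t^[j] i = k) : IsNilpotent (reducedFunMatrix k t) := by
  choose d hd using h
  refine ⟨∑ i, d i, ?_⟩
  rw [reducedFunMatrix_pow hk]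
  ext i l
  have hle : d (k.succAbove i) ≤ ∑ i, d i :=
    Finset.single_le_sum (f := d) (fun _ _ => Nat.zero_le _) (Finset.mem_univ _)
  obtain ⟨c, hc⟩ := Nat.exists_eq_add_of_le' hle
  have hfix : t^[∑ i, d i] (k.succAbove i) = k := by
    rw [hc, Function.iterate_add_apply, hd, Function.iterate_fixed hk]
  simp [reducedFunMatrix, hfix, (Fin.succAbove_ne k l).symm]

theorem Matrix.det_one_sub_of_isNilpotent {n R : Type*} [Fintype n] [DecidableEq n] [CommRing R]
    [IsDomain R] {N : Matrix n n R} (hN : IsNilpotent N) : (1 - N).det = 1 := by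
  have h : N.charpoly = Polynomial.X ^ Fintype.card n :=
    sub_eq_zero.mp (Matrix.isNilpotent_charpoly_sub_pow_of_isNilpotent hN).eq_zero
  have h1 := Matrix.eval_charpoly N 1
  rw [h] at h1
  simpa using h1.symm

theorem det_one_sub_reducedFunMatrix {m : ℕ} {k : Fin (m + 1)} {t : Fin (m + 1) → Fin (m + 1)}
    (hk : t k = k) [Decidable (∀ i, ∃ j : ℕ, t^[j] i = k)] :
    (1 - reducedFunMatrix k t).det = if ∀ i, ∃ j : ℕ, t^[j] i = k then 1 else 0 := by
  classical
  split_ifs with h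
  · exact Matrix.det_one_sub_of_isNilpotent (isNilpotent_reducedFunMatrix hk h)
  · obtain ⟨v, hv⟩ := not_forall.mp h
    let f : Fin (m + 1) → ℤ := fun v => if ∃ j : ℕ, t^[j] v = k then 0 else 1
    have hfk : f k = 0 := if_pos ⟨0, rfl⟩
    have hft (v) : f (t v) = f v := by
      have : (∃ j : ℕ, t^[j] (t v) = k) ↔ ∃ j : ℕ, t^[j] v = k := by
        constructor
        · rintro ⟨j, hj⟩
          exact ⟨j + 1, hj⟩
        · rintro ⟨j, hj⟩
          refine ⟨j, ?_⟩
          rw [← Function.iterate_succ_apply, Function.iterate_succ_apply', hj, hk]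
      simp only [f, this]
    have hvk : v ≠ k := fun e => hv ⟨0, e⟩
    obtain ⟨i, rfl⟩ := Fin.exists_succAbove_eq hvk
    rw [← Matrix.exists_mulVec_eq_zero_iff]
    refine ⟨fun l => f (k.succAbove l), fun h0 => ?_, ?_⟩
    · have := congrFun h0 i
      simp [f, hv] at this
    · ext l
      have := reducedFunMatrix_mul_apply (t := t) f hfk l
      rw [hft] at this
      simp [Matrix.mulVec, dotProduct, Matrix.one_apply, sub_mul, Finset.sum_sub_distrib, this]


/-- Kirchhoff's matrix–tree theorem for directed multigraphs: the number of
spanning trees directed toward the root `p k` (counted with arc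
multiplicities, i.e. the sum over all acyclic successor functions `t` of
`∏_{i ≠ k} C i (t i)`) equals the `(k,k)`-minor of the Laplacian matrix `M`.
A successor function is acyclic exactly when iterating it from any vertex
eventually reaches `k`; we normalise `t k = k`. -/
theorem stmt10 (m : ℕ) (C : Fin (m + 1) → Fin (m + 1) → ℕ) (hC : ∀ i, C i i = 0)
    (M : Matrix (Fin (m + 1)) (Fin (m + 1)) ℤ)
    (hMdiag : ∀ i, M i i = ∑ j, (C i j : ℤ))
    (hMoff : ∀ i j, i ≠ j → M i j = -(C i j : ℤ))
    (k : Fin (m + 1)) :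
    (∑ t ∈ @Finset.filter (Fin (m + 1) → Fin (m + 1))
        (fun t => t k = k ∧ ∀ i, ∃ j : ℕ, t^[j] i = k)
        (Classical.decPred _) Finset.univ,
      ∏ i ∈ Finset.univ.filter (fun i => i ≠ k), (C i (t i) : ℤ)) =
      (M.submatrix k.succAbove k.succAbove).det := by
  classical
  let v : Fin m → Fin (m + 1) → Fin m → ℤ := fun i j l =>
    (if i = l then 1 else 0) - (if j = k.succAbove l then 1 else 0)
  have hrow : M.submatrix k.succAbove k.succAbove =
      fun i => ∑ j, (C (k.succAbove i) j : ℤ) • v i j := by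
    ext i l
    simp only [Matrix.submatrix_apply, Finset.sum_apply, Pi.smul_apply, smul_eq_mul, v, mul_sub,
      Finset.sum_sub_distrib, mul_ite, mul_one, mul_zero, Finset.sum_ite_eq', Finset.mem_univ,
      if_true]
    by_cases hil : i = l
    · subst hil
      simp [hMdiag, hC]
    · rw [hMoff _ _ (fun e => hil (Fin.succAbove_right_injective e))]
      simp [hil]
  have hdet (s : Fin m → Fin (m + 1)) :
      Matrix.detRowAlternating (fun i => v i (s i)) =
        if ∀ i, ∃ j : ℕ, (k.insertNth k s : Fin (m + 1) → Fin (m + 1))^[j] i = k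
          then (1 : ℤ) else 0 := by
    rw [← det_one_sub_reducedFunMatrix (by simp)]
    change Matrix.det _ = _
    congr 1
    ext i l
    simp [v, reducedFunMatrix, Matrix.one_apply]
  have hexp : (M.submatrix k.succAbove k.succAbove).det = ∑ s : Fin m → Fin (m + 1),
      (∏ i, (C (k.succAbove i) (s i) : ℤ)) *
        if ∀ i, ∃ j : ℕ, (k.insertNth k s : Fin (m + 1) → Fin (m + 1))^[j] i = k
          then (1 : ℤ) else 0 := by
    rw [hrow]
    change (Matrix.detRowAlternating (n := Fin m) (R := ℤ)).toMultilinearMap _ = _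
    rw [MultilinearMap.map_sum]
    refine Finset.sum_congr rfl fun s _ => ?_
    rw [MultilinearMap.map_smul_univ, smul_eq_mul]
    congr 1
    exact hdet s
  rw [hexp]
  simp only [mul_ite, mul_one, mul_zero]
  rw [← Finset.sum_filter]
  refine Finset.sum_bij' (fun t _ => k.removeNth t) (fun s _ => k.insertNth k s) ?_ ?_ ?_ ?_ ?_
  · intro t ht
    simp only [Finset.mem_filter, Finset.mem_univ, true_and] at ht ⊢
    have : (k.insertNth k (k.removeNth t) : Fin (m + 1) → Fin (m + 1)) = t := by
      rw [Fin.insertNth_removeNth, Function.update_eq_self_iff, ht.1]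
    rw [this]
    exact ht.2
  · intro s hs
    simp only [Finset.mem_filter, Finset.mem_univ, true_and] at hs ⊢
    exact ⟨by simp, hs⟩
  · intro t ht
    simp only [Finset.mem_filter, Finset.mem_univ, true_and] at ht
    rw [Fin.insertNth_removeNth, Function.update_eq_self_iff, ht.1]
  · intro s _
    simp
  · intro t _
    rw [Finset.prod_filter, Fin.prod_univ_succAbove _ k]
    simp [Fin.removeNth]
end

section
/- BEST theorem: Let (G, Δ) be a finite connected Eulerian directed graph, i.e., a finite set G of vertices with a finite set Δ of arcs (each arc having a tail and a head in G, parallel arcs allowed) such that at every vertex p the in-degree equals the out-degree, both equal to σ_p ≥ 1, and the underlying graph is connected. Fix an arc e ∈ Δ and let w be the tail of e. Then the number of Euler tours starting with e — that is, the number of orderings e = e_1, e_2, …, e_m of all m = |Δ| arcs such that for each i the head of e_i equals the tail of e_{i+1} (indices mod m) — equals P_w · ∏_{p ∈ G} (σ_p − 1)!, where P_w is the number of spanning trees of (G, Δ) with all arcs directed toward the root w (i.e., subsets T ⊆ Δ containing for each vertex p ≠ w exactly one arc with tail p and no arc with tail w, such that T contains no cycle). -/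
namespace BEST

open Finset

/-- A list of arcs forming a walk from `u` to `w`. -/
def IsTrail {V E : Type*} (tl hd : E → V) (w : V) : V → List E → Prop
  | u, [] => u = w
  | u, a :: l => tl a = u ∧ IsTrail tl hd w (hd a) l

/-- The set of arcs `T` contains a closed walk. -/
def HasCycle {V E : Type*} (tl hd : E → V) (T : Set E) : Prop :=
  ∃ (k : ℕ) (f : ZMod (k + 1) → E), (∀ i, f i ∈ T) ∧ ∀ i, hd (f i) = tl (f (i + 1))

/-- `T` is an acyclic set of arcs in `S` with exactly one arc leaving each vertex other than `w`
that some arc of `S` leaves, and none leaving `w`. -/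
def IsArb {V E : Type*} (tl hd : E → V) (w : V) (S : Finset E) (T : Set E) : Prop :=
  (∀ a ∈ T, a ∈ S) ∧ (∀ p, p ≠ w → (∃ a ∈ S, tl a = p) → ∃! a, a ∈ T ∧ tl a = p) ∧
    (∀ a ∈ T, tl a ≠ w) ∧ ¬ HasCycle tl hd T

open scoped Classical in
/-- The orderings of the arcs in `S` forming a walk from `u` to `w`. -/
noncomputable def trails {V E : Type*} (tl hd : E → V) (w : V) (S : Finset E) (u : V) :
    Finset (List E) :=
  {l ∈ S.val.lists.toFinset | IsTrail tl hd w u l}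

open scoped Classical in
/-- The arc sets satisfying `IsArb` in `S`. -/
noncomputable def arbs {V E : Type*} [Fintype E] (tl hd : E → V) (w : V) (S : Finset E) :
    Finset (Set E) :=
  {T | IsArb tl hd w S T}

/-- The out-degree of `p` in the arc set `S`; passing `hd` instead of `tl` gives the in-degree. -/
def deg {V E : Type*} [DecidableEq V] (tl : E → V) (S : Finset E) (p : V) : ℕ :=
  #{a ∈ S | tl a = p}

/-- The number of ways to order the arcs of `S` leaving each vertex, the last one being
prescribed except at `w`. -/
def localOrders {V E : Type*} [Fintype V] [DecidableEq V] (tl : E → V) (w : V) (S : Finset E) :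
    ℕ :=
  ∏ p, (if p = w then deg tl S p else deg tl S p - 1).factorial

section Lemmas

variable {V E : Type*} {tl hd : E → V} {w : V}

theorem HasCycle.mono {T T' : Set E} (h : T ⊆ T') (hT : HasCycle tl hd T) :
    HasCycle tl hd T' := by
  obtain ⟨k, f, hf, hc⟩ := hT
  exact ⟨k, f, fun i => h (hf i), hc⟩

theorem hasCycle_of_forall_exists_next [Finite E] {T : Set E} (hne : T.Nonempty)
    (h : ∀ a ∈ T, ∃ b ∈ T, hd a = tl b) : HasCycle tl hd T := by
  choose! g hgT hg using h
  obtain ⟨x, hx⟩ := hne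
  have hit : ∀ n, g^[n] x ∈ T := by
    intro n
    induction n with
    | zero => exact hx
    | succ n ih => rw [Function.iterate_succ_apply']; exact hgT _ ih
  obtain ⟨i, j, hij, heq⟩ := Finite.exists_ne_map_eq_of_infinite (fun n : ℕ => g^[n] x)
  wlog hlt : i < j generalizing i j
  · exact this j i hij.symm heq.symm (by omega)
  obtain ⟨k, rfl⟩ : ∃ k, j = i + k + 1 := ⟨j - i - 1, by omega⟩
  refine ⟨k, fun t => g^[i + t.val] x, fun t => hit _, fun t => ?_⟩
  have hstep : ∀ n, hd (g^[n] x) = tl (g^[n + 1] x) := fun n => by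
    rw [Function.iterate_succ_apply']; exact hg _ (hit n)
  rw [hstep]
  refine congrArg tl ?_
  by_cases ht : t.val = k
  · have h0 : t + 1 = 0 := by
      have : ((t.val + 1 : ℕ) : ZMod (k + 1)) = 0 := by rw [ht]; exact ZMod.natCast_self _
      simpa using this
    simp only [h0, ZMod.val_zero, ht]
    exact heq.symm
  · have h1 : (t + 1).val = t.val + 1 := by
      have hlt := ZMod.val_lt t
      rw [← ZMod.val_cast_of_lt (n := k + 1) (a := t.val + 1) (by omega)]
      simp
    simp only [h1, add_assoc]

theorem HasCycle.of_insert {T : Set E} {a : E} (hT : HasCycle tl hd (insert a T))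
    (h : ∀ b ∈ insert a T, hd b ≠ tl a) : HasCycle tl hd T := by
  obtain ⟨k, f, hf, hc⟩ := hT
  refine ⟨k, f, fun i => (hf i).resolve_left fun hi => ?_, hc⟩
  refine h _ (hf (i - 1)) ?_
  rw [hc, sub_add_cancel, hi]

theorem mem_arbs [Fintype E] {S : Finset E} {T : Set E} :
    T ∈ arbs tl hd w S ↔ IsArb tl hd w S T := by
  simp [arbs]

theorem mem_trails {S : Finset E} {u : V} {l : List E} :
    l ∈ trails tl hd w S u ↔ S.val = l ∧ IsTrail tl hd w u l := by
  simp [trails]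

section

variable [DecidableEq E]

theorem cons_mem_trails {S : Finset E} {u : V} {a : E} {l : List E} :
    a :: l ∈ trails tl hd w S u ↔
      (a ∈ S ∧ tl a = u) ∧ l ∈ trails tl hd w (S.erase a) (hd a) := by
  rw [mem_trails, mem_trails, IsTrail, Finset.erase_val, ← Multiset.cons_coe]
  constructor
  · rintro ⟨hS, hu, hl⟩
    have ha : a ∈ S := by rw [← Finset.mem_val, hS]; simp
    exact ⟨⟨ha, hu⟩, by rw [hS]; simp, hl⟩
  · rintro ⟨⟨ha, hu⟩, hS, hl⟩
    exact ⟨by rw [← hS]; exact (Multiset.cons_erase ha).symm, hu, hl⟩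

theorem card_trails [DecidableEq V] {S : Finset E} {u : V} (h : S.Nonempty) :
    #(trails tl hd w S u) = ∑ a ∈ S with tl a = u, #(trails tl hd w (S.erase a) (hd a)) := by
  have : trails tl hd w S u = {a ∈ S | tl a = u}.biUnion
      fun a => (trails tl hd w (S.erase a) (hd a)).image (List.cons a) := by
    ext l
    simp only [mem_biUnion, mem_filter, mem_image]
    constructor
    · intro hl
      cases l with
      | nil =>
        rw [mem_trails] at hl
        simp [h.ne_empty] at hl
      | cons a l =>
        rw [cons_mem_trails] at hl
        exact ⟨a, hl.1, l, hl.2, rfl⟩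
    · rintro ⟨a, ha, l, hl, rfl⟩
      exact cons_mem_trails.2 ⟨ha, hl⟩
  rw [this, card_biUnion]
  · exact sum_congr rfl fun a _ => card_image_of_injective _ List.cons_injective
  · intro a _ b _ hab
    simp only [Finset.disjoint_left, mem_image]
    rintro _ ⟨l, _, rfl⟩ ⟨l', _, h'⟩
    exact hab (List.cons.inj h').1.symm

theorem isArb_erase {S : Finset E} {T : Set E} {a : E}
    (h : tl a = w ∨ ∃ b ∈ S, b ≠ a ∧ tl b = tl a) :
    IsArb tl hd w (S.erase a) T ↔ IsArb tl hd w S T ∧ a ∉ T := by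
  have key : ∀ p, p ≠ w → ((∃ b ∈ S.erase a, tl b = p) ↔ ∃ b ∈ S, tl b = p) := by
    intro p hp
    constructor
    · rintro ⟨b, hb, rfl⟩
      exact ⟨b, mem_of_mem_erase hb, rfl⟩
    · rintro ⟨b, hb, rfl⟩
      by_cases hba : b = a
      · subst hba
        obtain h | ⟨c, hc, hne, he⟩ := h
        · exact absurd h hp
        · exact ⟨c, mem_erase.2 ⟨hne, hc⟩, he⟩
      · exact ⟨b, mem_erase.2 ⟨hba, hb⟩, rfl⟩
  constructor
  · rintro ⟨h1, h2, h3⟩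
    exact ⟨⟨fun b hb => mem_of_mem_erase (h1 b hb), fun p hp hS => h2 p hp ((key p hp).2 hS), h3⟩,
      fun ha => notMem_erase a S (h1 a ha)⟩
  · rintro ⟨⟨h1, h2, h3⟩, ha⟩
    refine ⟨fun b hb => mem_erase.2 ⟨?_, h1 b hb⟩, fun p hp hS => h2 p hp ((key p hp).1 hS), h3⟩
    rintro rfl
    exact ha hb

open scoped Classical in
theorem card_arbs_erase [Fintype E] {S : Finset E} {a : E}
    (h : tl a = w ∨ ∃ b ∈ S, b ≠ a ∧ tl b = tl a) :
    #(arbs tl hd w (S.erase a)) = #{T ∈ arbs tl hd w S | a ∉ T} := by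
  congr 1
  ext T
  simp [mem_arbs, isArb_erase h]

theorem card_arbs_erase_root [Fintype E] {S : Finset E} {a : E} (h : tl a = w) :
    #(arbs tl hd w (S.erase a)) = #(arbs tl hd w S) := by
  congr 1
  ext T
  rw [mem_arbs, mem_arbs, isArb_erase (.inl h)]
  exact and_iff_left_of_imp fun hT ha => hT.2.2.1 a ha h

theorem card_arbs_erase_leaf [Fintype E] {S : Finset E} {a : E} (haS : a ∈ S) (haw : tl a ≠ w)
    (hout : ∀ b ∈ S, tl b = tl a → b = a) (hin : ∀ b ∈ S, hd b ≠ tl a) :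
    #(arbs tl hd w (S.erase a)) = #(arbs tl hd w S) := by
  refine card_bij' (fun T _ => insert a T) (fun T _ => T \ {a}) ?_ ?_ ?_ ?_
  · intro T hT
    rw [mem_arbs] at hT ⊢
    obtain ⟨h1, h2, h3, h4⟩ := hT
    have hsub : ∀ b ∈ insert a T, b ∈ S := by
      rintro b (rfl | hb)
      exacts [haS, mem_of_mem_erase (h1 b hb)]
    refine ⟨hsub, ?_, ?_, fun hc => h4 (hc.of_insert fun b hb => hin b (hsub b hb))⟩
    · rintro p hp ⟨b, hb, rfl⟩
      by_cases hba : b = a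
      · subst hba
        exact ⟨b, ⟨Set.mem_insert _ _, rfl⟩, fun c hc => hout c (hsub c hc.1) hc.2⟩
      · obtain ⟨c, ⟨hc, hcb⟩, hu⟩ := h2 _ hp ⟨b, mem_erase.2 ⟨hba, hb⟩, rfl⟩
        refine ⟨c, ⟨Set.mem_insert_of_mem _ hc, hcb⟩, ?_⟩
        rintro d ⟨rfl | hd', hdb⟩
        · exact absurd (hout b hb hdb.symm) hba
        · exact hu d ⟨hd', hdb⟩
    · rintro b (rfl | hb)
      exacts [haw, h3 b hb]
  · intro T hT
    rw [mem_arbs] at hT ⊢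
    obtain ⟨h1, h2, h3, h4⟩ := hT
    refine ⟨fun b hb => mem_erase.2 ⟨hb.2, h1 b hb.1⟩, ?_, fun b hb => h3 b hb.1,
      fun hc => h4 (hc.mono Set.sdiff_subset)⟩
    rintro p hp ⟨b, hb, rfl⟩
    rw [mem_erase] at hb
    obtain ⟨c, ⟨hc, hcb⟩, hu⟩ := h2 _ hp ⟨b, hb.2, rfl⟩
    refine ⟨c, ⟨⟨hc, ?_⟩, hcb⟩, fun d hd' => hu d ⟨hd'.1.1, hd'.2⟩⟩
    rintro rfl
    exact hb.1 (hout b hb.2 hcb.symm)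
  · intro T hT
    rw [mem_arbs] at hT
    have : a ∉ T := fun ha => notMem_erase a S (hT.1 a ha)
    ext b
    simp only [Set.mem_sdiff, Set.mem_insert_iff, Set.mem_singleton_iff]
    grind
  · intro T hT
    rw [mem_arbs] at hT
    obtain ⟨c, ⟨hc, hca⟩, -⟩ := hT.2.1 _ haw ⟨a, haS, rfl⟩
    have : a ∈ T := hout c (hT.1 c hc) hca ▸ hc
    ext b
    simp only [Set.mem_sdiff, Set.mem_insert_iff, Set.mem_singleton_iff]
    grind

theorem sum_card_arbs_erase [Fintype E] [DecidableEq V] {S : Finset E} {u : V} (hu : u ≠ w)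
    (h : 2 ≤ deg tl S u) :
    ∑ a ∈ S with tl a = u, #(arbs tl hd w (S.erase a)) =
      (deg tl S u - 1) * #(arbs tl hd w S) := by
  classical
  have hrw : ∀ a ∈ S.filter (tl · = u),
      #(arbs tl hd w (S.erase a)) = #{T ∈ arbs tl hd w S | a ∉ T} := by
    intro a ha
    refine card_arbs_erase (.inr ?_)
    obtain ⟨b, hb, hba⟩ := exists_mem_ne (by exact h) a
    rw [mem_filter] at ha hb
    exact ⟨b, hb.1, hba, hb.2.trans ha.2.symm⟩
  rw [sum_congr rfl hrw, mul_comm, ← smul_eq_mul, ← sum_const]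
  refine (sum_card_bipartiteAbove_eq_sum_card_bipartiteBelow (fun a T => a ∉ T)).trans ?_
  refine sum_congr rfl fun T hT => ?_
  rw [mem_arbs] at hT
  obtain ⟨b, hb⟩ : (S.filter (tl · = u)).Nonempty := card_pos.1 (by unfold deg at h; omega)
  rw [mem_filter] at hb
  obtain ⟨c, ⟨hc, hcu⟩, huniq⟩ := hT.2.1 u hu ⟨b, hb⟩
  rw [deg, ← card_erase_of_mem (mem_filter.2 ⟨hT.1 c hc, hcu⟩)]
  congr 1
  ext d
  simp only [bipartiteBelow, mem_filter, mem_erase]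
  constructor
  · rintro ⟨hd', hdT⟩
    exact ⟨by rintro rfl; exact hdT hc, hd'⟩
  · rintro ⟨hdc, hd'⟩
    exact ⟨hd', fun hdT => hdc (huniq d ⟨hdT, hd'.2⟩)⟩

theorem deg_erase_add [DecidableEq V] {S : Finset E} {a : E} (ha : a ∈ S) (p : V) :
    deg tl (S.erase a) p + (if p = tl a then 1 else 0) = deg tl S p := by
  unfold deg
  rw [filter_erase]
  split_ifs with h
  · exact card_erase_add_one (mem_filter.2 ⟨ha, h.symm⟩)
  · rw [erase_eq_of_notMem, add_zero]
    simpa [ha] using Ne.symm h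

theorem localOrders_erase [Fintype V] [DecidableEq V] {S : Finset E} {a : E} (ha : a ∈ S) :
    localOrders tl w S =
      (if tl a = w then deg tl S (tl a) else max 1 (deg tl S (tl a) - 1)) *
        localOrders tl w (S.erase a) := by
  unfold localOrders
  rw [← mul_prod_erase univ _ (mem_univ (tl a)),
    ← mul_prod_erase univ (fun p => (if p = w then deg tl (S.erase a) p
      else deg tl (S.erase a) p - 1).factorial) (mem_univ (tl a)), ← mul_assoc]
  congr 1
  · have h := deg_erase_add (tl := tl) ha (tl a)
    rw [if_pos rfl] at h
    rw [← h]
    split_ifs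
    · exact Nat.factorial_succ _
    · cases deg tl (S.erase a) (tl a) with
      | zero => simp
      | succ n => simp [Nat.factorial_succ]
  · refine prod_congr rfl fun p hp => ?_
    have h := deg_erase_add (tl := tl) ha p
    rw [if_neg (ne_of_mem_erase hp), add_zero] at h
    rw [h]

end

theorem arbs_empty [Fintype E] : arbs tl hd w ∅ = {∅} := by
  ext T
  rw [mem_arbs, mem_singleton]
  constructor
  · intro h
    exact Set.eq_empty_of_forall_notMem fun a ha => notMem_empty a (h.1 a ha)
  · rintro rfl
    refine ⟨by simp, by simp, by simp, ?_⟩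
    rintro ⟨k, f, hf, -⟩
    exact hf 0

theorem arbs_eq_empty [Fintype E] {S : Finset E} (hS : S.Nonempty) (hw : ∀ a ∈ S, tl a ≠ w)
    (h : ∀ a ∈ S, hd a ≠ w ∧ ∃ b ∈ S, tl b = hd a) : arbs tl hd w S = ∅ := by
  rw [eq_empty_iff_forall_notMem]
  intro T hT
  rw [mem_arbs] at hT
  obtain ⟨h1, h2, h3, h4⟩ := hT
  refine h4 (hasCycle_of_forall_exists_next ?_ fun a ha => ?_)
  · obtain ⟨a, ha⟩ := hS
    obtain ⟨c, hc, -⟩ := h2 _ (hw a ha) ⟨a, ha, rfl⟩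
    exact ⟨c, hc.1⟩
  · obtain ⟨hne, hb⟩ := h a (h1 a ha)
    obtain ⟨c, hc, -⟩ := h2 _ hne hb
    exact ⟨c, hc.1, hc.2.symm⟩

theorem deg_pos_iff [DecidableEq V] {S : Finset E} {p : V} :
    0 < deg tl S p ↔ ∃ a ∈ S, tl a = p := by
  simp [deg, card_pos, Finset.Nonempty]

theorem card_trails_eq [Fintype V] [Fintype E] [DecidableEq V] (S : Finset E) (u : V)
    (hbal : ∀ p, deg tl S p + (if p = w then 1 else 0) = deg hd S p + (if p = u then 1 else 0)) :
    #(trails tl hd w S u) = #(arbs tl hd w S) * localOrders tl w S := by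
  classical
  induction hn : #S generalizing S u with
  | zero =>
    obtain rfl := card_eq_zero.1 hn
    have huw : u = w := by
      have := hbal u
      by_contra hne
      simp [deg, hne] at this
    have : trails tl hd w ∅ u = {[]} := by
      ext l
      rw [mem_trails, mem_singleton]
      constructor
      · rintro ⟨h, -⟩
        simpa using h.symm
      · rintro rfl
        exact ⟨rfl, huw⟩
    rw [this, arbs_empty]
    simp [localOrders, deg]
  | succ n ih =>
    have hne : S.Nonempty := card_pos.1 (by omega)
    rw [card_trails hne]
    have hstep : ∀ a ∈ S.filter (tl · = u), #(trails tl hd w (S.erase a) (hd a)) =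
        #(arbs tl hd w (S.erase a)) * localOrders tl w (S.erase a) := by
      intro a ha
      rw [mem_filter] at ha
      refine ih _ _ (fun p => ?_) (by rw [card_erase_of_mem ha.1]; omega)
      have h1 := deg_erase_add (tl := tl) ha.1 p
      have h2 := deg_erase_add (tl := hd) ha.1 p
      have h3 := hbal p
      rw [ha.2] at h1
      omega
    rw [sum_congr rfl hstep]
    by_cases h0 : deg tl S u = 0
    · have huw : u = w := by
        have := hbal u
        by_contra hne
        simp [hne, h0] at this
      subst huw
      have hfil : S.filter (tl · = u) = ∅ := card_eq_zero.1 h0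
      have hbal' : ∀ p, deg tl S p = deg hd S p := fun p => by have := hbal p; omega
      have hout : ∀ a ∈ S, tl a ≠ u := fun a ha h => by
        have := deg_pos_iff.2 ⟨a, ha, h⟩; omega
      rw [hfil, sum_empty, arbs_eq_empty hne hout, card_empty, zero_mul]
      intro a ha
      have hpos : 0 < deg tl S (hd a) := by
        rw [hbal']
        exact deg_pos_iff.2 ⟨a, ha, rfl⟩
      exact ⟨fun h => by rw [h] at hpos; omega, deg_pos_iff.1 hpos⟩
    · have hfac : ∀ a ∈ S.filter (tl · = u), localOrders tl w S =
          (if u = w then deg tl S u else max 1 (deg tl S u - 1)) *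
            localOrders tl w (S.erase a) := by
        intro a ha
        rw [mem_filter] at ha
        rw [localOrders_erase ha.1, ha.2]
      have hcpos : 0 < if u = w then deg tl S u else max 1 (deg tl S u - 1) := by
        split_ifs <;> omega
      refine Nat.eq_of_mul_eq_mul_left hcpos ?_
      rw [mul_sum]
      have hsum : ∀ a ∈ S.filter (tl · = u),
          (if u = w then deg tl S u else max 1 (deg tl S u - 1)) *
            (#(arbs tl hd w (S.erase a)) * localOrders tl w (S.erase a)) =
          #(arbs tl hd w (S.erase a)) * localOrders tl w S := by
        intro a ha
        rw [hfac a ha]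
        ring
      rw [sum_congr rfl hsum, ← sum_mul, ← mul_assoc]
      congr 1
      by_cases huw : u = w
      · rw [if_pos huw, sum_congr rfl fun a ha =>
          card_arbs_erase_root ((mem_filter.1 ha).2.trans huw), sum_const, smul_eq_mul, deg]
      · rw [if_neg huw]
        by_cases h2 : 2 ≤ deg tl S u
        · rw [sum_card_arbs_erase huw h2, max_eq_right (by omega)]
        · have h1 : deg tl S u = 1 := by omega
          obtain ⟨a, ha⟩ := card_eq_one.1 h1
          have haS : a ∈ S ∧ tl a = u := by
            rw [← mem_filter (p := fun a => tl a = u), ha]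
            exact mem_singleton_self a
          rw [ha, sum_singleton, h1, card_arbs_erase_leaf haS.1 (haS.2 ▸ huw)]
          · simp
          · intro b hb hba
            rw [← mem_singleton, ← ha]
            exact mem_filter.2 ⟨hb, hba.trans haS.2⟩
          · intro b hb hbu
            have := hbal u
            have hpos := deg_pos_iff.2 ⟨b, hb, hbu.trans haS.2⟩
            rw [if_neg huw, if_pos rfl] at this
            omega

theorem isTrail_ofFn {n : ℕ} (u : V) (f : Fin (n + 1) → E) :
    IsTrail tl hd w u (List.ofFn f) ↔ tl (f 0) = u ∧
      (∀ i : Fin n, hd (f i.castSucc) = tl (f i.succ)) ∧ hd (f (Fin.last n)) = w := by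
  induction n generalizing u with
  | zero => simp [IsTrail]
  | succ n ih =>
    rw [List.ofFn_succ, IsTrail, ih, Fin.forall_fin_succ]
    simp only [Fin.succ_last, Fin.castSucc_zero, Fin.succ_castSucc, and_assoc]
    grind

theorem isTrail_ofFn_iff_cyclic {n : ℕ} (f : Fin (n + 1) → E) (h : tl (f 0) = w) :
    IsTrail tl hd w w (List.ofFn f) ↔ ∀ i, hd (f i) = tl (f (i + 1)) := by
  rw [isTrail_ofFn, Fin.forall_fin_succ']
  simp [h, Fin.coeSucc_eq_succ]

theorem card_tours [Fintype E] [DecidableEq E] (e : E) (h : tl e = w) :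
    Nat.card {τ : ZMod (Fintype.card E) ≃ E // τ 0 = e ∧ ∀ i, hd (τ i) = tl (τ (i + 1))} =
      #(trails tl hd w (univ.erase e) (hd e)) := by
  obtain ⟨n, hn⟩ : ∃ n, Fintype.card E = n + 1 :=
    Nat.exists_eq_succ_of_ne_zero (Fintype.card_pos_iff.2 ⟨e⟩).ne'
  rw [hn]
  change Nat.card {τ : Fin (n + 1) ≃ E // τ 0 = e ∧ ∀ i, hd (τ i) = tl (τ (i + 1))} = _
  have hmem : ∀ l, l ∈ trails tl hd w (univ.erase e) (hd e) ↔
      univ.val = ((e :: l : List E) : Multiset E) ∧ IsTrail tl hd w w (e :: l) := fun l => by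
    rw [← mem_trails, cons_mem_trails]
    simp [h]
  have hofFn : ∀ τ : Fin (n + 1) → E, τ 0 = e →
      List.ofFn τ = e :: List.ofFn fun i : Fin n => τ i.succ := by
    rintro τ rfl
    exact List.ofFn_succ
  rw [← Nat.card_eq_finsetCard]
  refine Nat.card_congr (Equiv.ofBijective (fun τ =>
    ⟨List.ofFn fun i : Fin n => τ.1 i.succ, (hmem _).2 ?_⟩) ⟨?_, ?_⟩)
  · rw [← hofFn τ.1 τ.2.1, isTrail_ofFn_iff_cyclic τ.1 (by rw [τ.2.1, h])]
    refine ⟨(Multiset.Nodup.ext univ.nodup ?_).2 fun a => ?_, τ.2.2⟩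
    · exact Multiset.coe_nodup.2 (List.nodup_ofFn.2 τ.1.injective)
    · simpa [-List.ofFn_succ, eq_comm] using τ.1.surjective a
  · intro τ τ' hτ
    have := congrArg (List.cons e) (congrArg Subtype.val hτ)
    simp only at this
    rw [← hofFn τ.1 τ.2.1, ← hofFn τ'.1 τ'.2.1] at this
    exact Subtype.ext (DFunLike.coe_injective (List.ofFn_injective this))
  · rintro ⟨l, hl⟩
    obtain ⟨hl1, hl2⟩ := (hmem l).1 hl
    have hlen : (e :: l).length = n + 1 := by
      rw [← Multiset.coe_card, ← hl1, ← hn]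
      rfl
    obtain ⟨f, hf⟩ : ∃ f : Fin (n + 1) → E, List.ofFn f = e :: l := by
      rw [← hlen]
      exact ⟨(e :: l).get, List.ofFn_get _⟩
    have hnodup : (e :: l).Nodup := by
      rw [← Multiset.coe_nodup, ← hl1]
      exact univ.nodup
    have hf0 : f 0 = e := by
      rw [List.ofFn_succ] at hf
      exact (List.cons.inj hf).1
    have hinj : Function.Injective f := by rwa [← hf, List.nodup_ofFn] at hnodup
    have hbij : Function.Bijective f :=
      (Fintype.bijective_iff_injective_and_card f).2 ⟨hinj, by simp [hn]⟩
    rw [← hf, isTrail_ofFn_iff_cyclic f (by rw [hf0, h])] at hl2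
    refine ⟨⟨Equiv.ofBijective f hbij, hf0, hl2⟩, Subtype.ext ?_⟩
    rw [hofFn f hf0] at hf
    exact (List.cons.inj hf).2

end Lemmas

end BEST

/-- The BEST theorem: in a finite connected Eulerian directed multigraph
(arc type `E`, tail map `tl`, head map `hd`, in-degree = out-degree = `σ p ≥ 1`
at every vertex `p`), the number of Euler tours starting with a fixed arc `e`
(encoded as cyclic orderings `τ : ZMod |E| ≃ E` with `τ 0 = e` and the head of
each arc equal to the tail of the next) equals
`P_w * ∏_p (σ p - 1)!`, where `w = tl e` and `P_w` is the number of spanning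
trees directed toward the root `w` (sets of arcs giving each vertex `p ≠ w`
exactly one outgoing arc, none at `w`, and containing no directed cycle). -/
theorem stmt11 {V E : Type*} [Fintype V] [Fintype E] [DecidableEq V]
    (tl hd : E → V) (σ : V → ℕ) (hσ : ∀ p, 1 ≤ σ p)
    (hout : ∀ p, (Finset.univ.filter fun a => tl a = p).card = σ p)
    (hin : ∀ p, (Finset.univ.filter fun a => hd a = p).card = σ p)
    (hconn : (SimpleGraph.fromRel fun v w => ∃ a : E, tl a = v ∧ hd a = w).Connected)
    (e : E) (w : V) (hw : tl e = w) :
    Nat.card {τ : ZMod (Fintype.card E) ≃ E //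
        τ 0 = e ∧ ∀ i, hd (τ i) = tl (τ (i + 1))} =
      Nat.card {T : Set E //
          (∀ p : V, p ≠ w → ∃! a, a ∈ T ∧ tl a = p) ∧
          (∀ a ∈ T, tl a ≠ w) ∧
          ¬ ∃ (k : ℕ) (f : ZMod (k + 1) → E), (∀ i, f i ∈ T) ∧
              ∀ i, hd (f i) = tl (f (i + 1))} *
        ∏ p : V, Nat.factorial (σ p - 1) := by
  classical
  have hdo : ∀ p, BEST.deg tl Finset.univ p = σ p := hout
  have hdi : ∀ p, BEST.deg hd Finset.univ p = σ p := hin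
  have ho := BEST.deg_erase_add (tl := tl) (Finset.mem_univ e)
  have hi := BEST.deg_erase_add (tl := hd) (Finset.mem_univ e)
  rw [BEST.card_tours e hw, BEST.card_trails_eq, BEST.card_arbs_erase_root hw]
  · congr 1
    · rw [BEST.arbs, Nat.card_eq_fintype_card, Fintype.card_subtype]
      congr 1
      ext T
      have hex : ∀ p, ∃ a, tl a = p := fun p => by
        have hpos : 0 < BEST.deg tl Finset.univ p := hdo p ▸ hσ p
        simpa using BEST.deg_pos_iff.1 hpos
      simp [BEST.IsArb, BEST.HasCycle, hex]
    · refine Finset.prod_congr rfl fun p _ => congrArg _ ?_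
      have := ho p
      rw [hdo, hw] at this
      split_ifs at this ⊢ <;> omega
  · intro p
    have h1 := ho p
    have h2 := hi p
    rw [hdo, hw] at h1
    rw [hdi] at h2
    omega
end

section
/- Let B ⊆ ℤ be a basis for the integers, i.e., every integer x can be written in exactly one way as the sum of a finite subset of B (equivalently, the map sending each finite subset F ⊆ B to Σ_{b ∈ F} b is a bijection from the finite subsets of B onto ℤ). Then exactly one element of B is odd, and all other elements of B are even. -/
/-- If translation by `a` swaps `p` with its complement without changing `q` (going up from the
complement and down from `p`), then any condition `r` on `q` cuts `p` and its complement in sets of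
the same size. -/
theorem card_filter_eq_card_filter_not_of_translate {G : Type*} [Fintype G] [AddCommGroup G]
    (p r : G → Prop) [DecidablePred p] [DecidablePred r] (a : G)
    (hdown : ∀ x, p x → ¬ p (x - a) ∧ (r (x - a) ↔ r x))
    (hup : ∀ x, ¬ p x → p (x + a) ∧ (r (x + a) ↔ r x)) :
    (Finset.univ.filter fun x => p x ∧ r x).card =
      (Finset.univ.filter fun x => ¬ p x ∧ r x).card := by
  refine Finset.card_bij' (fun x _ => x - a) (fun x _ => x + a) ?_ ?_ ?_ ?_
  · intro x hx
    simp only [Finset.mem_filter, Finset.mem_univ, true_and] at hx ⊢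
    exact ⟨(hdown x hx.1).1, (hdown x hx.1).2.2 hx.2⟩
  · intro x hx
    simp only [Finset.mem_filter, Finset.mem_univ, true_and] at hx ⊢
    exact ⟨(hup x hx.1).1, (hup x hx.1).2.2 hx.2⟩
  · intro x _
    simp
  · intro x _
    simp

theorem four_dvd_card_of_translate {G : Type*} [Fintype G] [AddCommGroup G]
    (p q : G → Prop) (a b : G)
    (hp : ∀ x, p x → ¬ p (x - a) ∧ (q (x - a) ↔ q x))
    (hp' : ∀ x, ¬ p x → p (x + a) ∧ (q (x + a) ↔ q x))
    (hq : ∀ x, q x → ¬ q (x - b) ∧ (p (x - b) ↔ p x))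
    (hq' : ∀ x, ¬ q x → q (x + b) ∧ (p (x + b) ↔ p x)) :
    4 ∣ Fintype.card G := by
  classical
  have h₁ := card_filter_eq_card_filter_not_of_translate p q a hp hp'
  have h₂ := card_filter_eq_card_filter_not_of_translate p (fun x => ¬ q x) a
    (fun x hx => ⟨(hp x hx).1, not_congr (hp x hx).2⟩)
    (fun x hx => ⟨(hp' x hx).1, not_congr (hp' x hx).2⟩)
  have h₃ := card_filter_eq_card_filter_not_of_translate q p b hq hq'
  have h₄ := Finset.card_filter_add_card_filter_not (s := (Finset.univ : Finset G)) p
  have h₅ := Finset.card_filter_add_card_filter_not (s := Finset.univ.filter p) q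
  have h₆ := Finset.card_filter_add_card_filter_not
    (s := Finset.univ.filter fun x => ¬ p x) q
  simp only [Finset.filter_filter] at h₅ h₆
  simp only [and_comm (a := q _), and_comm (a := ¬ q _)] at h₃
  rw [Finset.card_univ] at h₄
  omega

/-- A choice `rep` of representations of the integers as sums of finite subsets of `B`, each
finite subset being the representation of its sum. -/
structure IsBasisRepr (B : Set ℤ) (rep : ℤ → Finset ℤ) : Prop where
  sum_eq : ∀ x, ∑ b ∈ rep x, b = x
  subset : ∀ x, ↑(rep x) ⊆ B
  eq_of_sum : ∀ (F : Finset ℤ) (x : ℤ), ↑F ⊆ B → ∑ b ∈ F, b = x → rep x = F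

namespace IsBasisRepr

variable {B : Set ℤ} {rep : ℤ → Finset ℤ} {b c x y : ℤ}

theorem repr_add (h : IsBasisRepr B rep) (hb : b ∈ B) (hx : b ∉ rep x) :
    rep (x + b) = insert b (rep x) := by
  apply h.eq_of_sum
  · rw [Finset.coe_insert]
    exact Set.insert_subset hb (h.subset x)
  · rw [Finset.sum_insert hx, h.sum_eq, add_comm]

theorem repr_sub (h : IsBasisRepr B rep) (hx : b ∈ rep x) :
    rep (x - b) = (rep x).erase b := by
  apply h.eq_of_sum
  · exact (Finset.coe_subset.2 (Finset.erase_subset b _)).trans (h.subset x)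
  · rw [eq_sub_iff_add_eq]
    exact (Finset.sum_erase_add _ (fun a : ℤ => a) hx).trans (h.sum_eq x)

theorem mem_repr_add_iff (h : IsBasisRepr B rep) (hb : b ∈ B) :
    b ∈ rep (x + b) ↔ b ∉ rep x := by
  refine ⟨fun hx => ?_, fun hx => ?_⟩
  · have := h.repr_sub hx
    rw [add_sub_cancel_right] at this
    simp [this]
  · simp [h.repr_add hb hx]

theorem periodic_mem_repr (h : IsBasisRepr B rep) (hb : b ∈ B) :
    Function.Periodic (fun x => b ∈ rep x) (2 * b) := by
  intro x
  simp only [eq_iff_iff]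
  rw [two_mul, ← add_assoc, h.mem_repr_add_iff hb, h.mem_repr_add_iff hb, not_not]

theorem mem_repr_iff_of_dvd (h : IsBasisRepr B rep) (hb : b ∈ B) (hd : 2 * b ∣ y - x) :
    b ∈ rep x ↔ b ∈ rep y := by
  obtain ⟨k, hk⟩ := hd
  have := (h.periodic_mem_repr hb).int_mul k x
  rw [← eq_iff_iff, ← this]
  congr! 2
  push_cast
  linarith

theorem eq_of_odd (h : IsBasisRepr B rep) (hb : b ∈ B) (hc : c ∈ B) (hbo : Odd b) (hco : Odd c) :
    c = b := by
  by_contra hne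
  have hbc : Odd (b * c) := hbo.mul hco
  set n : ℕ := (2 * (b * c)).natAbs with hn
  have hn0 : n ≠ 0 := by
    obtain ⟨k, hk⟩ := hbc
    omega
  have : NeZero n := ⟨hn0⟩
  have hdvd : ∀ x y : ℤ, (x : ZMod n) = y → 2 * (b * c) ∣ y - x := by
    intro x y hxy
    rw [ZMod.intCast_eq_intCast_iff_dvd_sub] at hxy
    exact Int.natAbs_dvd.1 hxy
  have key : ∀ d ∈ B, d ∣ b * c → ∀ (x : ℤ) (z : ZMod n), (x : ZMod n) = z →
      (d ∈ rep z.cast ↔ d ∈ rep x) := by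
    intro d hd hdiv x z hz
    refine h.mem_repr_iff_of_dvd hd ((mul_dvd_mul_left 2 hdiv).trans (hdvd _ _ ?_))
    rw [hz, ZMod.intCast_zmod_cast]
  have kb := key b hb (dvd_mul_right b c)
  have kc := key c hc (dvd_mul_left c b)
  have hsub (d : ℤ) (z : ZMod n) : ((z.cast - d : ℤ) : ZMod n) = z - d := by simp
  have hadd (d : ℤ) (z : ZMod n) : ((z.cast + d : ℤ) : ZMod n) = z + d := by simp
  have h4 : 4 ∣ Fintype.card (ZMod n) := by
    refine four_dvd_card_of_translate (fun z => b ∈ rep z.cast) (fun z => c ∈ rep z.cast)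
      (b : ZMod n) (c : ZMod n) ?_ ?_ ?_ ?_ <;> intro z hz
    · rw [kb _ _ (hsub b z), kc _ _ (hsub b z), h.repr_sub hz]
      simp [hne]
    · rw [kb _ _ (hadd b z), kc _ _ (hadd b z), h.repr_add hb hz]
      simp [hne]
    · rw [kb _ _ (hsub c z), kc _ _ (hsub c z), h.repr_sub hz]
      simp [Ne.symm hne]
    · rw [kb _ _ (hadd c z), kc _ _ (hadd c z), h.repr_add hc hz]
      simp [Ne.symm hne]
  rw [ZMod.card] at h4
  obtain ⟨k, hk⟩ := hbc
  omega

theorem exists_odd (h : IsBasisRepr B rep) : ∃ b ∈ B, Odd b := by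
  by_contra! hno
  have : Even (∑ b ∈ rep 1, b) :=
    Finset.even_sum _ fun b hb => Int.not_odd_iff_even.1 (hno b (h.subset 1 hb))
  rw [h.sum_eq] at this
  exact absurd this (by decide)

end IsBasisRepr

/-- If `B ⊆ ℤ` is a basis for the integers (every integer is, in exactly one
way, the sum of a finite subset of `B`), then exactly one element of `B` is
odd and all the other elements are even. -/
theorem stmt12 (B : Set ℤ)
    (hB : Function.Bijective fun F : {F : Finset ℤ // ↑F ⊆ B} => ∑ b ∈ F.1, b) :
    ∃ b ∈ B, Odd b ∧ ∀ c ∈ B, c ≠ b → Even c := by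
  choose f hf using hB.2
  have h : IsBasisRepr B fun x => (f x).1 :=
    { sum_eq := hf
      subset := fun x => (f x).2
      eq_of_sum := fun F x hF hx =>
        congrArg Subtype.val (hB.1 (a₁ := f x) (a₂ := ⟨F, hF⟩) ((hf x).trans hx.symm)) }
  obtain ⟨b, hb, hbo⟩ := h.exists_odd
  refine ⟨b, hb, hbo, fun c hc hcb => ?_⟩
  by_contra hce
  exact hcb (h.eq_of_odd hb hc hbo (Int.not_even_iff_odd.1 hce))
end

section
/- Szele's conjecture (De Bruijn's theorem): Let B ⊆ ℤ be a basis for the integers, i.e., every integer can be written in exactly one way as the sum of a finite subset of B. Then for every natural number k ≥ 0, exactly one element of B is of the form 2^k · d with d odd; consequently B can be enumerated as {d_1, 2·d_2, 2²·d_3, …} with all d_i odd. -/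
/-- Every integer is the sum of exactly one finite subset of `B`. -/
def IsIntegerBasis (B : Set ℤ) : Prop :=
  ∀ n : ℤ, ∃! F : Finset ℤ, ↑F ⊆ B ∧ ∑ b ∈ F, b = n

theorem isIntegerBasis_of_bijective {B : Set ℤ}
    (hB : Function.Bijective fun F : {F : Finset ℤ // ↑F ⊆ B} => ∑ b ∈ F.1, b) :
    IsIntegerBasis B := by
  intro n
  obtain ⟨F, hF⟩ := hB.2 n
  refine ⟨F.1, ⟨F.2, hF⟩, ?_⟩
  rintro G ⟨hG, hGn⟩
  exact congrArg Subtype.val (@hB.1 ⟨G, hG⟩ F (hGn.trans hF.symm))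

/-- The sum of a periodic function over a complete residue system is shift invariant. -/
theorem Function.Periodic.sum_zmod_sub {g : ℤ → ℤ} {N : ℕ} [NeZero N]
    (hg : Function.Periodic g N) (c : ℤ) :
    ∑ x : ZMod N, g ((x.val : ℤ) - c) = ∑ x : ZMod N, g (x.val : ℤ) := by
  have key (x : ZMod N) :
      g ((x.val : ℤ) - c) = g (((Equiv.subRight (c : ZMod N) x).val : ℕ) : ℤ) := by
    have h : (((x.val : ℤ) - c : ℤ) : ZMod N) =
        (((Equiv.subRight (c : ZMod N) x).val : ℤ) : ZMod N) := by
      simp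
    obtain ⟨k, hk⟩ := (ZMod.intCast_eq_intCast_iff_dvd_sub _ _ _).1 h
    have := hg.int_mul k ((x.val : ℤ) - c)
    rw [← this]
    congr 1
    linear_combination -hk
  simp_rw [key]
  exact (Equiv.subRight (c : ZMod N)).sum_comp fun x => g (x.val : ℤ)

/-- The integers have no tiling by `{0, b} + {0, b'}` with `b` and `b'` both odd. -/
theorem not_odd_tiling {f g : ℤ → ℤ} {b b' : ℤ} (hb : Odd b) (hb' : Odd b')
    (hg : ∀ n, g n = 0 ∨ g n = 1) (hf : ∀ n, f n + f (n - b) = 1)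
    (hfg : ∀ n, g n + g (n - b') = f n) : False := by
  have hfper : Function.Periodic f (2 * b) := by
    intro n
    have h1 := hf (n + 2 * b)
    have h2 := hf (n + b)
    rw [show n + 2 * b - b = n + b by ring] at h1
    rw [show n + b - b = n by ring] at h2
    linarith
  have hfN : Function.Periodic f (b' * (2 * b)) := hfper.int_mul b'
  set M := b' * (2 * b) with hM
  have hanti (n : ℤ) : g (n + M) - g n = -(g (n - b' + M) - g (n - b')) := by
    have h1 := hfg (n + M)
    have h2 := hfg n
    rw [hfN n, show n + M - b' = n - b' + M by ring] at h1
    linarith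
  have hdiff : Function.Periodic (fun n => g (n + M) - g n) (2 * b') := by
    intro n
    have h1 := hanti (n + 2 * b')
    have h2 := hanti (n + b')
    rw [show n + 2 * b' - b' = n + b' by ring] at h1
    rw [show n + b' - b' = n by ring] at h2
    simp only
    linarith
  have hgM : Function.Periodic g M := by
    intro n
    have h := hdiff.int_mul b n
    rw [Int.cast_id, show b * (2 * b') = M by rw [hM]; ring] at h
    rcases hg n with h0 | h0 <;> rcases hg (n + M) with h1 | h1 <;>
      rcases hg (n + M + M) with h2 | h2 <;> omega
  have hMmod : M % 4 = 2 := by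
    obtain ⟨k, hk⟩ := hb'.mul hb
    have : M = 2 * (b' * b) := by rw [hM]; ring
    omega
  have hne : NeZero M.natAbs := ⟨by omega⟩
  have hgN : Function.Periodic g (M.natAbs : ℤ) := by
    rcases Int.natAbs_eq M with h | h
    · rw [← h]; exact hgM
    · rw [show (M.natAbs : ℤ) = -M by omega]; exact hgM.neg
  have hsum : ∑ x : ZMod M.natAbs, (g (x.val : ℤ) + g ((x.val : ℤ) - b') +
      (g ((x.val : ℤ) - b) + g ((x.val : ℤ) - (b + b')))) = M.natAbs := by
    have h1 (n : ℤ) : g n + g (n - b') + (g (n - b) + g (n - (b + b'))) = 1 := by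
      rw [← sub_sub, hfg, hfg, hf]
    simp [h1, ZMod.card]
  simp only [Finset.sum_add_distrib, hgN.sum_zmod_sub] at hsum
  omega

namespace IsIntegerBasis

variable {B : Set ℤ}

theorem eq_of_sum_eq (hB : IsIntegerBasis B) {F G : Finset ℤ} (hF : ↑F ⊆ B) (hG : ↑G ⊆ B)
    (h : ∑ b ∈ F, b = ∑ b ∈ G, b) : F = G :=
  (hB (∑ b ∈ G, b)).unique ⟨hF, h⟩ ⟨hG, rfl⟩

theorem zero_notMem (hB : IsIntegerBasis B) : (0 : ℤ) ∉ B := by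
  intro h
  have := hB.eq_of_sum_eq (F := {0}) (G := ∅) (by simpa using h) (by simp) (by simp)
  simp at this

theorem exists_odd (hB : IsIntegerBasis B) : ∃ b ∈ B, Odd b := by
  by_contra! h
  obtain ⟨F, ⟨hF, hF1⟩, -⟩ := hB 1
  have : (2 : ℤ) ∣ ∑ b ∈ F, b :=
    Finset.dvd_sum fun b hb => (Int.not_odd_iff_even.1 (h b (hF hb))).two_dvd
  omega

theorem odd_unique (hB : IsIntegerBasis B) {b b' : ℤ} (hb : b ∈ B) (hb' : b' ∈ B)
    (hbo : Odd b) (hbo' : Odd b') : b = b' := by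
  classical
  by_contra hne
  choose φ hφ _ using id hB
  have hins {c : ℤ} (hc : c ∈ B) (n : ℤ) (h : c ∉ φ (n - c)) : φ n = insert c (φ (n - c)) := by
    refine hB.eq_of_sum_eq (hφ n).1 ?_ ?_
    · rw [Finset.coe_insert]
      exact Set.insert_subset hc (hφ _).1
    · rw [Finset.sum_insert h, (hφ _).2, (hφ _).2]; ring
  have hers {c : ℤ} (n : ℤ) (h : c ∈ φ n) : φ (n - c) = (φ n).erase c := by
    refine hB.eq_of_sum_eq (hφ _).1 ?_ ?_
    · exact (Finset.coe_subset.2 (Finset.erase_subset _ _)).trans (hφ n).1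
    · have := Finset.add_sum_erase (φ n) (fun x => x) h
      simp only [(hφ _).2] at this ⊢
      linarith
  have hmem {c : ℤ} (hc : c ∈ B) (n : ℤ) : c ∈ φ (n - c) ↔ c ∉ φ n := by
    constructor
    · intro h h'
      rw [hers n h'] at h
      simp at h
    · intro h
      by_contra h'
      rw [hins hc n h'] at h
      simp at h
  refine not_odd_tiling (f := fun n => if b ∈ φ n then 0 else 1)
    (g := fun n => if b ∈ φ n ∨ b' ∈ φ n then 0 else 1) hbo hbo' ?_ ?_ ?_
  · intro n
    split_ifs <;> simp
  · intro n
    by_cases h : b ∈ φ n <;> simp [hmem hb, h]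
  · intro n
    simp only [hmem hb']
    by_cases h : b' ∈ φ n
    · rw [hers n h]
      simp [h, hne]
    · simp [h]

theorem half (hB : IsIntegerBasis B) : IsIntegerBasis {x | 2 * x ∈ B} := by
  classical
  intro n
  obtain ⟨F, ⟨hF, hFn⟩, -⟩ := hB (2 * n)
  have heven : ∀ x ∈ F, 2 * (x / 2) = x := by
    intro x hx
    refine Int.mul_ediv_cancel' ?_
    by_contra hx2
    have hxo : Odd x := by rwa [← Int.not_even_iff_odd, even_iff_two_dvd]
    have h2 : (2 : ℤ) ∣ ∑ y ∈ F.erase x, y := by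
      refine Finset.dvd_sum fun y hy => ?_
      rw [Finset.mem_erase] at hy
      by_contra hy2
      have hyo : Odd y := by rwa [← Int.not_even_iff_odd, even_iff_two_dvd]
      exact hy.1 (hB.odd_unique (hF hy.2) (hF hx) hyo hxo)
    have := Finset.add_sum_erase F (fun y => y) hx
    omega
  have hinj : Function.Injective fun x : ℤ => 2 * x := mul_right_injective₀ two_ne_zero
  have himage : (F.image (· / 2)).image (2 * ·) = F := by
    rw [Finset.image_image]
    exact (Finset.image_congr fun x hx => heven x hx).trans Finset.image_id
  have hsum (G : Finset ℤ) : ∑ x ∈ G.image (2 * ·), x = 2 * ∑ x ∈ G, x := by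
    rw [Finset.sum_image hinj.injOn, Finset.mul_sum]
  refine ⟨F.image (· / 2), ⟨?_, ?_⟩, ?_⟩
  · intro x hx
    obtain ⟨y, hy, rfl⟩ := Finset.mem_image.1 (Finset.mem_coe.1 hx)
    simp only [Set.mem_ofPred_eq, heven y hy]
    exact hF hy
  · have := hsum (F.image (· / 2))
    rw [himage, hFn] at this
    omega
  · rintro G ⟨hG, hGn⟩
    apply Finset.image_injective hinj
    refine Eq.trans ?_ himage.symm
    refine hB.eq_of_sum_eq ?_ hF ?_
    · intro x hx
      obtain ⟨y, hy, rfl⟩ := Finset.mem_image.1 (Finset.mem_coe.1 hx)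
      exact hG hy
    · rw [hsum, hGn, hFn]

theorem existsUnique_two_pow_mul_odd (hB : IsIntegerBasis B) (k : ℕ) :
    ∃! b, b ∈ B ∧ ∃ d : ℤ, Odd d ∧ b = 2 ^ k * d := by
  induction k generalizing B with
  | zero =>
    obtain ⟨b, hb, hbo⟩ := hB.exists_odd
    refine ⟨b, ⟨hb, b, hbo, by simp⟩, ?_⟩
    rintro c ⟨hc, d, hd, rfl⟩
    exact hB.odd_unique hc hb (by simpa using hd) hbo
  | succ k ih =>
    obtain ⟨b, ⟨hb, d, hd, hbd⟩, huniq⟩ := ih hB.half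
    refine ⟨2 * b, ⟨hb, d, hd, by rw [hbd]; ring⟩, ?_⟩
    rintro c ⟨hc, e, he, rfl⟩
    have hpow : (2 : ℤ) ^ (k + 1) * e = 2 * (2 ^ k * e) := by ring
    rw [hpow] at hc ⊢
    rw [huniq (2 ^ k * e) ⟨hc, e, he, rfl⟩]

end IsIntegerBasis

theorem two_pow_mul_odd_exponent_unique {k l : ℕ} {d e : ℤ} (hd : Odd d) (he : Odd e)
    (h : 2 ^ k * d = 2 ^ l * e) : k = l := by
  have val (m : ℕ) {c : ℤ} (hc : Odd c) : emultiplicity 2 (2 ^ m * c) = m := by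
    refine emultiplicity_eq_coe.2 ⟨dvd_mul_right _ _, fun hdvd => ?_⟩
    rw [pow_succ, mul_dvd_mul_iff_left (by positivity)] at hdvd
    exact Int.not_even_iff_odd.2 hc (even_iff_two_dvd.2 hdvd)
  have := val k hd
  rw [h, val l he] at this
  exact_mod_cast this.symm

/-- Szele's conjecture, proved by De Bruijn: if `B ⊆ ℤ` is a basis for the
integers (every integer is, in exactly one way, the sum of a finite subset of
`B`), then for every `k` exactly one element of `B` has the form `2 ^ k * d`
with `d` odd; consequently `B` can be enumerated as
`{d₁, 2·d₂, 2²·d₃, …}` with all `dᵢ` odd. -/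
theorem stmt13 (B : Set ℤ)
    (hB : Function.Bijective fun F : {F : Finset ℤ // ↑F ⊆ B} => ∑ b ∈ F.1, b) :
    (∀ k : ℕ, ∃! b, b ∈ B ∧ ∃ d : ℤ, Odd d ∧ b = 2 ^ k * d) ∧
      ∃ d : ℕ → ℤ, (∀ k, Odd (d k)) ∧
        Function.Injective (fun k : ℕ => 2 ^ k * d k) ∧
        Set.range (fun k : ℕ => 2 ^ k * d k) = B := by
  have hbasis := isIntegerBasis_of_bijective hB
  have hex := hbasis.existsUnique_two_pow_mul_odd
  refine ⟨hex, ?_⟩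
  choose b hb huniq using hex
  choose hbB d hd hbd using hb
  refine ⟨d, hd, fun k l h => two_pow_mul_odd_exponent_unique (hd k) (hd l) h, ?_⟩
  ext x
  constructor
  · rintro ⟨k, rfl⟩
    simp only [← hbd]
    exact hbB k
  · intro hx
    have hx0 : x ≠ 0 := fun h => hbasis.zero_notMem (h ▸ hx)
    have hfin : FiniteMultiplicity 2 x := Int.finiteMultiplicity_iff.2 ⟨by decide, hx0⟩
    obtain ⟨c, hc, hc2⟩ := hfin.exists_eq_pow_mul_and_not_dvd
    have hco : Odd c := by rwa [← Int.not_even_iff_odd, even_iff_two_dvd]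
    exact ⟨_, (hbd _).symm.trans (huniq _ x ⟨hx, c, hco, hc⟩).symm⟩
end

section
/- Let n ≥ 1 and let Q = (q_1, …, q_{n−1}) ∈ {−1, +1}^{n−1} be a shape. For 1 ≤ j ≤ n let θ(Q; j) denote the number of permutations [a_1, …, a_n] of {1, …, n} of shape Q with a_n = j. Let (Q,1) = (q_1, …, q_{n−1}, 1) be the shape of degree n+1 obtained by appending +1. Then θ((Q,1); 1) = 0, and for every j with 2 ≤ j ≤ n+1, θ((Q,1); j) = Σ_{h=1}^{j−1} θ(Q; h). -/
/-- `shapeCount m q j` is the number θ(Q; j) of permutations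
`a₀, …, a_m` of `{0, …, m}` of shape `q` (i.e. `q i * (a_{i+1} - a_i) > 0`
for all `i < m`) whose last entry `a_m` equals `j`. -/
noncomputable def shapeCount (m : ℕ) (q : Fin m → ℤ) (j : Fin (m + 1)) : ℕ :=
  Nat.card {π : Equiv.Perm (Fin (m + 1)) //
    (∀ i : Fin m, 0 < q i * (((π i.succ : ℕ) : ℤ) - ((π i.castSucc : ℕ) : ℤ))) ∧
    π (Fin.last m) = j}

/-- Extend a permutation `σ` of `{0, …, m}` by a new last entry `j`, shifting up the entries
of `σ` that are at least `j`. -/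
def appendEntry {m : ℕ} (j : Fin (m + 2)) (σ : Equiv.Perm (Fin (m + 1))) :
    Equiv.Perm (Fin (m + 2)) :=
  finSuccEquivLast.trans ((Equiv.optionCongr σ).trans (finSuccEquiv' j).symm)

@[simp]
theorem appendEntry_last {m : ℕ} (j : Fin (m + 2)) (σ : Equiv.Perm (Fin (m + 1))) :
    appendEntry j σ (Fin.last (m + 1)) = j := by
  simp [appendEntry]

@[simp]
theorem appendEntry_castSucc {m : ℕ} (j : Fin (m + 2)) (σ : Equiv.Perm (Fin (m + 1)))
    (i : Fin (m + 1)) : appendEntry j σ i.castSucc = j.succAbove (σ i) := by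
  simp [appendEntry]

theorem appendEntry_injective {m : ℕ} (j : Fin (m + 2)) :
    Function.Injective (appendEntry j) := by
  intro σ τ h
  ext1 i
  have := congrArg (fun π : Equiv.Perm (Fin (m + 2)) => π i.castSucc) h
  simpa using this

theorem exists_appendEntry_eq {m : ℕ} (π : Equiv.Perm (Fin (m + 2))) :
    ∃ σ, appendEntry (π (Fin.last (m + 1))) σ = π := by
  have h : ∀ i : Fin (m + 1), ∃ k, (π (Fin.last (m + 1))).succAbove k = π i.castSucc := fun i =>
    Fin.exists_succAbove_eq (fun h => (Fin.castSucc_lt_last i).ne (π.injective h))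
  choose f hf using h
  have hinj : Function.Injective f := fun a b hab =>
    Fin.castSucc_injective _ (π.injective (by rw [← hf a, ← hf b, hab]))
  refine ⟨Equiv.ofBijective f (Finite.injective_iff_bijective.mp hinj), ?_⟩
  ext1 i
  cases i using Fin.lastCases with
  | last => simp
  | cast i => simp [hf]

/-- The permutation `π` has shape `q`. -/
def HasShape {m : ℕ} (q : Fin m → ℤ) (π : Equiv.Perm (Fin (m + 1))) : Prop :=
  ∀ i : Fin m, 0 < q i * (((π i.succ : ℕ) : ℤ) - ((π i.castSucc : ℕ) : ℤ))

theorem hasShape_appendEntry_iff {m : ℕ} {q : Fin m → ℤ} (hq : ∀ i, q i = 1 ∨ q i = -1)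
    (j : Fin (m + 2)) (σ : Equiv.Perm (Fin (m + 1))) :
    HasShape (Fin.snoc q 1 : Fin (m + 1) → ℤ) (appendEntry j σ) ↔
      HasShape q σ ∧ (σ (Fin.last m) : ℕ) < j := by
  unfold HasShape
  rw [Fin.forall_fin_succ']
  refine and_congr (forall_congr' fun i => ?_) ?_
  · rw [Fin.succ_castSucc, appendEntry_castSucc, appendEntry_castSucc, Fin.snoc_castSucc]
    have h₁ : (j.succAbove (σ i.castSucc) : ℕ) < j.succAbove (σ i.succ) ↔
        (σ i.castSucc : ℕ) < σ i.succ := Fin.succAbove_lt_succAbove_iff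
    have h₂ : (j.succAbove (σ i.succ) : ℕ) < j.succAbove (σ i.castSucc) ↔
        (σ i.succ : ℕ) < σ i.castSucc := Fin.succAbove_lt_succAbove_iff
    rcases hq i with h | h <;> rw [h] <;> omega
  · rw [Fin.succ_last, appendEntry_last, appendEntry_castSucc, Fin.snoc_last]
    have h : (j.succAbove (σ (Fin.last m)) : ℕ) < j ↔ (σ (Fin.last m) : ℕ) < j :=
      Fin.succAbove_lt_iff_castSucc_lt j (σ (Fin.last m))
    omega

theorem shapeCount_snoc_one_eq_card {m : ℕ} {q : Fin m → ℤ} (hq : ∀ i, q i = 1 ∨ q i = -1)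
    (j : Fin (m + 2)) :
    shapeCount (m + 1) (Fin.snoc q 1) j =
      Nat.card {σ : Equiv.Perm (Fin (m + 1)) // HasShape q σ ∧ (σ (Fin.last m) : ℕ) < j} := by
  symm
  refine Nat.card_eq_of_bijective (fun σ => ⟨appendEntry j σ.1,
    (hasShape_appendEntry_iff hq j σ.1).mpr σ.2, appendEntry_last j σ.1⟩) ⟨?_, ?_⟩
  · intro σ τ h
    exact Subtype.ext (appendEntry_injective j (congrArg Subtype.val h))
  · rintro ⟨π, hπ, rfl⟩
    obtain ⟨σ, hσ⟩ := exists_appendEntry_eq π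
    refine ⟨⟨σ, (hasShape_appendEntry_iff hq _ σ).mp ?_⟩, Subtype.ext hσ⟩
    rw [hσ]
    exact hπ

theorem shapeCount_snoc_one {m : ℕ} {q : Fin m → ℤ} (hq : ∀ i, q i = 1 ∨ q i = -1)
    (j : Fin (m + 2)) :
    shapeCount (m + 1) (Fin.snoc q 1) j =
      ∑ h ∈ Finset.univ.filter (fun h : Fin (m + 1) => (h : ℕ) < (j : ℕ)),
        shapeCount m q h := by
  classical
  rw [shapeCount_snoc_one_eq_card hq, Nat.card_eq_fintype_card, Fintype.card_subtype,
    Finset.card_eq_sum_card_fiberwise (f := fun σ => σ (Fin.last m))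
      (t := Finset.univ.filter (fun h : Fin (m + 1) => (h : ℕ) < (j : ℕ)))
      (fun σ hσ => by simpa using (Finset.mem_filter.mp hσ).2.2)]
  refine Finset.sum_congr rfl fun h hh => ?_
  rw [shapeCount, Nat.card_eq_fintype_card, Fintype.card_subtype, Finset.filter_filter]
  congr 1
  ext σ
  simp only [Finset.mem_filter, Finset.mem_univ, true_and] at hh ⊢
  constructor
  · rintro ⟨⟨hs, -⟩, rfl⟩
    exact ⟨hs, rfl⟩
  · rintro ⟨hs, rfl⟩
    exact ⟨⟨hs, hh⟩, rfl⟩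


/-- De Bruijn's recurrence for counting permutations of a given shape, case of
appending `+1`: θ((Q,1); 1) = 0 (here the smallest value is `0`), and for the
other values `j`, θ((Q,1); j) = Σ_{h < j} θ(Q; h). -/
theorem stmt14 (m : ℕ) (q : Fin m → ℤ) (hq : ∀ i, q i = 1 ∨ q i = -1) :
    shapeCount (m + 1) (Fin.snoc q 1) 0 = 0 ∧
      ∀ j : Fin (m + 2), j ≠ 0 →
        shapeCount (m + 1) (Fin.snoc q 1) j =
          ∑ h ∈ Finset.univ.filter (fun h : Fin (m + 1) => (h : ℕ) < (j : ℕ)),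
            shapeCount m q h := by
  refine ⟨?_, fun j _ => shapeCount_snoc_one hq j⟩
  rw [shapeCount_snoc_one hq]
  simp
end

section
/- Let n ≥ 1 and let Q = (q_1, …, q_{n−1}) ∈ {−1, +1}^{n−1} be a shape. For 1 ≤ j ≤ n let θ(Q; j) denote the number of permutations [a_1, …, a_n] of {1, …, n} of shape Q with a_n = j. Let (Q,−1) = (q_1, …, q_{n−1}, −1) be the shape of degree n+1 obtained by appending −1. Then θ((Q,−1); n+1) = 0, and for every j with 1 ≤ j ≤ n, θ((Q,−1); j) = Σ_{h=j}^{n} θ(Q; h). -/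
/-- Appending the value `j` at the end of a permutation `σ`, after shifting the values of `σ`
that are at least `j` up by one. -/
def Equiv.Perm.appendLast {m : ℕ} (j : Fin (m + 2)) (σ : Equiv.Perm (Fin (m + 1))) :
    Equiv.Perm (Fin (m + 2)) :=
  (finSuccEquiv' (Fin.last (m + 1))).trans
    ((Equiv.optionCongr σ).trans (finSuccEquiv' j).symm)

namespace Equiv.Perm

variable {m : ℕ} (j : Fin (m + 2))

@[simp]
theorem appendLast_last (σ : Equiv.Perm (Fin (m + 1))) :
    appendLast j σ (Fin.last (m + 1)) = j := by
  simp [appendLast]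

@[simp]
theorem appendLast_castSucc (σ : Equiv.Perm (Fin (m + 1))) (i : Fin (m + 1)) :
    appendLast j σ i.castSucc = j.succAbove (σ i) := by
  simp [appendLast, ← Fin.succAbove_last]

theorem appendLast_injective : Function.Injective (appendLast j) := by
  intro σ τ h
  ext i : 1
  have := congrArg (fun π => π i.castSucc) h
  simpa using this

theorem exists_appendLast_eq (π : Equiv.Perm (Fin (m + 2))) (hπ : π (Fin.last (m + 1)) = j) :
    ∃ σ, appendLast j σ = π := by
  have hne (i : Fin (m + 1)) : π i.castSucc ≠ j := by
    rw [← hπ]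
    exact π.injective.ne i.castSucc_lt_last.ne
  choose f hf using fun i => Fin.exists_succAbove_eq (hne i)
  have hinj : Function.Injective f := by
    intro a b hab
    have := congrArg j.succAbove hab
    rw [hf, hf] at this
    exact Fin.castSucc_injective _ (π.injective this)
  refine ⟨Equiv.ofBijective f (Finite.injective_iff_bijective.mp hinj), ?_⟩
  ext i : 1
  induction i using Fin.lastCases with
  | last => simp [hπ]
  | cast i => simp [hf]

end Equiv.Perm

theorem Fin.succAbove_val_lt_succAbove_val_iff {n : ℕ} (j : Fin (n + 1)) (a b : Fin n) :
    (j.succAbove a : ℕ) < j.succAbove b ↔ (a : ℕ) < b := by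
  rw [← Fin.lt_def, Fin.succAbove_lt_succAbove_iff, Fin.lt_def]

theorem shape_step_succAbove_iff {m : ℕ} (j : Fin (m + 2)) {c : ℤ} (hc : c = 1 ∨ c = -1)
    (a b : Fin (m + 1)) :
    0 < c * (((j.succAbove a : ℕ) : ℤ) - (j.succAbove b : ℕ)) ↔
      0 < c * (((a : ℕ) : ℤ) - (b : ℕ)) := by
  have hab := Fin.succAbove_val_lt_succAbove_val_iff j a b
  have hba := Fin.succAbove_val_lt_succAbove_val_iff j b a
  rcases hc with rfl | rfl <;> omega

theorem shape_snoc_appendLast_iff {m : ℕ} (q : Fin m → ℤ) (hq : ∀ i, q i = 1 ∨ q i = -1)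
    (j : Fin (m + 2)) (σ : Equiv.Perm (Fin (m + 1))) :
    (∀ i : Fin (m + 1), 0 < (Fin.snoc q (-1) : Fin (m + 1) → ℤ) i *
        (((σ.appendLast j i.succ : ℕ) : ℤ) - ((σ.appendLast j i.castSucc : ℕ) : ℤ))) ↔
      (∀ i : Fin m, 0 < q i * (((σ i.succ : ℕ) : ℤ) - ((σ i.castSucc : ℕ) : ℤ))) ∧
        (j : ℕ) ≤ σ (Fin.last m) := by
  have hlast : (j : ℕ) < j.succAbove (σ (Fin.last m)) ↔ (j : ℕ) ≤ σ (Fin.last m) := by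
    rw [← Fin.lt_def, Fin.lt_succAbove_iff_le_castSucc, Fin.le_def, Fin.val_castSucc]
  rw [Fin.forall_fin_succ']
  refine and_congr (forall_congr' fun i => ?_) ?_
  · rw [Fin.snoc_castSucc, Fin.succ_castSucc, Equiv.Perm.appendLast_castSucc,
      Equiv.Perm.appendLast_castSucc]
    exact shape_step_succAbove_iff j (hq i) _ _
  · rw [Fin.snoc_last, Fin.succ_last, Equiv.Perm.appendLast_last,
      Equiv.Perm.appendLast_castSucc, ← hlast]
    omega

theorem shapeCount_snoc_neg_one {m : ℕ} (q : Fin m → ℤ) (hq : ∀ i, q i = 1 ∨ q i = -1)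
    (j : Fin (m + 2)) :
    shapeCount (m + 1) (Fin.snoc q (-1)) j =
      Nat.card {σ : Equiv.Perm (Fin (m + 1)) //
        (∀ i : Fin m, 0 < q i * (((σ i.succ : ℕ) : ℤ) - ((σ i.castSucc : ℕ) : ℤ))) ∧
        (j : ℕ) ≤ σ (Fin.last m)} := by
  symm
  refine Nat.card_eq_of_bijective (fun σ => ⟨σ.1.appendLast j,
    (shape_snoc_appendLast_iff q hq j σ.1).mpr σ.2, σ.1.appendLast_last j⟩) ⟨?_, ?_⟩
  · intro σ τ h
    exact Subtype.ext (Equiv.Perm.appendLast_injective j (congrArg Subtype.val h))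
  · rintro ⟨π, hπ, hj⟩
    obtain ⟨σ, rfl⟩ := Equiv.Perm.exists_appendLast_eq j π hj
    exact ⟨⟨σ, (shape_snoc_appendLast_iff q hq j σ).mp hπ⟩, rfl⟩

theorem sum_shapeCount {m : ℕ} (q : Fin m → ℤ) (s : Finset (Fin (m + 1))) :
    ∑ h ∈ s, shapeCount m q h =
      Nat.card {σ : Equiv.Perm (Fin (m + 1)) //
        (∀ i : Fin m, 0 < q i * (((σ i.succ : ℕ) : ℤ) - ((σ i.castSucc : ℕ) : ℤ))) ∧
        σ (Fin.last m) ∈ s} := by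
  classical
  simp only [shapeCount, Nat.card_eq_fintype_card, Fintype.card_subtype]
  rw [Finset.card_eq_sum_card_fiberwise (f := fun σ => σ (Fin.last m)) (t := s)
    fun σ hσ => (Finset.mem_filter.mp hσ).2.2]
  refine Finset.sum_congr rfl fun h hh => congrArg Finset.card ?_
  ext σ
  simp only [Finset.mem_filter, Finset.mem_univ, true_and]
  constructor
  · rintro ⟨hσ, rfl⟩
    exact ⟨⟨hσ, hh⟩, rfl⟩
  · rintro ⟨⟨hσ, -⟩, rfl⟩
    exact ⟨hσ, rfl⟩

/-- De Bruijn's recurrence for counting permutations of a given shape, case of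
appending `-1`: θ((Q,−1); n+1) = 0 (here the largest value is `Fin.last`),
and for the other values `j`, θ((Q,−1); j) = Σ_{h ≥ j} θ(Q; h). -/
theorem stmt15 (m : ℕ) (q : Fin m → ℤ) (hq : ∀ i, q i = 1 ∨ q i = -1) :
    shapeCount (m + 1) (Fin.snoc q (-1)) (Fin.last (m + 1)) = 0 ∧
      ∀ j : Fin (m + 2), (j : ℕ) < m + 1 →
        shapeCount (m + 1) (Fin.snoc q (-1)) j =
          ∑ h ∈ Finset.univ.filter (fun h : Fin (m + 1) => (j : ℕ) ≤ (h : ℕ)),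
            shapeCount m q h := by
  refine ⟨?_, fun j _ => ?_⟩
  · rw [shapeCount_snoc_neg_one q hq]
    refine Nat.card_eq_zero.mpr (Or.inl ⟨?_⟩)
    rintro ⟨σ, -, h⟩
    rw [Fin.val_last] at h
    exact (σ (Fin.last m)).isLt.not_ge h
  · rw [shapeCount_snoc_neg_one q hq, sum_shapeCount]
    simp only [Finset.mem_filter, Finset.mem_univ, true_and]
end

section
/- Little's lemma: Let (G, Γ) be a finite connected simple graph and let v be a vertex of G. Then there exists an orientation of G (an assignment of a direction to each edge of Γ) such that every vertex u ≠ v has odd out-degree. -/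
namespace SimpleGraph

open Classical in
/-- The out-degree modulo two of the vertex `u` in the orientation `o` of `G`. -/
noncomputable def outParity {V : Type*} [Fintype V] (G : SimpleGraph V)
    (o : V → V → Bool) (u : V) : ZMod 2 :=
  ∑ w, if G.Adj u w ∧ o u w = true then 1 else 0

theorem outParity_eq_one_iff {V : Type*} [Fintype V] (G : SimpleGraph V)
    (o : V → V → Bool) (u : V) :
    G.outParity o u = 1 ↔ Odd (Nat.card {w : V | G.Adj u w ∧ o u w = true}) := by
  classical
  rw [← ZMod.natCast_eq_one_iff_odd, outParity, Finset.sum_boole, Nat.card_eq_fintype_card,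
    ← Set.toFinset_card, Set.toFinset_ofPred]

open Classical in
/-- Reversing one edge changes the out-degree parity at exactly its two endpoints. -/
theorem exists_outParity_eq_of_adj {V : Type*} [Fintype V] {G : SimpleGraph V}
    {o : V → V → Bool} (ho : ∀ i j, G.Adj i j → o i j = !o j i) {a b : V} (h : G.Adj a b) :
    ∃ o' : V → V → Bool, (∀ i j, G.Adj i j → o' i j = !o' j i) ∧
      ∀ u, G.outParity o' u =
        G.outParity o u + (if u = a then 1 else 0) + (if u = b then 1 else 0) := by
  refine ⟨fun i j ↦ xor (o i j) (decide (s(i, j) = s(a, b))), fun i j hij ↦ ?_, fun u ↦ ?_⟩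
  · simp only [ho i j hij, Sym2.eq_swap (a := i), Bool.not_xor]
  · have h_ends : ((if u = a then 1 else 0) + (if u = b then 1 else 0) : ZMod 2) =
        ∑ w, ((if w = b then (if u = a then 1 else 0) else 0) +
          (if w = a then (if u = b then 1 else 0) else 0)) := by
      simp [Finset.sum_add_distrib]
    rw [add_assoc, h_ends, outParity, outParity, ← Finset.sum_add_distrib]
    refine Finset.sum_congr rfl fun w _ ↦ ?_
    have h_ne := h.ne
    have h_symm := h.symm
    have h_two : (1 + 1 : ZMod 2) = 0 := by decide
    cases o u w <;> simp only [Sym2.eq_iff] <;> grind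

open Classical in
/-- Reversing the edges of a walk in turn changes the out-degree parity at its two ends only. -/
theorem Walk.exists_outParity_eq {V : Type*} [Fintype V] {G : SimpleGraph V} {a b : V}
    (p : G.Walk a b) {o : V → V → Bool} (ho : ∀ i j, G.Adj i j → o i j = !o j i) :
    ∃ o' : V → V → Bool, (∀ i j, G.Adj i j → o' i j = !o' j i) ∧
      ∀ u, G.outParity o' u =
        G.outParity o u + (if u = a then 1 else 0) + (if u = b then 1 else 0) := by
  induction p generalizing o with
  | nil => exact ⟨o, ho, fun u ↦ by rw [add_assoc, CharTwo.add_self_eq_zero, add_zero]⟩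
  | @cons a c b h p ih =>
    obtain ⟨o₁, ho₁, h₁⟩ := exists_outParity_eq_of_adj ho h
    obtain ⟨o₂, ho₂, h₂⟩ := ih ho₁
    refine ⟨o₂, ho₂, fun u ↦ ?_⟩
    rw [h₂, h₁, add_assoc (G.outParity o u + _), CharTwo.add_self_eq_zero, add_zero]

theorem exists_forall_eq_not {V : Type*} (G : SimpleGraph V) :
    ∃ o : V → V → Bool, ∀ i j, G.Adj i j → o i j = !o j i := by
  classical
  refine ⟨fun i j ↦ decide (WellOrderingRel i j), fun i j hij ↦ ?_⟩
  rcases trichotomous_of (WellOrderingRel (α := V)) i j with h | h | h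
  · simp [h, asymm h]
  · exact absurd h hij.ne
  · simp [h, asymm h]

end SimpleGraph

/-- Little's lemma: every finite connected simple graph has an orientation
(for adjacent `i, j`, the edge goes from `i` to `j` iff `o i j = true`, and
`o i j = !o j i`) in which every vertex other than a chosen vertex `v` has odd
out-degree. -/
theorem stmt17 {V : Type*} [Fintype V] (G : SimpleGraph V)
    (hconn : G.Connected) (v : V) :
    ∃ o : V → V → Bool, (∀ i j, G.Adj i j → o i j = !o j i) ∧
      ∀ u, u ≠ v → Odd (Nat.card {w : V | G.Adj u w ∧ o u w = true}) := by
  classical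
  suffices h : ∀ S : Finset V, v ∉ S → ∃ o : V → V → Bool,
      (∀ i j, G.Adj i j → o i j = !o j i) ∧ ∀ u ∈ S, G.outParity o u = 1 by
    obtain ⟨o, ho, hS⟩ := h (Finset.univ.erase v) (Finset.notMem_erase v _)
    exact ⟨o, ho, fun u hu ↦ (G.outParity_eq_one_iff o u).1 (hS u (by simp [hu]))⟩
  intro S
  induction S using Finset.induction_on with
  | empty =>
    obtain ⟨o, ho⟩ := G.exists_forall_eq_not
    exact fun _ ↦ ⟨o, ho, by simp⟩
  | insert a S ha ih =>
    intro hv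
    obtain ⟨hva, hvS⟩ : v ≠ a ∧ v ∉ S := by simpa using hv
    obtain ⟨o, ho, hS⟩ := ih hvS
    by_cases h_odd : G.outParity o a = 1
    · exact ⟨o, ho, by simpa [h_odd] using hS⟩
    · obtain ⟨p⟩ := hconn.preconnected a v
      obtain ⟨o', ho', h⟩ := p.exists_outParity_eq ho
      have h_zero : G.outParity o a = 0 := by
        generalize G.outParity o a = x at h_odd
        revert x
        decide
      refine ⟨o', ho', fun u hu ↦ ?_⟩
      rcases Finset.mem_insert.1 hu with rfl | hu
      · simp [h, h_zero, hva.symm]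
      · have hua : u ≠ a := fun e ↦ ha (e ▸ hu)
        have huv : u ≠ v := fun e ↦ hvS (e ▸ hu)
        simp [h, hS u hu, hua, huv]
end

section
/- Let (G, Γ) be a finite simple graph on vertex set {1, …, n}, let b be a symmetric matrix of weights in a commutative ring with b_{ij} = b_{ji}, b_{ij} = 0 whenever {i,j} ∉ Γ, and let ε be an orientation of G, i.e., an antisymmetric n×n matrix with ε_{ij} ∈ {−1, +1} and ε_{ij} = −ε_{ji} when {i,j} ∈ Γ and ε_{ij} = 0 otherwise. Suppose ε is Pfaffian: in every circuit cover of G consisting only of circuits of even length, every circuit [{i_1,i_2}, {i_2,i_3}, …, {i_k,i_1}] has positive sign, where the sign of an even circuit is −ε_{i_1 i_2}·ε_{i_2 i_3}⋯ε_{i_k i_1}. Let S = Σ_β ρ(β), where β ranges over all perfect matchings of G (partitions of {1,…,n} into edges of Γ) and ρ(β) = ∏_{{i,j} ∈ β} b_{ij}. Then S² = det(A), where A is the antisymmetric matrix with entries a_{ij} = ε_{ij}·b_{ij}. -/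
section Pfaffian

open Equiv.Perm

variable {V : Type*}

theorem exists_bool_swap_of_setoid [LinearOrder V] (r : Setoid V) (f : V → V)
    (hf : ∀ a b, r a b → r (f a) (f b)) (hff : ∀ a, r (f (f a)) a) (hne : ∀ a, ¬ r (f a) a) :
    ∃ c : V → Bool, (∀ a b, r a b → c a = c b) ∧ ∀ a, c (f a) = !c a := by
  let rep : V → V := fun a => (Quotient.mk r a).out
  have hrep : ∀ a b, r a b → rep a = rep b := fun a b h => by
    simp only [rep]; rw [Quotient.sound h]
  have hrr : ∀ a, r (rep a) a := fun a => Quotient.mk_out a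
  refine ⟨fun a => decide (rep a < rep (f a)), fun a b h => ?_, fun a => ?_⟩
  · simp only [hrep a b h, hrep _ _ (hf a b h)]
  · have h1 := hrep _ _ (hff a)
    have h2 : rep (f a) ≠ rep a := fun h =>
      hne a (r.trans (r.symm (hrr (f a))) (h ▸ hrr a))
    simp only [h1]
    rcases lt_or_gt_of_ne h2 with h | h
    · simp [h, h.le]
    · simp [h, h.le]

/-- `c` changes its value along each step of `σ`. -/
def IsAlternating (σ : Equiv.Perm V) (c : V → Bool) : Prop := ∀ v, c (σ v) = !c v

theorem IsAlternating.inv {σ : Equiv.Perm V} {c : V → Bool} (h : IsAlternating σ c) :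
    IsAlternating σ⁻¹ c := fun v => by
  have := h (σ⁻¹ v)
  simp at this
  simp [this]

theorem IsAlternating.even_of_pow_apply {σ : Equiv.Perm V} {c : V → Bool}
    (h : IsAlternating σ c) {k : ℕ} {v : V} (hk : (σ ^ k) v = v) : Even k := by
  have key : ∀ k : ℕ, c ((σ ^ k) v) = (c v ^^ decide (¬ Even k)) := by
    intro k
    induction k with
    | zero => simp
    | succ k ih =>
      rw [pow_succ', mul_apply, h, ih]
      by_cases hk : Even k <;> simp [hk, Nat.even_add_one]
  have := key k
  rw [hk] at this
  by_contra hodd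
  simp [hodd] at this

theorem IsAlternating.even_of_zpow_apply {σ : Equiv.Perm V} {c : V → Bool}
    (h : IsAlternating σ c) {k : ℤ} {v : V} (hk : (σ ^ k) v = v) : Even k := by
  obtain ⟨n, rfl | rfl⟩ := k.eq_nat_or_neg
  · exact (Int.even_coe_nat n).2 (h.even_of_pow_apply hk)
  · refine ((Int.even_coe_nat n).2 (h.inv.even_of_pow_apply (v := v) ?_)).neg
    simpa using hk

theorem exists_isAlternating_of_involutive [LinearOrder V] (f g : Equiv.Perm V)
    (hf : ∀ v, f (f v) = v) (hg : ∀ v, g (g v) = v) (hf' : ∀ v, f v ≠ v) (hg' : ∀ v, g v ≠ v) :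
    ∃ c, IsAlternating f c ∧ IsAlternating g c := by
  have ff : f * f = 1 := Equiv.ext hf
  have gg : g * g = 1 := Equiv.ext hg
  have hfi : f⁻¹ = f := inv_eq_of_mul_eq_one_left ff
  have hgi : g⁻¹ = g := inv_eq_of_mul_eq_one_left gg
  have hconj : f * (f * g) * f⁻¹ = (f * g)⁻¹ := by
    rw [mul_inv_rev, hfi, hgi, ← mul_assoc, ff, one_mul]
  have hz : ∀ (k : ℤ) (v : V), f (((f * g) ^ k) v) = ((f * g) ^ (-k)) (f v) := by
    intro k v
    have : f * (f * g) ^ k * f⁻¹ = (f * g) ^ (-k) := by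
      rw [← conj_zpow, hconj, inv_zpow']
    rw [← this]; simp
  obtain ⟨c, hc, hcf⟩ := exists_bool_swap_of_setoid (SameCycle.setoid (f * g)) f
    (by
      rintro a b ⟨k, rfl⟩
      exact ⟨-k, (hz k a).symm⟩)
    (fun a => by rw [hf a])
    (by
      intro a h
      obtain ⟨k, hk⟩ := SameCycle.symm h
      obtain ⟨j, rfl | rfl⟩ := Int.even_or_odd' k
      · apply hf' (((f * g) ^ j) a)
        rw [hz, ← hk, ← mul_apply, ← zpow_add]
        congr 2; ring
      · apply hg' (((f * g) ^ j) a)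
        apply f.injective
        rw [hz, ← hk, ← mul_apply (_ ^ _), ← zpow_add, ← mul_apply f g, ← mul_apply, ← zpow_one_add]
        congr 2; ring)
  refine ⟨c, hcf, fun v => ?_⟩
  have h := hcf (g v)
  rw [← hc v (f (g v)) ⟨1, by simp⟩] at h
  simp [h]

theorem exists_isAlternating_of_forall_even [LinearOrder V] (σ : Equiv.Perm V)
    (h : ∀ (v : V) (k : ℤ), (σ ^ k) v = v → Even k) : ∃ c, IsAlternating σ c := by
  obtain ⟨c, -, hc⟩ := exists_bool_swap_of_setoid (SameCycle.setoid (σ ^ 2)) σ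
    (by
      rintro a b ⟨k, rfl⟩
      refine ⟨k, ?_⟩
      rw [← mul_apply, ← mul_apply]
      congr 1
      exact ((Commute.refl σ).pow_left 2).zpow_left k)
    (fun a => SameCycle.symm ⟨1, by simp [pow_two]⟩)
    (by
      intro a hs
      obtain ⟨k, hk⟩ := SameCycle.symm hs
      have := h a (-1 + 2 * k) (by
        rw [zpow_add, zpow_mul, mul_apply]
        simpa using congrArg (fun w => σ⁻¹ w) hk)
      rw [Int.even_add] at this
      simp at this)
  exact ⟨c, hc⟩

/-- The set of points which return to themselves after an odd number of steps of `σ`. -/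
def oddPoints (σ : Equiv.Perm V) : Set V := {v | ∃ k : ℤ, Odd k ∧ (σ ^ k) v = v}

theorem exists_isAlternating_or_nonempty_oddPoints [LinearOrder V] (σ : Equiv.Perm V) :
    (∃ c, IsAlternating σ c) ∨ (oddPoints σ).Nonempty := by
  by_contra! h
  obtain ⟨c, hc⟩ := exists_isAlternating_of_forall_even σ fun v k hk => by
    by_contra hodd
    exact Set.eq_empty_iff_forall_notMem.1 h.2 v ⟨k, Int.not_even_iff_odd.1 hodd, hk⟩
  exact h.1 c hc

section Reverse

variable [Fintype V] [DecidableEq V]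

/-- The permutation obtained from `σ` by reversing its cycle through `x`. -/
def reverseCycle (σ : Equiv.Perm V) (x : V) : Equiv.Perm V := σ * (σ.cycleOf x) ^ (-2 : ℤ)

theorem commute_cycleOf (σ : Equiv.Perm V) (x : V) : Commute σ (σ.cycleOf x) := by
  ext v
  simp only [mul_apply, cycleOf_apply, sameCycle_apply_right]
  split_ifs <;> rfl

theorem reverseCycle_zpow_apply_of_sameCycle {σ : Equiv.Perm V} {x v : V} (h : SameCycle σ x v)
    (k : ℤ) : ((reverseCycle σ x) ^ k) v = (σ ^ (-k)) v := by
  rw [reverseCycle, ((commute_cycleOf σ x).zpow_right _).mul_zpow, ← zpow_mul, mul_apply,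
    h.cycleOf_eq, cycleOf_zpow_apply_self, ← mul_apply, ← zpow_add]
  congr 2; ring

theorem reverseCycle_zpow_apply_of_not_sameCycle {σ : Equiv.Perm V} {x v : V}
    (h : ¬ SameCycle σ x v) (k : ℤ) : ((reverseCycle σ x) ^ k) v = (σ ^ k) v := by
  have hv : σ.cycleOf x v = v := by rw [cycleOf_apply, if_neg h]
  rw [reverseCycle, ((commute_cycleOf σ x).zpow_right _).mul_zpow, ← zpow_mul, mul_apply,
    zpow_apply_eq_self_of_apply_eq_self hv]

theorem reverseCycle_apply (σ : Equiv.Perm V) (x v : V) :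
    reverseCycle σ x v = if SameCycle σ x v then σ⁻¹ v else σ v := by
  split_ifs with h
  · simpa using reverseCycle_zpow_apply_of_sameCycle h 1
  · simpa using reverseCycle_zpow_apply_of_not_sameCycle h 1

theorem sameCycle_reverseCycle_iff (σ : Equiv.Perm V) (x v : V) :
    SameCycle (reverseCycle σ x) x v ↔ SameCycle σ x v := by
  constructor
  · rintro ⟨k, rfl⟩
    exact ⟨-k, (reverseCycle_zpow_apply_of_sameCycle (SameCycle.refl _ _) k).symm⟩
  · rintro ⟨k, rfl⟩
    exact ⟨-k, by simpa using reverseCycle_zpow_apply_of_sameCycle (SameCycle.refl σ x) (-k)⟩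

theorem reverseCycle_reverseCycle (σ : Equiv.Perm V) (x : V) :
    reverseCycle (reverseCycle σ x) x = σ := by
  ext v
  simp only [reverseCycle_apply (reverseCycle σ x), sameCycle_reverseCycle_iff]
  split_ifs with h
  · simpa using reverseCycle_zpow_apply_of_sameCycle h (-1)
  · simpa using reverseCycle_zpow_apply_of_not_sameCycle h 1

theorem sign_reverseCycle (σ : Equiv.Perm V) (x : V) : sign (reverseCycle σ x) = sign σ := by
  have : sign (σ.cycleOf x) ^ (-2 : ℤ) = 1 := by
    rw [zpow_neg, inv_eq_one]
    exact Int.units_sq _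
  rw [reverseCycle, map_mul, map_zpow, this, mul_one]

theorem oddPoints_reverseCycle (σ : Equiv.Perm V) (x : V) :
    oddPoints (reverseCycle σ x) = oddPoints σ := by
  ext v
  by_cases h : SameCycle σ x v
  · simp only [oddPoints, Set.mem_ofPred_eq, reverseCycle_zpow_apply_of_sameCycle h]
    constructor
    · rintro ⟨k, hk, hv⟩
      exact ⟨-k, hk.neg, hv⟩
    · rintro ⟨k, hk, hv⟩
      exact ⟨-k, hk.neg, by simpa using hv⟩
  · simp only [oddPoints, Set.mem_ofPred_eq, reverseCycle_zpow_apply_of_not_sameCycle h]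

theorem odd_card_sameCycle {σ : Equiv.Perm V} {x : V} (hx : x ∈ oddPoints σ) :
    Odd (Finset.univ.filter fun v => SameCycle σ x v).card := by
  obtain ⟨k, hk, hkx⟩ := hx
  have hon : σ.IsCycleOn (Finset.univ.filter fun v => SameCycle σ x v : Finset V) := by
    refine ⟨σ.bijOn fun v => by simp, fun a ha b hb => ?_⟩
    simp only [Finset.coe_filter, Finset.mem_univ, true_and, Set.mem_ofPred_eq] at ha hb
    exact ha.symm.trans hb
  have hd := (hon.zpow_apply_eq (a := x) (by simp [SameCycle.refl])).1 hkx
  obtain ⟨m, rfl⟩ := hd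
  exact (Int.odd_coe_nat _).1 (Int.odd_mul.1 hk).1

theorem prod_reverseCycle {R : Type*} [CommRing R] {a : Matrix V V R} (ha : ∀ i j, a i j = -a j i)
    {σ : Equiv.Perm V} {x : V} (hx : x ∈ oddPoints σ) :
    ∏ v, a v (reverseCycle σ x v) = -∏ v, a v (σ v) := by
  rw [← Finset.prod_filter_mul_prod_filter_not _ (fun v => SameCycle σ x v),
    ← Finset.prod_filter_mul_prod_filter_not Finset.univ (fun v => SameCycle σ x v)
      (fun v => a v (σ v)), ← neg_mul]
  congr 1
  · calc _ = ∏ v ∈ Finset.univ.filter fun v => SameCycle σ x v, a v (σ⁻¹ v) :=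
          Finset.prod_congr rfl fun v hv => by
            rw [reverseCycle_apply, if_pos (Finset.mem_filter.1 hv).2]
      _ = ∏ v ∈ Finset.univ.filter fun v => SameCycle σ x v, a (σ v) v :=
          Finset.prod_bij' (fun v _ => σ⁻¹ v) (fun v _ => σ v) (by simp) (by simp) (by simp)
            (by simp) (by simp)
      _ = ∏ v ∈ Finset.univ.filter fun v => SameCycle σ x v, -a v (σ v) :=
          Finset.prod_congr rfl fun v _ => ha _ _
      _ = _ := by rw [Finset.prod_neg, (odd_card_sameCycle hx).neg_one_pow, neg_one_mul]
  · exact Finset.prod_congr rfl fun v hv => by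
      rw [reverseCycle_apply, if_neg (Finset.mem_filter.1 hv).2]

/-- Permutations with an odd cycle do not contribute to an antisymmetric determinant. -/
theorem sum_not_isAlternating_eq_zero [LinearOrder V] {R : Type*} [CommRing R] {a : Matrix V V R}
    (ha : ∀ i j, a i j = -a j i) (ha0 : ∀ i, a i i = 0)
    [DecidablePred fun σ : Equiv.Perm V => ∃ c, IsAlternating σ c] :
    ∑ σ : Equiv.Perm V with ¬ ∃ c, IsAlternating σ c, sign σ • ∏ v, a v (σ v) = 0 := by
  have hne : ∀ σ : Equiv.Perm V, (¬ ∃ c, IsAlternating σ c) → (oddPoints σ).Nonempty :=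
    fun σ h => (exists_isAlternating_or_nonempty_oddPoints σ).resolve_left h
  classical
  let pt : Set V → Equiv.Perm V → Equiv.Perm V := fun s σ =>
    if h : s.Nonempty then reverseCycle σ h.some else σ
  have hpt : ∀ σ, (¬ ∃ c, IsAlternating σ c) →
      ∃ x ∈ oddPoints σ, ∀ τ, pt (oddPoints σ) τ = reverseCycle τ x := fun σ h =>
    ⟨_, (hne σ h).some_mem, fun τ => by simp only [pt, dif_pos (hne σ h)]⟩
  refine Finset.sum_involution (fun σ _ => pt (oddPoints σ) σ) ?_ ?_ ?_ ?_
  · intro σ hσ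
    obtain ⟨x, hx, h⟩ := hpt σ (Finset.mem_filter.1 hσ).2
    rw [h, sign_reverseCycle, prod_reverseCycle ha hx, smul_neg, add_neg_cancel]
  · intro σ hσ hne0 heq
    obtain ⟨x, hx, h⟩ := hpt σ (Finset.mem_filter.1 hσ).2
    rw [h] at heq
    have h2 : σ (σ x) = x := by
      have := congrArg (fun τ : Equiv.Perm V => τ x) heq
      simp only [reverseCycle_apply, SameCycle.refl, if_true] at this
      rw [← this]; simp
    obtain ⟨k, ⟨j, rfl⟩, hk⟩ := hx
    have hfix : σ x = x := by
      have h3 : (σ ^ (2 : ℤ)) x = x := h2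
      rwa [add_comm, zpow_add, zpow_one, mul_apply, zpow_mul,
        zpow_apply_eq_self_of_apply_eq_self h3] at hk
    apply hne0
    rw [Finset.prod_eq_zero (Finset.mem_univ x) (by rw [hfix, ha0]), smul_zero]
  · intro σ hσ
    have hσ' := (Finset.mem_filter.1 hσ).2
    obtain ⟨x, hx, h⟩ := hpt σ hσ'
    simp only [Finset.mem_filter, Finset.mem_univ, true_and]
    rintro ⟨c, hc⟩
    rw [← oddPoints_reverseCycle σ x] at hx
    rw [h] at hc
    obtain ⟨k, hk, hkx⟩ := hx
    exact Int.not_even_iff_odd.2 hk (hc.even_of_zpow_apply hkx)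
  · intro σ hσ
    obtain ⟨x, hx, h⟩ := hpt σ (Finset.mem_filter.1 hσ).2
    simp only [h, oddPoints_reverseCycle, reverseCycle_reverseCycle]

end Reverse

section Bijection

/-- A choice of an element of a set of colourings. -/
noncomputable def pickColoring (C : Set (V → Bool)) : V → Bool := by
  classical exact if h : C.Nonempty then h.some else fun _ => false

theorem pickColoring_mem {C : Set (V → Bool)} (h : C.Nonempty) : pickColoring C ∈ C := by
  rw [pickColoring, dif_pos h]
  exact h.some_mem

/-- The common colourings of two permutations. -/
def colorings (f g : Equiv.Perm V) : Set (V → Bool) := {c | IsAlternating f c ∧ IsAlternating g c}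

/-- Two involutions with a common alternating colouring glue to a permutation. -/
def glue (f g : Equiv.Perm V) (c : V → Bool) (hf : ∀ v, f (f v) = v) (hg : ∀ v, g (g v) = v)
    (hc : c ∈ colorings f g) : Equiv.Perm V where
  toFun v := if c v then g v else f v
  invFun v := if c v then f v else g v
  left_inv v := by
    have h1 := hc.1 v
    have h2 := hc.2 v
    cases h : c v <;> simp_all
  right_inv v := by
    have h1 := hc.1 v
    have h2 := hc.2 v
    cases h : c v <;> simp_all

/-- The involution exchanging `v` and `σ v` for the points `v` of colour `k`. -/
def splitInvolution (σ : Equiv.Perm V) (c : V → Bool) (hc : IsAlternating σ c) (k : Bool) :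
    Equiv.Perm V where
  toFun v := if c v = k then σ v else σ⁻¹ v
  invFun v := if c v = k then σ v else σ⁻¹ v
  left_inv v := by
    have h1 := hc v
    have h2 := hc.inv v
    cases h : c v <;> cases k <;> simp_all
  right_inv v := by
    have h1 := hc v
    have h2 := hc.inv v
    cases h : c v <;> cases k <;> simp_all

theorem setOf_isAlternating_glue {f g : Equiv.Perm V} {c : V → Bool} (hf : ∀ v, f (f v) = v)
    (hg : ∀ v, g (g v) = v) (hc : c ∈ colorings f g) :
    {d | IsAlternating (glue f g c hf hg hc) d} = colorings f g := by
  ext d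
  refine ⟨fun hd => ⟨fun v => ?_, fun v => ?_⟩, fun hd v => ?_⟩
  · have h1 := hc.1 v
    have h2 := hd v
    have h3 := hd (f v)
    simp only [glue, Equiv.coe_fn_mk] at h2 h3
    cases h : c v <;> simp_all
  · have h1 := hc.2 v
    have h2 := hd v
    have h3 := hd (g v)
    simp only [glue, Equiv.coe_fn_mk] at h2 h3
    cases h : c v <;> simp_all
  · have h1 := hd.1 v
    have h2 := hd.2 v
    simp only [glue, Equiv.coe_fn_mk]
    split_ifs <;> assumption

theorem colorings_splitInvolution {σ : Equiv.Perm V} {c : V → Bool} (hc : IsAlternating σ c) :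
    colorings (splitInvolution σ c hc false) (splitInvolution σ c hc true) = {d | IsAlternating σ d} := by
  ext d
  refine ⟨fun hd v => ?_, fun hd => ⟨fun v => ?_, fun v => ?_⟩⟩
  · have h1 := hd.1 v
    have h2 := hd.2 v
    simp only [splitInvolution, Equiv.coe_fn_mk] at h1 h2
    cases h : c v <;> simp_all
  all_goals
    have h1 := hd v
    have h2 := IsAlternating.inv hd v
    simp only [splitInvolution, Equiv.coe_fn_mk]
    split_ifs <;> assumption

theorem splitInvolution_splitInvolution {σ : Equiv.Perm V} {c : V → Bool}
    (hc : IsAlternating σ c) (k : Bool) (v : V) :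
    splitInvolution σ c hc k (splitInvolution σ c hc k v) = v :=
  (splitInvolution σ c hc k).left_inv v

variable [Fintype V] {R : Type*} [CommRing R] {b : Matrix V V R}

theorem prod_lt_eq_prod_color [LinearOrder V] (hb : ∀ i j, b i j = b j i) {f : Equiv.Perm V}
    {c : V → Bool} (hf : ∀ v, f (f v) = v) (hc : IsAlternating f c) (k : Bool) :
    ∏ v with v < f v, b v (f v) = ∏ v with c v = k, b v (f v) := by
  have hne : ∀ v, f v ≠ v := fun v h => by simpa [h] using hc v
  refine Finset.prod_bij' (fun v _ => if c v = k then v else f v)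
    (fun v _ => if v < f v then v else f v) ?_ ?_ ?_ ?_ ?_
  · intro v _
    have := hc v
    simp only [Finset.mem_filter, Finset.mem_univ, true_and]
    split_ifs with h
    · exact h
    · cases h' : c v <;> cases k <;> simp_all
  · intro v _
    simp only [Finset.mem_filter, Finset.mem_univ, true_and]
    split_ifs with h
    · exact h
    · rw [hf]
      exact lt_of_le_of_ne (not_lt.1 h) (hne v)
  · intro v hv
    have hv' := (Finset.mem_filter.1 hv).2
    split_ifs <;> simp_all [not_lt_of_gt]
  · intro v hv
    have hv' := (Finset.mem_filter.1 hv).2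
    have := hc v
    split_ifs <;> simp_all
  · intro v _
    split_ifs
    · rfl
    · rw [hf, hb]

open Classical in
/-- Ordered pairs of perfect matchings, encoded as involutions, correspond to circuit covers by
even circuits, encoded as permutations. -/
theorem sq_sum_involutions [LinearOrder V] (G : SimpleGraph V) (hb : ∀ i j, b i j = b j i) :
    (∑ f : Equiv.Perm V with (∀ v, f (f v) = v) ∧ ∀ v, G.Adj v (f v),
      ∏ v with v < f v, b v (f v)) ^ 2 =
    ∑ σ : Equiv.Perm V with (∃ c, IsAlternating σ c) ∧ ∀ v, G.Adj v (σ v), ∏ v, b v (σ v) := by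
  have hpick : ∀ σ : Equiv.Perm V, (∃ c, IsAlternating σ c) →
      IsAlternating σ (pickColoring {c | IsAlternating σ c}) := fun σ h => pickColoring_mem h
  rw [sq, Finset.sum_mul_sum, ← Finset.sum_product']
  have hM : ∀ p : Equiv.Perm V × Equiv.Perm V,
      p ∈ (Finset.univ.filter fun f : Equiv.Perm V => (∀ v, f (f v) = v) ∧ ∀ v, G.Adj v (f v)) ×ˢ
        (Finset.univ.filter fun f : Equiv.Perm V => (∀ v, f (f v) = v) ∧ ∀ v, G.Adj v (f v)) ↔
      ((∀ v, p.1 (p.1 v) = v) ∧ ∀ v, G.Adj v (p.1 v)) ∧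
        (∀ v, p.2 (p.2 v) = v) ∧ ∀ v, G.Adj v (p.2 v) := by simp
  have hT : ∀ σ : Equiv.Perm V,
      σ ∈ (Finset.univ.filter fun σ : Equiv.Perm V =>
        (∃ c, IsAlternating σ c) ∧ ∀ v, G.Adj v (σ v)) ↔
      (∃ c, IsAlternating σ c) ∧ ∀ v, G.Adj v (σ v) := by simp
  have hcol : ∀ p ∈ (Finset.univ.filter fun f : Equiv.Perm V =>
        (∀ v, f (f v) = v) ∧ ∀ v, G.Adj v (f v)) ×ˢ
        (Finset.univ.filter fun f : Equiv.Perm V => (∀ v, f (f v) = v) ∧ ∀ v, G.Adj v (f v)),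
      pickColoring (colorings p.1 p.2) ∈ colorings p.1 p.2 := fun p hp => by
    obtain ⟨⟨h1, h2⟩, h3, h4⟩ := (hM p).1 hp
    exact pickColoring_mem (exists_isAlternating_of_involutive _ _ h1 h3
      (fun v => (h2 v).ne') fun v => (h4 v).ne')
  refine Finset.sum_bij'
    (fun p hp => glue p.1 p.2 (pickColoring (colorings p.1 p.2)) ((hM p).1 hp).1.1
      ((hM p).1 hp).2.1 (hcol p hp))
    (fun σ hσ => (splitInvolution σ _ (hpick σ ((hT σ).1 hσ).1) false,
      splitInvolution σ _ (hpick σ ((hT σ).1 hσ).1) true)) ?_ ?_ ?_ ?_ ?_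
  · intro p hp
    obtain ⟨⟨h1, h2⟩, h3, h4⟩ := (hM p).1 hp
    refine (hT _).2 ⟨⟨_, (setOf_isAlternating_glue h1 h3 (hcol p hp)).ge (hcol p hp)⟩, fun v => ?_⟩
    simp only [glue, Equiv.coe_fn_mk]
    split_ifs
    exacts [h4 v, h2 v]
  · intro σ hσ
    obtain ⟨h1, h2⟩ := (hT σ).1 hσ
    have h3 : ∀ v, G.Adj v (σ⁻¹ v) := fun v => by simpa using (h2 (σ⁻¹ v)).symm
    refine (hM _).2 ⟨⟨splitInvolution_splitInvolution (hpick σ h1) _, fun v => ?_⟩,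
      splitInvolution_splitInvolution (hpick σ h1) _, fun v => ?_⟩ <;>
    · simp only [splitInvolution, Equiv.coe_fn_mk]
      split_ifs
      exacts [h2 v, h3 v]
  · intro p hp
    obtain ⟨⟨h1, h2⟩, h3, h4⟩ := (hM p).1 hp
    have hc := hcol p hp
    refine Prod.ext (Equiv.ext fun v => ?_) (Equiv.ext fun v => ?_) <;>
    · simp only [splitInvolution, Equiv.coe_fn_mk, setOf_isAlternating_glue]
      change (if _ then _ else (Equiv.symm _) v) = _
      simp only [glue, Equiv.coe_fn_mk, Equiv.coe_fn_symm_mk]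
      split_ifs <;> simp_all
  · intro σ hσ
    ext v
    simp only [glue, Equiv.coe_fn_mk, colorings_splitInvolution]
    simp only [splitInvolution, Equiv.coe_fn_mk]
    split_ifs <;> simp_all
  · intro p hp
    obtain ⟨⟨h1, h2⟩, h3, h4⟩ := (hM p).1 hp
    have hc := hcol p hp
    rw [prod_lt_eq_prod_color hb h1 hc.1 false, prod_lt_eq_prod_color hb h3 hc.2 true, mul_comm,
      ← Finset.prod_filter_mul_prod_filter_not Finset.univ
        (fun v => pickColoring (colorings p.1 p.2) v = true)]
    congr 1
    · refine Finset.prod_congr rfl fun v hv => ?_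
      simp [glue, (Finset.mem_filter.1 hv).2]
    · refine Finset.prod_congr (by simp) fun v hv => ?_
      simp [glue, (Finset.mem_filter.1 hv).2]

end Bijection

open Classical in
/-- Perfect matchings correspond to the involutions moving every vertex along an edge. -/
theorem sum_matchings_eq_sum_involutions [LinearOrder V] [Fintype V] {R : Type*} [CommRing R]
    (b : Matrix V V R) (G : SimpleGraph V) {s : Finset (Finset (V × V))}
    (hs : ∀ β, β ∈ s ↔ (∀ p ∈ β, p.1 < p.2 ∧ G.Adj p.1 p.2) ∧
      ∀ v : V, ∃! p, p ∈ β ∧ (p.1 = v ∨ p.2 = v)) :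
    ∑ β ∈ s, ∏ p ∈ β, b p.1 p.2 =
      ∑ f : Equiv.Perm V with (∀ v, f (f v) = v) ∧ ∀ v, G.Adj v (f v),
        ∏ v with v < f v, b v (f v) := by
  symm
  refine Finset.sum_bij (fun f _ => Finset.univ.filter fun p : V × V => p.1 < p.2 ∧ f p.1 = p.2)
    ?_ ?_ ?_ ?_
  · intro f hf
    obtain ⟨hf, hadj⟩ := (Finset.mem_filter.1 hf).2
    simp only [hs, Finset.mem_filter, Finset.mem_univ, true_and]
    refine ⟨fun p hp => ⟨hp.1, hp.2 ▸ hadj p.1⟩, fun v => ?_⟩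
    rcases lt_or_gt_of_ne (hadj v).ne with h | h
    · refine ⟨(v, f v), by simp [h], ?_⟩
      rintro ⟨x, y⟩ ⟨⟨hxy, hy⟩, rfl | rfl⟩
      · simp_all
      · dsimp only at *
        subst hy
        rw [hf] at h
        exact absurd h hxy.asymm
    · refine ⟨(f v, v), by simp [h, hf], ?_⟩
      rintro ⟨x, y⟩ ⟨⟨hxy, hy⟩, rfl | rfl⟩
      · dsimp only at *
        subst hy
        exact absurd h hxy.asymm
      · dsimp only at *
        subst hy
        rw [hf]
  · intro f hf g hg hfg
    obtain ⟨hf, hadj⟩ := (Finset.mem_filter.1 hf).2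
    obtain ⟨hg, -⟩ := (Finset.mem_filter.1 hg).2
    have key : ∀ v, v < f v → g v = f v := fun v hv => by
      have := congrArg (fun s => (v, f v) ∈ s) hfg
      simpa [hv] using this
    ext v
    rcases lt_or_gt_of_ne (hadj v).ne with h | h
    · exact (key v h).symm
    · have := key (f v) (by rwa [hf])
      rw [hf] at this
      rw [← hg (f v), this]
  · intro β hβ
    obtain ⟨h1, h2⟩ := (hs β).1 hβ
    choose p hp hpu using h2
    let f : V → V := fun v => if (p v).1 = v then (p v).2 else (p v).1
    have hq : ∀ q ∈ β, f q.1 = q.2 ∧ f q.2 = q.1 := fun q hq => by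
      have e1 := hpu q.1 q ⟨hq, Or.inl rfl⟩
      have e2 := hpu q.2 q ⟨hq, Or.inr rfl⟩
      simp only [f]
      rw [← e1, ← e2, if_pos rfl, if_neg (h1 q hq).1.ne]
      exact ⟨rfl, rfl⟩
    have hinv : Function.Involutive f := fun v => by
      obtain ⟨hv, h | h⟩ := hp v
      · rw [← h, (hq _ hv).1, (hq _ hv).2]
      · rw [← h, (hq _ hv).2, (hq _ hv).1]
    refine ⟨hinv.toPerm, ?_, ?_⟩
    · simp only [Finset.mem_filter, Finset.mem_univ, true_and, Function.Involutive.coe_toPerm]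
      refine ⟨hinv, fun v => ?_⟩
      obtain ⟨hv, h | h⟩ := hp v
      · rw [← h, (hq _ hv).1]
        exact (h1 _ hv).2
      · rw [← h, (hq _ hv).2]
        exact (h1 _ hv).2.symm
    · refine Finset.ext fun ⟨x, y⟩ => ?_
      rw [Finset.mem_filter]
      simp only [Finset.mem_univ, true_and, Function.Involutive.coe_toPerm]
      constructor
      · rintro ⟨hxy, rfl⟩
        obtain ⟨hv, h | h⟩ := hp x
        · rw [← h, (hq _ hv).1]
          exact hv
        · rw [← h, (hq _ hv).2] at hxy
          exact absurd hxy (h1 _ hv).1.asymm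
      · exact fun h => ⟨(h1 _ h).1, (hq _ h).1⟩
  · intro f _
    refine Finset.prod_bij' (fun v _ => (v, f v)) (fun q _ => q.1) ?_ ?_ ?_ ?_ ?_
    · intro v hv
      simpa using hv
    · rintro q hq
      obtain ⟨h, h'⟩ := (Finset.mem_filter.1 hq).2
      simpa [h'] using h
    · simp
    · rintro ⟨x, y⟩ hq
      simpa using (Finset.mem_filter.1 hq).2.2
    · simp

/-- Every permutation with an alternating colouring along the edges of a graph with a Pfaffian
orientation contributes with positive sign. -/
theorem sign_mul_prod_eq_one [Fintype V] [DecidableEq V] {R : Type*} [CommRing R]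
    {G : SimpleGraph V} {ε : Matrix V V R}
    (hPf : ∀ (m : ℕ) (L : Fin m → ℕ) (F : (c : Fin m) → ZMod (L c + 2) → V),
      (∀ c, Even (L c)) →
      (∀ c, Function.Injective (F c)) →
      (∀ c (i : ZMod (L c + 2)), G.Adj (F c i) (F c (i + 1))) →
      Function.Bijective (fun p : Σ c : Fin m, ZMod (L c + 2) => F p.1 p.2) →
      ∀ c, -∏ i : ZMod (L c + 2), ε (F c i) (F c (i + 1)) = 1)
    {σ : Equiv.Perm V} {c : V → Bool} (hc : IsAlternating σ c) (hadj : ∀ v, G.Adj v (σ v)) :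
    ((sign σ : ℤ) : R) * ∏ v, ε v (σ v) = 1 := by
  have hne : ∀ v, σ v ≠ v := fun v => (hadj v).ne'
  let e := σ.cycleFactorsFinset.equivFin.symm
  have hcyc : ∀ p ∈ σ.cycleFactorsFinset, p.IsCycle := fun p hp =>
    (mem_cycleFactorsFinset_iff.1 hp).1
  have hon : ∀ p ∈ σ.cycleFactorsFinset, σ.IsCycleOn (p.support : Finset V) := fun p hp =>
    isCycleOn_support_of_mem_cycleFactorsFinset hp
  have heven : ∀ p ∈ σ.cycleFactorsFinset, Even p.support.card := fun p hp => by
    obtain ⟨x, hx⟩ := (hcyc p hp).nonempty_support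
    exact hc.even_of_pow_apply (((hon p hp).pow_apply_eq hx).2 dvd_rfl)
  choose r hr using fun k => (hcyc (e k) (e k).2).nonempty_support
  let L : Fin σ.cycleFactorsFinset.card → ℕ := fun k => (e k).1.support.card - 2
  have hL : ∀ k, L k + 2 = (e k).1.support.card := fun k =>
    Nat.sub_add_cancel (hcyc (e k) (e k).2).two_le_card_support
  let F : (k : Fin σ.cycleFactorsFinset.card) → ZMod (L k + 2) → V := fun k i =>
    (σ ^ i.val) (r k)
  have hFs : ∀ k i, F k (i + 1) = σ (F k i) := fun k i => by
    simp only [F]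
    rw [← mul_apply, ← pow_succ', (hon (e k) (e k).2).pow_apply_eq_pow_apply (hr k), ← hL k,
      ← ZMod.natCast_eq_natCast_iff]
    simp
  have hFmem : ∀ k i, F k i ∈ (e k).1.support := fun k i => by
    have := (hon (e k) (e k).2).1.mapsTo.perm_pow i.val (hr k)
    exact this
  have hFinj : ∀ k, Function.Injective (F k) := fun k i j hij => by
    simp only [F] at hij
    rw [(hon (e k) (e k).2).pow_apply_eq_pow_apply (hr k), ← hL k,
      ← ZMod.natCast_eq_natCast_iff] at hij
    simpa using hij
  have hFbij : Function.Bijective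
      (fun p : Σ k : Fin σ.cycleFactorsFinset.card, ZMod (L k + 2) => F p.1 p.2) := by
    constructor
    · rintro ⟨k, i⟩ ⟨l, j⟩ h
      dsimp only at h
      have hkl : k = l := by
        apply e.injective
        apply Subtype.ext
        rw [cycle_is_cycleOf (hFmem k i) (e k).2, cycle_is_cycleOf (hFmem l j) (e l).2, h]
      subst hkl
      rw [hFinj k h]
    · intro v
      have hv : σ.cycleOf v ∈ σ.cycleFactorsFinset :=
        cycleOf_mem_cycleFactorsFinset_iff.2 (mem_support.2 (hne v))
      obtain ⟨k, hk⟩ := e.surjective ⟨_, hv⟩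
      have hvk : v ∈ (e k).1.support := by
        rw [hk]
        exact mem_support_cycleOf_iff.2 ⟨SameCycle.refl _ _, mem_support.2 (hne v)⟩
      obtain ⟨i, hi, hiv⟩ := (hon (e k) (e k).2).exists_pow_eq (hr k) hvk
      refine ⟨⟨k, (i : ZMod (L k + 2))⟩, ?_⟩
      simp only [F]
      rw [ZMod.val_natCast_of_lt (by rwa [hL]), hiv]
  have hprod := hPf _ L F (fun k => by
      have := heven (e k) (e k).2
      rw [← hL] at this
      simpa [Nat.even_add] using this) hFinj (fun k i => by
      rw [hFs]
      exact hadj _) hFbij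
  have hε : ∏ v, ε v (σ v) = (-1) ^ σ.cycleFactorsFinset.card := by
    rw [← Equiv.prod_comp (Equiv.ofBijective _ hFbij), Fintype.prod_sigma]
    simp only [Equiv.ofBijective_apply, ← hFs]
    rw [Finset.prod_congr rfl fun k _ => neg_eq_iff_eq_neg.1 (hprod k)]
    simp
  have hsum : Even σ.cycleType.sum := even_iff_two_dvd.2 <| Multiset.dvd_sum fun k hk => by
    rw [cycleType_def, Multiset.mem_map] at hk
    obtain ⟨p, hp, rfl⟩ := hk
    exact (heven p hp).two_dvd
  have hcard : Multiset.card σ.cycleType = σ.cycleFactorsFinset.card := by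
    rw [cycleType_def, Multiset.card_map]; rfl
  rw [hε, sign_of_cycleType, hcard, pow_add, hsum.neg_one_pow, one_mul]
  push_cast
  rw [← mul_pow]
  simp

end Pfaffian

/-- De Bruijn's account of Kasteleyn's Pfaffian method: let `G` be a graph on
`{0, …, n-1}` with symmetric edge weights `b` (vanishing off the edges) and a
Pfaffian orientation `ε` (an antisymmetric ±1-valued matrix supported on the
edges such that in every circuit cover by even circuits each circuit
`[i₁, …, i_k]` has positive sign `-ε_{i₁i₂}ε_{i₂i₃}⋯ε_{i_ki₁} = 1`; circuit
covers are encoded by families `F c : ZMod (L c + 2) → Fin n` of injective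
cyclic sequences of adjacent vertices jointly enumerating all vertices).
Then the sum `S` of the weights `∏ b_{ij}` of all perfect matchings of `G`
satisfies `S ^ 2 = det A`, where `a_{ij} = ε_{ij} b_{ij}`. -/
theorem stmt18 {A : Type*} [CommRing A] (n : ℕ) (G : SimpleGraph (Fin n))
    (b ε : Matrix (Fin n) (Fin n) A)
    (hbsymm : ∀ i j, b i j = b j i)
    (hb0 : ∀ i j, ¬ G.Adj i j → b i j = 0)
    (hε1 : ∀ i j, G.Adj i j → ε i j = 1 ∨ ε i j = -1)
    (hεanti : ∀ i j, ε i j = -ε j i)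
    (hε0 : ∀ i j, ¬ G.Adj i j → ε i j = 0)
    (hPf : ∀ (m : ℕ) (L : Fin m → ℕ) (F : (c : Fin m) → ZMod (L c + 2) → Fin n),
      (∀ c, Even (L c)) →
      (∀ c, Function.Injective (F c)) →
      (∀ c (i : ZMod (L c + 2)), G.Adj (F c i) (F c (i + 1))) →
      Function.Bijective (fun p : Σ c : Fin m, ZMod (L c + 2) => F p.1 p.2) →
      ∀ c, -∏ i : ZMod (L c + 2), ε (F c i) (F c (i + 1)) = 1) :
    (∑ β ∈ @Finset.filter (Finset (Fin n × Fin n))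
        (fun β => (∀ p ∈ β, p.1 < p.2 ∧ G.Adj p.1 p.2) ∧
          ∀ v : Fin n, ∃! p, p ∈ β ∧ (p.1 = v ∨ p.2 = v))
        (Classical.decPred _) Finset.univ,
      ∏ p ∈ β, b p.1 p.2) ^ 2 =
      (Matrix.of fun i j => ε i j * b i j).det := by
  classical
  set a : Matrix (Fin n) (Fin n) A := Matrix.of fun i j => ε i j * b i j with ha
  have haanti : ∀ i j, a i j = -a j i := fun i j => by
    simp only [ha, Matrix.of_apply]
    rw [hεanti i j, hbsymm i j, neg_mul]
  have ha0 : ∀ i j, ¬ G.Adj i j → a i j = 0 := fun i j h => by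
    simp [ha, hε0 i j h]
  have hdet : a.det = ∑ σ : Equiv.Perm (Fin n), Equiv.Perm.sign σ • ∏ v, a v (σ v) := by
    rw [← Matrix.det_transpose, Matrix.det_apply]
    rfl
  rw [hdet, ← Finset.sum_filter_add_sum_filter_not Finset.univ
      (fun σ : Equiv.Perm (Fin n) => ∃ c, IsAlternating σ c),
    sum_not_isAlternating_eq_zero haanti (fun i => ha0 i i (G.irrefl)), add_zero,
    sum_matchings_eq_sum_involutions b G (fun β =>
      (@Finset.mem_filter _ _ (Classical.decPred _) _ _).trans (and_iff_right (Finset.mem_univ β))),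
    sq_sum_involutions G hbsymm]
  refine Finset.sum_subset_zero_on_sdiff (fun σ hσ => ?_) (fun σ hσ => ?_) fun σ hσ => ?_
  · simp only [Finset.mem_filter, Finset.mem_univ, true_and] at hσ ⊢
    exact hσ.1
  · simp only [Finset.mem_sdiff, Finset.mem_filter, Finset.mem_univ, true_and, not_and,
      not_forall] at hσ
    obtain ⟨v, hv⟩ := hσ.2 hσ.1
    rw [Finset.prod_eq_zero (Finset.mem_univ v) (ha0 v (σ v) hv), smul_zero]
  · simp only [Finset.mem_filter, Finset.mem_univ, true_and] at hσ
    obtain ⟨⟨c, hc⟩, hadj⟩ := hσ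
    simp only [ha, Matrix.of_apply, Finset.prod_mul_distrib]
    rw [Units.smul_def, zsmul_eq_mul, ← mul_assoc, sign_mul_prod_eq_one hPf hc hadj, one_mul]
end

section
/- Pólya's fundamental theorem: Let G be a finite group acting on a finite set D, let R be a finite set of colors, and let ω : R → A be a weight function into a commutative ring A. For a coloring f : D → R define its weight Ω(f) = ∏_{d ∈ D} ω(f(d)). Let G act on the colorings R^D by (g·f)(d) = f(g⁻¹·d); then Ω is constant on orbits, and the weight of an orbit (color pattern) is the weight of any of its elements. Then |G| times the sum of the weights of all orbits of G on R^D equals Σ_{g ∈ G} ∏_{j ≥ 1} (Σ_{r ∈ R} ω(r)^j)^{b_j(g)}, where b_j(g) is the number of cycles of length j of the permutation of D induced by g. -/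
open Finset Function Equiv.Perm

/-- The number of points in the cycle of `σ` through `x` is the minimal period of `x`. -/
theorem card_filter_sameCycle_eq_minimalPeriod {D : Type*} [Fintype D] (σ : Equiv.Perm D)
    (x : D) [DecidablePred (σ.SameCycle x)] :
    #{y | σ.SameCycle x y} = minimalPeriod σ x := by
  classical
  have h := MulAction.minimalPeriod_eq_card σ x
  have hσ : (fun y : D => σ • y) = σ := rfl
  rw [hσ] at h
  rw [h, ← Fintype.card_subtype]
  refine Fintype.card_congr (Equiv.subtypeEquivRight fun y => ?_)
  simp only [MulAction.mem_orbit_iff, Subgroup.exists_zpowers]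
  rfl

/-- A function invariant under a permutation is constant on its cycles. -/
theorem apply_eq_of_sameCycle {D R : Type*} {σ : Equiv.Perm D} {f : D → R}
    (hf : ∀ d, f (σ d) = f d) {x y : D} (h : σ.SameCycle x y) : f x = f y := by
  obtain ⟨i, rfl⟩ := h
  induction i with
  | zero => rfl
  | succ i ih => rw [ih, add_comm, zpow_add, zpow_one, Equiv.Perm.mul_apply, hf]
  | pred i ih =>
    rw [ih, ← hf ((σ ^ (-(i : ℤ) - 1)) x), ← Equiv.Perm.mul_apply, ← zpow_one_add]
    congr 3
    ring

/-- The functions invariant under a permutation are the functions on its set of cycles. -/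
def invariantFunctionsEquiv {D : Type*} (R : Type*) (σ : Equiv.Perm D) :
    {f : D → R // ∀ d, f (σ d) = f d} ≃ (Quotient (SameCycle.setoid σ) → R) where
  toFun f := Quotient.lift f.1 fun _ _ h => apply_eq_of_sameCycle f.2 h
  invFun h := ⟨fun d => h (Quotient.mk _ d), fun d =>
    congrArg h (Quotient.sound (s := SameCycle.setoid σ) (sameCycle_apply_left.2 (.refl σ d)))⟩
  left_inv _ := rfl
  right_inv _ := funext fun q => Quotient.inductionOn q fun _ => rfl

open scoped Classical in
/-- The total weight of the colorings fixed by a permutation with `c j` cycles of length `j`. -/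
theorem sum_weight_invariant {D R A : Type*} [Fintype D] [Fintype R] [CommRing A]
    (σ : Equiv.Perm D) (ω : R → A) (c : ℕ → ℕ)
    (hc : ∀ j, c j * j = #{d : D | minimalPeriod σ d = j}) :
    ∑ f : D → R with ∀ d, f (σ d) = f d, ∏ d, ω (f d) =
      ∏ j ∈ Icc 1 (Fintype.card D), (∑ r, ω r ^ j) ^ c j := by
  let mk : D → Quotient (SameCycle.setoid σ) := Quotient.mk _
  let len : Quotient (SameCycle.setoid σ) → ℕ := fun q => #{d | mk d = q}
  have hlen (d : D) : len (mk d) = minimalPeriod σ d := by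
    rw [← card_filter_sameCycle_eq_minimalPeriod]
    refine congrArg card (filter_congr fun y _ => ?_)
    exact Quotient.eq.trans sameCycle_comm
  have hlen_mem (q : Quotient (SameCycle.setoid σ)) : len q ∈ Icc 1 (Fintype.card D) := by
    induction q using Quotient.inductionOn with | _ d
    exact mem_Icc.2 ⟨card_pos.2 ⟨d, by simp [mk]⟩, card_le_univ _⟩
  have hcount (j : ℕ) (hj : 1 ≤ j) : #{q | len q = j} = c j := by
    refine Nat.eq_of_mul_eq_mul_right hj ?_
    rw [hc, card_eq_sum_card_fiberwise (f := mk) (t := {q | len q = j})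
      (fun d hd => by simpa [hlen] using hd), ← smul_eq_mul, ← sum_const]
    refine sum_congr rfl fun q hq => ?_
    rw [mem_filter_univ] at hq
    rw [← hq, filter_filter]
    refine congrArg card (filter_congr fun d _ => ?_)
    constructor
    · rintro rfl
      exact ⟨(hlen d).symm, rfl⟩
    · exact And.right
  calc
    _ = ∑ f : {f : D → R // ∀ d, f (σ d) = f d}, ∏ d, ω (f.1 d) :=
      sum_subtype _ (by simp) _
    _ = ∑ h : Quotient (SameCycle.setoid σ) → R, ∏ d, ω (h (mk d)) :=
      Fintype.sum_equiv (invariantFunctionsEquiv R σ) _ _ fun _ => rfl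
    _ = ∑ h : Quotient (SameCycle.setoid σ) → R, ∏ q, ω (h q) ^ len q := by
      refine sum_congr rfl fun h _ => ?_
      rw [← prod_fiberwise univ mk]
      refine prod_congr rfl fun q _ => prod_eq_pow_card fun d hd => ?_
      rw [(mem_filter.1 hd).2]
    _ = ∏ q, ∑ r, ω r ^ len q := (Fintype.prod_sum fun q r => ω r ^ len q).symm
    _ = _ := by
      rw [← prod_fiberwise_of_maps_to fun q _ => hlen_mem q]
      refine prod_congr rfl fun j hj => ?_
      rw [← hcount j (mem_Icc.1 hj).1]
      refine prod_eq_pow_card fun q hq => ?_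
      rw [(mem_filter.1 hq).2]

/-- Weighted Burnside lemma, for an invariant weight and a transversal of the orbits. -/
theorem card_mul_sum_transversal {G X A : Type*} [Group G] [Fintype G] [Fintype X] [DecidableEq X]
    [CommRing A] [MulAction G X] (W : X → A) (hW : ∀ (g : G) x, W (g • x) = W x) (reps : Finset X)
    (hreps : ∀ x, ∃! y, y ∈ reps ∧ ∃ g : G, y = g • x) :
    (Fintype.card G : A) * ∑ x ∈ reps, W x = ∑ g : G, ∑ x with g • x = x, W x := by
  have key (x : X) : ∑ y ∈ reps, ∑ g : G with g • y = x, W y = ∑ g : G with g • x = x, W x := by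
    obtain ⟨_, ⟨hy, a, rfl⟩, huniq⟩ := hreps x
    rw [sum_eq_single_of_mem _ hy]
    · simp only [hW, sum_const]
      congr 1
      refine card_equiv (Equiv.mulRight a) fun g => ?_
      simp [mul_smul]
    · intro y hy' hne
      refine sum_eq_zero fun g hg => absurd (huniq y ⟨hy', g⁻¹, ?_⟩) hne
      rw [← (mem_filter.1 hg).2, inv_smul_smul]
  calc
    _ = ∑ y ∈ reps, ∑ g : G, W y := by simp [mul_sum]
    _ = ∑ y ∈ reps, ∑ x, ∑ g : G with g • y = x, W y := by simp only [sum_fiberwise]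
    _ = ∑ x, ∑ g : G with g • x = x, W x := by rw [sum_comm]; exact sum_congr rfl fun x _ => key x
    _ = _ := by simp only [sum_filter]; rw [sum_comm]

/-- The action `(g • f) d = f (π g⁻¹ d)` on colorings. -/
abbrev coloringAction {G D : Type*} (R : Type*) [Group G] (π : G →* Equiv.Perm D) :
    MulAction G (D → R) where
  smul g f d := f (π g⁻¹ d)
  one_smul f := funext fun d => show f (π 1⁻¹ d) = f d by simp
  mul_smul g h f := funext fun d => show f (π (g * h)⁻¹ d) = f (π h⁻¹ (π g⁻¹ d)) by simp

/-- Pólya's fundamental theorem: a finite group `G` acts on a finite set `D`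
via `π : G →* Equiv.Perm D`, inducing an action on colourings `f : D → R` by
`(g • f) d = f (π g⁻¹ d)`. Let `ω : R → A` be a weight function into a
commutative ring, with the weight of a colouring being `∏ d, ω (f d)`, and
let `b g j` be the number of cycles of length `j` of the permutation `π g`
(so `b g j * j` counts the points of minimal period `j`). Then for any system
`reps` of representatives of the orbits (colour patterns), `|G|` times the
sum of the weights of the orbits equals
`Σ_g ∏_j (Σ_r ω r ^ j) ^ (b g j)`. -/
theorem stmt19 {G D R A : Type*} [Group G] [Fintype G] [Fintype D] [Fintype R]
    [CommRing A]
    (π : G →* Equiv.Perm D) (ω : R → A) (b : G → ℕ → ℕ)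
    (hb : ∀ g j, b g j * j =
      (Finset.univ.filter fun d : D => Function.minimalPeriod (⇑(π g)) d = j).card)
    (reps : Finset (D → R))
    (hreps : ∀ f : D → R, ∃! f', f' ∈ reps ∧ ∃ g : G, ∀ d, f' d = f ((π g⁻¹) d)) :
    (Fintype.card G : A) * ∑ f ∈ reps, ∏ d : D, ω (f d) =
      ∑ g : G, ∏ j ∈ Finset.Icc 1 (Fintype.card D),
        (∑ r : R, ω r ^ j) ^ b g j := by
  classical
  let _ := coloringAction R π
  have smul_def (g : G) (f : D → R) : g • f = fun d => f (π g⁻¹ d) := rfl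
  rw [card_mul_sum_transversal (G := G) (fun f => ∏ d, ω (f d))
    (fun g f => Equiv.prod_comp (π g⁻¹) fun d => ω (f d)) reps
    (by simpa only [smul_def, funext_iff] using hreps)]
  refine sum_congr rfl fun g _ => ?_
  rw [← sum_weight_invariant (π g) ω (b g) (hb g)]
  refine sum_congr (filter_congr fun f _ => ?_) fun _ _ => rfl
  rw [smul_def, funext_iff]
  refine (π g).forall_congr_right.symm.trans ?_
  simp [eq_comm]
end
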